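/- Let n ∈ ℕ, E a complex Banach space, n/(n+1) < p ≤ ∞, 0 < q ≤ ∞, s > σ_p, d > 1, and K ∈ ℕ₀ with K ≥ 1 + ⌊s⌋. Then an f ∈ S'(ℝ^n,E) belongs to B^s_{p,q}(E) if and only if there exist coefficients λ = {λ_{ν,m}} ∈ b_{p,q} and functions a_{ν,m} : ℝ^n → E, where each a_{0,m} is an E-valued 1_K-atom supported in d·Q_{0,m} and each a_{ν,m} (ν ≥ 1) is an E-valued (s,p)_{K,−1}-atom associated with Q_{ν,m} (i.e. no moment conditions), such that f = Σ_{ν=0}^∞ Σ_{m∈ℤ^n} λ_{ν,m} a_{ν,m} with convergence in S'(ℝ^n,E). Moreover, ‖f|B^s_{p,q}(E)‖ is equivalent to inf ‖λ|b_{p,q}‖, the infimum taken over all such admissible representations of f: there are constants c₁, c₂ > 0 independent of f with c₁ ‖f|B^s_{p,q}(E)‖ ≤ inf ‖λ|b_{p,q}‖ ≤ c₂ ‖f|B^s_{p,q}(E)‖. -/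

import Mathlib

noncomputable section

open MeasureTheory Filter Metric Real Set SchwartzMap
open scoped ENNReal NNReal Topology FourierTransform

/-- Euclidean space ℝⁿ. -/
abbrev Rn (n : ℕ) : Type := EuclideanSpace ℝ (Fin n)

/-- The Schwartz space 𝓢(ℝⁿ, ℂ). -/
abbrev Sch (n : ℕ) : Type := SchwartzMap (Rn n) ℂ

/-- Partial derivative in the `i`-th coordinate direction. -/
def pd {F : Type*} [NormedAddCommGroup F] [NormedSpace ℝ F] {n : ℕ} (i : Fin n)
    (g : Rn n → F) : Rn n → F :=
  fun x => lineDeriv ℝ g x (EuclideanSpace.single i (1 : ℝ))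

/-- Multi-index derivative `D^α = ∂₁^{α₁} ⋯ ∂ₙ^{αₙ}`. -/
def mderiv {F : Type*} [NormedAddCommGroup F] [NormedSpace ℝ F] {n : ℕ} (α : Fin n → ℕ)
    (g : Rn n → F) : Rn n → F :=
  (List.finRange n).foldr (fun i h => (pd i)^[α i] h) g

/-- The order `|α|` of a multi-index. -/
def mdeg {n : ℕ} (α : Fin n → ℕ) : ℕ := ∑ i, α i

/-- The Schwartz seminorm `‖φ‖_{K,L} = sup_x (1+|x|²)^{K/2} ∑_{|α| ≤ L} |D^α φ(x)|`. -/
def schSemi {n : ℕ} (K L : ℕ) (φ : Sch n) : ℝ :=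
  ⨆ x : Rn n, (1 + ‖x‖ ^ 2) ^ ((K : ℝ) / 2) *
    ∑ α : Fin n → Fin (L + 1), if mdeg (fun i => (α i : ℕ)) ≤ L
      then ‖mderiv (fun i => (α i : ℕ)) (fun y => φ y) x‖ else 0

/-- `E`-valued tempered distributions: linear maps `𝓢(ℝⁿ) → E` bounded by some
Schwartz seminorm. -/
structure TDist (n : ℕ) (E : Type*) [NormedAddCommGroup E] [NormedSpace ℂ E] where
  toFun : Sch n →ₗ[ℂ] E
  bound : ∃ (c : ℝ) (K L : ℕ), ∀ φ : Sch n, ‖toFun φ‖ ≤ c * schSemi K L φ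

namespace Aux

lemma hasTemperateGrowth_sub_left {n : ℕ} (x : Rn n) :
    Function.HasTemperateGrowth (fun y : Rn n => x - y) := by
  apply Function.HasTemperateGrowth.of_fderiv (k := 1) (C := ‖x‖ + 1)
  · have h : (fderiv ℝ (fun y : Rn n => x - y)) =
        fun _ : Rn n => -(ContinuousLinearMap.id ℝ (Rn n)) := by
      ext1 y
      rw [fderiv_const_sub]
      simp
    rw [h]
    exact .const _
  · exact (differentiable_const x).sub differentiable_id
  · intro y
    have h1 : ‖x - y‖ ≤ ‖x‖ + ‖y‖ := norm_sub_le x y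
    have h2 : (0:ℝ) ≤ ‖y‖ := norm_nonneg y
    have h3 : (0:ℝ) ≤ ‖x‖ := norm_nonneg x
    calc ‖x - y‖ ≤ ‖x‖ + ‖y‖ := h1
      _ ≤ (‖x‖ + 1) * (1 + ‖y‖) ^ 1 := by nlinarith

lemma antilipschitz_sub_left {n : ℕ} (x : Rn n) :
    AntilipschitzWith 1 (fun y : Rn n => x - y) := by
  refine (Isometry.antilipschitz ?_)
  intro y z
  simp only [edist_dist, dist_eq_norm, sub_sub_sub_cancel_left, norm_sub_rev]

end Aux

/-- The Schwartz function `y ↦ ψ(x - y)`. -/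
def shiftReflect {n : ℕ} (ψ : Sch n) (x : Rn n) : Sch n :=
  SchwartzMap.compCLMOfAntilipschitz (𝕜 := ℝ)
    (Aux.hasTemperateGrowth_sub_left x) (Aux.antilipschitz_sub_left x) ψ

/-- The dilated Schwartz function `ψ(t ·)` (junk value `0` when `t = 0`). -/
def dilate {n : ℕ} (ψ : Sch n) (t : ℝ) : Sch n :=
  if h : t = 0 then 0 else
    SchwartzMap.compCLM (𝕜 := ℝ) (g := fun y : Rn n => t • y)
      (by
        have := (t • ContinuousLinearMap.id ℝ (Rn n)).hasTemperateGrowth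
        exact this)
      (⟨1, |t|⁻¹, fun y => by
        have ht : 0 < |t| := abs_pos.mpr h
        have : ‖t • y‖ = |t| * ‖y‖ := by rw [norm_smul]; simp [Real.norm_eq_abs]
        rw [pow_one, this]
        rw [mul_add, mul_one]
        have : |t|⁻¹ * (|t| * ‖y‖) = ‖y‖ := by field_simp
        nlinarith [norm_nonneg y, inv_pos.mpr ht]⟩) ψ

/-- Fourier transform on Schwartz space. -/
def fourierS {n : ℕ} (φ : Sch n) : Sch n := FourierTransform.fourierCLE ℂ (Sch n) φ

/-- Inverse Fourier transform on Schwartz space. -/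
def invFourierS {n : ℕ} (φ : Sch n) : Sch n := (FourierTransform.fourierCLE ℂ (Sch n)).symm φ

variable {n : ℕ} {E : Type*} [NormedAddCommGroup E] [NormedSpace ℂ E]

/-- Convolution `(ψ * f)(x) := (2π)^{-n/2} f(ψ(x - ·))` of a Schwartz function with an
`E`-valued tempered distribution. -/
def tdConv (ψ : Sch n) (f : TDist n E) : Rn n → E :=
  fun x => ((2 * π) ^ (-(n : ℝ) / 2) : ℝ) • f.toFun (shiftReflect ψ x)

/-- The operator `f ↦ (φ f̂)ˇ = φ̌ * f`. -/
def mOp (φ : Sch n) (f : TDist n E) : Rn n → E := tdConv (invFourierS φ) f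

/-- `L_p`-norm (in `[0,∞]`) of an `ℝ≥0∞`-valued function. -/
def lpNormENN {n : ℕ} (p : ℝ≥0∞) (g : Rn n → ℝ≥0∞) : ℝ≥0∞ :=
  if p = ∞ then essSup g volume else (∫⁻ x, (g x) ^ p.toReal) ^ (1 / p.toReal)

/-- `ℓ_q`-norm (in `[0,∞]`) of a sequence, with the usual modification for `q = ∞`. -/
def lqSum (q : ℝ≥0∞) (a : ℕ → ℝ≥0∞) : ℝ≥0∞ :=
  if q = ∞ then ⨆ j, a j else (∑' j, (a j) ^ q.toReal) ^ (1 / q.toReal)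

/-- A smooth dyadic resolution of unity. -/
structure SmoothResolution (n : ℕ) (φ : ℕ → Sch n) : Prop where
  supp0 : Function.support (φ 0) ⊆ {ξ : Rn n | ‖ξ‖ ≤ 2}
  suppj : ∀ j : ℕ, 0 < j →
    Function.support (φ j) ⊆ {ξ : Rn n | 2 ^ ((j : ℝ) - 1) ≤ ‖ξ‖ ∧ ‖ξ‖ ≤ 2 ^ ((j : ℝ) + 1)}
  sum_eq : ∀ ξ : Rn n, ∑' j : ℕ, φ j ξ = 1
  deriv_bound : ∀ α : Fin n → ℕ, ∃ c : ℝ, ∀ (j : ℕ) (ξ : Rn n),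
    ‖mderiv α (fun y => φ j y) ξ‖ ≤ c * 2 ^ (-(j : ℝ) * (mdeg α : ℝ))

/-- The Besov quasi-norm `‖f | B^s_{p,q}(E)‖` w.r.t. the resolution of unity `φ`. -/
def besovNorm (s : ℝ) (p q : ℝ≥0∞) (φ : ℕ → Sch n) (f : TDist n E) : ℝ≥0∞ :=
  lqSum q fun j => (2 : ℝ≥0∞) ^ ((j : ℝ) * s) * eLpNorm (mOp (φ j) f) p volume

/-- The Triebel–Lizorkin quasi-norm `‖f | F^s_{p,q}(E)‖` w.r.t. the resolution of unity `φ`. -/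
def triebelNorm (s : ℝ) (p q : ℝ≥0∞) (φ : ℕ → Sch n) (f : TDist n E) : ℝ≥0∞ :=
  lpNormENN p fun x =>
    lqSum q fun j => (2 : ℝ≥0∞) ^ ((j : ℝ) * s) * (‖mOp (φ j) f x‖₊ : ℝ≥0∞)

/-- The closed cube `d·Q_{ν,m}` with centre `2^{-ν}m` and side length `d·2^{-ν}`. -/
def dQ {n : ℕ} (d : ℝ) (ν : ℕ) (m : Fin n → ℤ) : Set (Rn n) :=
  {x : Rn n | ∀ i, |x i - 2 ^ (-(ν : ℝ)) * (m i : ℝ)| ≤ d * 2 ^ (-(ν : ℝ)) / 2}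

/-- The lattice point `m ∈ ℤⁿ` as a point of `ℝⁿ`. -/
def zpt {n : ℕ} (m : Fin n → ℤ) : Rn n := WithLp.toLp 2 fun i => (m i : ℝ)

/-- `σ_p = n(1/p - 1)_+`. -/
def sigmaP (n : ℕ) (p : ℝ≥0∞) : ℝ := max ((n : ℝ) * (1 / p.toReal - 1)) 0

/-- `σ_{p,q} = n(1/min(p,q) - 1)_+`. -/
def sigmaPQ (n : ℕ) (p q : ℝ≥0∞) : ℝ := max ((n : ℝ) * (1 / (min p q).toReal - 1)) 0

/-- An `E`-valued `1_K`-atom supported in `d·Q_{0,m}`. -/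
def Is1Atom {n : ℕ} {E : Type*} [NormedAddCommGroup E] [NormedSpace ℝ E]
    (K : ℕ) (d : ℝ) (m : Fin n → ℤ) (a : Rn n → E) : Prop :=
  ContDiff ℝ K a ∧ Function.support a ⊆ dQ d 0 m ∧
    ∀ α : Fin n → ℕ, mdeg α ≤ K → ∀ x, ‖mderiv α a x‖ ≤ 1

/-- An `E`-valued `(s,p)_{K,L}`-atom associated with the cube `Q_{ν,m}` (support in
`d·Q_{ν,m}`, derivative bounds, and moment conditions up to order `L`). -/
def IsSPAtom {n : ℕ} {E : Type*} [NormedAddCommGroup E] [NormedSpace ℝ E]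
    (s : ℝ) (p : ℝ≥0∞) (K : ℕ) (L : ℤ) (d : ℝ) (ν : ℕ) (m : Fin n → ℤ)
    (a : Rn n → E) : Prop :=
  ContDiff ℝ K a ∧ Function.support a ⊆ dQ d ν m ∧
    (∀ α : Fin n → ℕ, mdeg α ≤ K → ∀ x,
      ‖mderiv α a x‖ ≤ 2 ^ (-(ν : ℝ) * (s - (n : ℝ) / p.toReal) + (mdeg α : ℝ) * (ν : ℝ))) ∧
    ∀ β : Fin n → ℕ, (mdeg β : ℤ) ≤ L →
      (∫ x : Rn n, (∏ i, (x i) ^ (β i)) • a x) = 0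

/-- The sequence space norm `‖λ|b_{p,q}‖`. -/
def bNorm {n : ℕ} (p q : ℝ≥0∞) (lam : ℕ → (Fin n → ℤ) → ℂ) : ℝ≥0∞ :=
  lqSum q fun ν =>
    if p = ∞ then ⨆ m : Fin n → ℤ, (‖lam ν m‖₊ : ℝ≥0∞)
    else (∑' m : Fin n → ℤ, (‖lam ν m‖₊ : ℝ≥0∞) ^ p.toReal) ^ (1 / p.toReal)

open Classical in
/-- The `L_p`-normalised characteristic function `χ^{(p)}_{ν,m}` of `Q_{ν,m}`. -/
def chiP {n : ℕ} (p : ℝ≥0∞) (ν : ℕ) (m : Fin n → ℤ) (x : Rn n) : ℝ≥0∞ :=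
  if x ∈ dQ 1 ν m then (2 : ℝ≥0∞) ^ ((ν : ℝ) * (n : ℝ) / p.toReal) else 0

/-- The sequence space norm `‖λ|f_{p,q}‖`. -/
def fNorm {n : ℕ} (p q : ℝ≥0∞) (lam : ℕ → (Fin n → ℤ) → ℂ) : ℝ≥0∞ :=
  lpNormENN p fun x =>
    if q = ∞ then ⨆ (ν : ℕ) (m : Fin n → ℤ), (‖lam ν m‖₊ : ℝ≥0∞) * chiP p ν m x
    else (∑' (ν : ℕ) (m : Fin n → ℤ),
      ((‖lam ν m‖₊ : ℝ≥0∞) * chiP p ν m x) ^ q.toReal) ^ (1 / q.toReal)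

/-- `f = ∑_{ν,m} λ_{ν,m} a_{ν,m}` with unconditional convergence in `S'(ℝⁿ,E)`:
for every test function the pairings sum to `f(φ)`. -/
def RepresentsAtomic {n : ℕ} {E : Type*} [NormedAddCommGroup E] [NormedSpace ℂ E]
    (f : TDist n E) (lam : ℕ → (Fin n → ℤ) → ℂ)
    (a : ℕ → (Fin n → ℤ) → Rn n → E) : Prop :=
  ∀ φ : Sch n, HasSum
    (fun νm : ℕ × (Fin n → ℤ) => lam νm.1 νm.2 • ∫ x : Rn n, φ x • a νm.1 νm.2 x)
    (f.toFun φ)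

/-- The set of coefficient norms `‖λ|b_{p,q}‖` over all admissible atomic
representations of `f` (atoms without moment conditions, `L = -1`). -/
def atomRepSetB {n : ℕ} {E : Type*} [NormedAddCommGroup E] [NormedSpace ℂ E]
    (s : ℝ) (p q : ℝ≥0∞) (K : ℕ) (d : ℝ) (f : TDist n E) : Set ℝ≥0∞ :=
  {r | ∃ (lam : ℕ → (Fin n → ℤ) → ℂ) (a : ℕ → (Fin n → ℤ) → Rn n → E),
    (∀ m, Is1Atom K d m (a 0 m)) ∧
    (∀ ν m, 0 < ν → IsSPAtom s p K (-1) d ν m (a ν m)) ∧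
    bNorm p q lam < ∞ ∧ RepresentsAtomic f lam a ∧ r = bNorm p q lam}

open scoped LineDeriv

/-- basis vector -/
abbrev eb {n : ℕ} (i : Fin n) : Rn n := EuclideanSpace.single i (1 : ℝ)

lemma eb_norm {n : ℕ} (i : Fin n) : ‖eb i‖ = 1 := by simp [eb]

/-- flattened index list of a multi-index -/
def flatIdx {n : ℕ} (α : Fin n → ℕ) : List (Fin n) :=
  (List.finRange n).flatMap (fun i => List.replicate (α i) i)

lemma foldr_replicate_iter {β γ : Type*} (f : β → γ → γ) (k : ℕ) (i : β) (g : γ) :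
    (List.replicate k i).foldr f g = (f i)^[k] g := by
  induction k with
  | zero => rfl
  | succ k ih => rw [List.replicate_succ, List.foldr_cons, ih, Function.iterate_succ_apply']

lemma foldr_flat {β γ : Type*} (f : β → γ → γ) (α : β → ℕ) (l : List β) (g : γ) :
    l.foldr (fun i h => (f i)^[α i] h) g
      = (l.flatMap (fun i => List.replicate (α i) i)).foldr f g := by
  induction l with
  | nil => rfl
  | cons a l ih =>
    rw [List.foldr_cons, List.flatMap_cons, List.foldr_append, foldr_replicate_iter, ih]

lemma mderiv_eq_flat {F : Type*} [NormedAddCommGroup F] [NormedSpace ℝ F] {n : ℕ}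
    (α : Fin n → ℕ) (g : Rn n → F) : mderiv α g = (flatIdx α).foldr pd g :=
  foldr_flat _ _ _ _

lemma flatIdx_length {n : ℕ} (α : Fin n → ℕ) : (flatIdx α).length = mdeg α := by
  simp only [flatIdx, List.length_flatMap, List.length_replicate, mdeg]
  rw [← List.sum_ofFn, List.ofFn_eq_map]

lemma flatIdx_count {n : ℕ} (α : Fin n → ℕ) (i : Fin n) : (flatIdx α).count i = α i := by
  have h : ∀ l : List (Fin n), l.Nodup →
      (l.flatMap (fun i => List.replicate (α i) i)).count i = if i ∈ l then α i else 0 := by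
    intro l hl
    induction l with
    | nil => simp
    | cons a l ih =>
      rw [List.flatMap_cons, List.count_append, ih hl.of_cons, List.count_replicate]
      have := hl.notMem
      by_cases h1 : a = i
      · subst h1; simp [this]
      · have h2 : ¬ i = a := fun h => h1 h.symm
        simp [h1, h2]
  have := h (List.finRange n) (List.nodup_finRange n)
  rw [if_pos (List.mem_finRange i)] at this
  exact this

lemma pd_list_eq {F : Type*} [NormedAddCommGroup F] [NormedSpace ℝ F] {n : ℕ}
    (L : List (Fin n)) (g : Rn n → F) (hg : ContDiff ℝ L.length g) :
    L.foldr pd g = fun x => iteratedFDeriv ℝ L.length g x (fun j => eb (L.get j)) := by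
  induction L with
  | nil => ext x; simp
  | cons a L ih =>
    have hg' : ContDiff ℝ L.length g := hg.of_le (by simp)
    rw [List.foldr_cons, ih hg']
    ext x
    have hd : DifferentiableAt ℝ (iteratedFDeriv ℝ L.length g) x :=
      hg.differentiable_iteratedFDeriv (by
        simp only [List.length_cons]; exact_mod_cast Nat.lt_succ_self _) x
    unfold pd
    rw [DifferentiableAt.lineDeriv_eq_fderiv]
    · rw [fderiv_continuousMultilinear_apply_const_apply hd]
      simp only [List.length_cons]
      rw [iteratedFDeriv_succ_apply_left]
      rfl
    · exact hd.continuousMultilinear_apply_const _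

lemma norm_pd_list_le {F : Type*} [NormedAddCommGroup F] [NormedSpace ℝ F] {n : ℕ}
    (L : List (Fin n)) (g : Rn n → F) (hg : ContDiff ℝ L.length g) (x : Rn n) :
    ‖L.foldr pd g x‖ ≤ ‖iteratedFDeriv ℝ L.length g x‖ := by
  rw [pd_list_eq L g hg]
  refine (ContinuousMultilinearMap.le_opNorm _ _).trans ?_
  simp

lemma norm_mderiv_le {F : Type*} [NormedAddCommGroup F] [NormedSpace ℝ F] {n : ℕ}
    (α : Fin n → ℕ) (g : Rn n → F) (hg : ContDiff ℝ (mdeg α) g) (x : Rn n) :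
    ‖mderiv α g x‖ ≤ ‖iteratedFDeriv ℝ (mdeg α) g x‖ := by
  rw [mderiv_eq_flat]
  rw [← flatIdx_length] at hg ⊢
  exact norm_pd_list_le _ g hg x

open LineDeriv in
/-- iterated directional derivative on Schwartz space -/
def dlS {n : ℕ} (L : List (Fin n)) (φ : Sch n) : Sch n :=
  L.foldr (fun i ψ => ∂_{eb i} ψ) φ

lemma dlS_coe {n : ℕ} (L : List (Fin n)) (φ : Sch n) :
    (⇑(dlS L φ) : Rn n → ℂ) = L.foldr pd (⇑φ) := by
  induction L with
  | nil => rfl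
  | cons a L ih =>
    rw [List.foldr_cons, ← ih]
    ext x
    exact SchwartzMap.lineDerivOp_apply _ _ _

lemma mderiv_sch {n : ℕ} (α : Fin n → ℕ) (φ : Sch n) :
    mderiv α (⇑φ) = ⇑(dlS (flatIdx α) φ) := by
  rw [mderiv_eq_flat, dlS_coe]

open LineDeriv in
lemma lineDeriv_comm_sch {n : ℕ} (u v : Rn n) (φ : Sch n) : ∂_{u} (∂_{v} φ) = ∂_{v} (∂_{u} φ) := by
  ext x
  have h1 : ∀ (u v : Rn n), (∂_{u} (∂_{v} φ)) x = fderiv ℝ (fderiv ℝ φ) x u v := by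
    intro u v
    rw [SchwartzMap.lineDerivOp_apply_eq_fderiv]
    have : (⇑(∂_{v} φ : Sch n) : Rn n → ℂ) = fun y => fderiv ℝ φ y v := by
      ext y; rw [SchwartzMap.lineDerivOp_apply_eq_fderiv]
    rw [this]
    have hd : DifferentiableAt ℝ (fderiv ℝ φ) x :=
      ((φ.smooth 2).fderiv_right (m := 1) (by norm_num)).differentiable (by norm_num) x
    rw [fderiv_clm_apply hd (differentiableAt_const v)]
    simp
  rw [h1, h1]
  have hs : IsSymmSndFDerivAt ℝ (⇑φ) x :=
    (φ.contDiffAt 2).isSymmSndFDerivAt (by simp)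
  exact hs _ _

lemma dlS_perm {n : ℕ} {L L' : List (Fin n)} (h : L.Perm L') (φ : Sch n) : dlS L φ = dlS L' φ := by
  unfold dlS
  have : LeftCommutative (fun (i : Fin n) (ψ : Sch n) => LineDeriv.lineDerivOp (eb i) ψ) :=
    ⟨fun a b c => lineDeriv_comm_sch _ _ _⟩
  exact h.foldr_eq _

lemma dlS_eq_mderiv {n : ℕ} (L : List (Fin n)) (φ : Sch n) :
    (⇑(dlS L φ) : Rn n → ℂ) = mderiv (fun i => L.count i) (⇑φ) := by
  rw [mderiv_sch, dlS_perm]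
  rw [List.perm_iff_count]
  intro a
  rw [flatIdx_count]

lemma multilin_norm_le_sum {F : Type*} [NormedAddCommGroup F] [NormedSpace ℝ F] {n k : ℕ}
    (T : ContinuousMultilinearMap ℝ (fun _ : Fin k => Rn n) F) :
    ‖T‖ ≤ ∑ I : Fin k → Fin n, ‖T (fun j => eb (I j))‖ := by
  refine ContinuousMultilinearMap.opNorm_le_bound (by positivity) ?_
  intro v
  have hv : v = fun j => ∑ i : Fin n, (v j i) • eb i := by
    ext j i
    simp [eb, Finset.sum_apply, Pi.single_apply]
  conv_lhs => rw [hv]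
  rw [ContinuousMultilinearMap.map_sum, Finset.sum_mul]
  refine (norm_sum_le _ _).trans (Finset.sum_le_sum fun I _ => ?_)
  rw [ContinuousMultilinearMap.map_smul_univ, norm_smul, mul_comm]
  refine mul_le_mul_of_nonneg_left ?_ (norm_nonneg _)
  rw [norm_prod]
  refine Finset.prod_le_prod (fun _ _ => norm_nonneg _) fun j _ => ?_
  exact PiLp.norm_apply_le (v j) (I j)

lemma iteratedFDeriv_sch_le {n k : ℕ} (φ : Sch n) (x : Rn n) :
    ‖iteratedFDeriv ℝ k φ x‖ ≤
      ∑ I : Fin k → Fin n, ‖mderiv (fun i => (List.ofFn I).count i) (⇑φ) x‖ := by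
  refine (multilin_norm_le_sum _).trans (Finset.sum_le_sum fun I _ => ?_)
  rw [← dlS_eq_mderiv, dlS_coe, pd_list_eq _ _ (φ.smooth _)]
  have : ∀ (L : List (Fin n)) (hL : L.length = k) , iteratedFDeriv ℝ L.length φ x (fun j => eb (L.get j)) = iteratedFDeriv ℝ k φ x (fun j => eb (L.get (Fin.cast hL.symm j))) := by
    intro L hL; subst hL; rfl
  beta_reduce
  rw [this (List.ofFn I) (by simp)]
  simp

lemma mdeg_count {n k : ℕ} (I : Fin k → Fin n) :
    mdeg (fun i => (List.ofFn I).count i) = k := by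
  rw [← flatIdx_length]
  have : (flatIdx (fun i => (List.ofFn I).count i)).Perm (List.ofFn I) := by
    rw [List.perm_iff_count]
    intro a
    rw [flatIdx_count]
  rw [this.length_eq, List.length_ofFn]


/-- bounded families of Schwartz functions -/
def SBdd {n : ℕ} {ι : Type*} (B : ι → Sch n) : Prop :=
  ∀ k l : ℕ, ∃ C : ℝ, ∀ j, SchwartzMap.seminorm ℝ k l (B j) ≤ C

lemma seminorm_sum_apply {n : ℕ} {κ : Type*} (p : κ → Seminorm ℝ (Sch n)) (s : Finset κ)
    (x : Sch n) : (∑ i ∈ s, p i) x = ∑ i ∈ s, p i x := by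
  classical
  induction s using Finset.induction_on with
  | empty => simp
  | insert a s ha ih => rw [Finset.sum_insert ha, Finset.sum_insert ha, Seminorm.add_apply, ih]

lemma SBdd.map {n : ℕ} {ι : Type*} {B : ι → Sch n} (hB : SBdd B) (T : Sch n →L[ℝ] Sch n) :
    SBdd (fun j => T (B j)) := by
  intro k l
  have hc : Continuous ((SchwartzMap.seminorm ℝ k l).comp T.toLinearMap : Seminorm ℝ (Sch n)) := by
    have := ((schwartz_withSeminorms ℝ (Rn n) ℂ).continuous_seminorm (k, l)).comp T.continuous
    exact this
  obtain ⟨s, C, -, hC⟩ := Seminorm.bound_of_continuous (schwartz_withSeminorms ℝ (Rn n) ℂ) _ hc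
  choose D hD using fun m : ℕ × ℕ => hB m.1 m.2
  refine ⟨C * ∑ m ∈ s, D m, fun j => ?_⟩
  refine (hC (B j)).trans ?_
  change (C : ℝ) * (s.sup (schwartzSeminormFamily ℝ (Rn n) ℂ)) (B j) ≤ _
  refine mul_le_mul_of_nonneg_left ?_ C.2
  refine (Seminorm.finset_sup_le_sum _ _ (B j)).trans ?_
  rw [seminorm_sum_apply]
  exact Finset.sum_le_sum fun m _ => hD m j

lemma SBdd.mapC {n : ℕ} {ι : Type*} {B : ι → Sch n} (hB : SBdd B) (T : Sch n →L[ℂ] Sch n) :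
    SBdd (fun j => T (B j)) := hB.map (T.restrictScalars ℝ)

lemma SBdd.const {n : ℕ} (φ : Sch n) : SBdd (fun _ : Unit => φ) :=
  fun _ _ => ⟨_, fun _ => le_rfl⟩

/-- decay weight -/
def wt {n : ℕ} (M : ℝ) (x : Rn n) : ℝ := (1 + ‖x‖) ^ (-M)

lemma wt_pos {n : ℕ} (M : ℝ) (x : Rn n) : 0 < wt M x := by unfold wt; positivity

lemma wt_le_one {n : ℕ} {M : ℝ} (hM : 0 ≤ M) (x : Rn n) : wt M x ≤ 1 := by
  unfold wt
  exact Real.rpow_le_one_of_one_le_of_nonpos (by linarith [norm_nonneg x]) (by linarith)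

lemma wt_anti {n : ℕ} {M M' : ℝ} (h : M ≤ M') (x : Rn n) : wt M' x ≤ wt M x := by
  unfold wt
  exact Real.rpow_le_rpow_of_exponent_le (by linarith [norm_nonneg x]) (by linarith)

lemma wt_cont {n : ℕ} (M : ℝ) : Continuous (wt (n := n) M) := by
  unfold wt
  exact Continuous.rpow_const (by fun_prop) fun x => Or.inl (by positivity)

lemma wt_mul {n : ℕ} (M M' : ℝ) (x : Rn n) : wt (M + M') x = wt M x * wt M' x := by
  unfold wt
  rw [neg_add, Real.rpow_add (by positivity)]

lemma wt_neg {n : ℕ} (x : Rn n) (M : ℝ) : wt M (-x) = wt M x := by simp [wt]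

lemma wt_sub_comm {n : ℕ} (x y : Rn n) (M : ℝ) : wt M (x - y) = wt M (y - x) := by
  rw [← wt_neg, neg_sub]

/-- Peetre-type inequality for weights -/
lemma wt_add_le {n : ℕ} {M : ℝ} (hM : 0 ≤ M) (x y : Rn n) :
    wt M x ≤ (1 + ‖y‖) ^ M * wt M (x + y) := by
  unfold wt
  rw [Real.rpow_neg (by positivity), Real.rpow_neg (by positivity), ← div_eq_mul_inv,
    ← one_div, div_le_div_iff₀ (by positivity) (by positivity), one_mul,
    ← Real.mul_rpow (by positivity) (by positivity)]
  refine Real.rpow_le_rpow (by positivity) ?_ hM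
  nlinarith [norm_nonneg x, norm_nonneg y, norm_add_le x y]

lemma wt_integrable {n : ℕ} {M : ℝ} (hM : (n : ℝ) < M) : Integrable (wt (n := n) M) := by
  unfold wt
  exact integrable_one_add_norm (by simpa using hM)

lemma SBdd.decay_l {n : ℕ} {ι : Type*} {B : ι → Sch n} (hB : SBdd B) (l : ℕ) (M : ℝ) :
    ∃ C : ℝ, 0 < C ∧ ∀ j x, ‖iteratedFDeriv ℝ l (B j) x‖ ≤ C * wt M x := by
  obtain ⟨k, hk⟩ := exists_nat_ge M
  choose D hD using fun m : ℕ × ℕ => hB m.1 m.2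
  refine ⟨max 1 (2 ^ k * ∑ m ∈ Finset.Iic (k, l), D m), by positivity, fun j x => ?_⟩
  have h1 := SchwartzMap.one_add_le_sup_seminorm_apply (𝕜 := ℝ) (m := (k, l)) le_rfl le_rfl (B j) x
  have h2 : ((Finset.Iic (k, l)).sup fun m => SchwartzMap.seminorm ℝ m.1 m.2) (B j)
      ≤ ∑ m ∈ Finset.Iic (k, l), D m := by
    refine (Seminorm.finset_sup_le_sum _ _ (B j)).trans ?_
    rw [seminorm_sum_apply]
    exact Finset.sum_le_sum fun m _ => hD m j
  have h3 : (1 + ‖x‖) ^ k * ‖iteratedFDeriv ℝ l (B j) x‖ ≤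
      max 1 (2 ^ k * ∑ m ∈ Finset.Iic (k, l), D m) :=
    (h1.trans (mul_le_mul_of_nonneg_left h2 (by positivity))).trans (le_max_right _ _)
  have h4 : ‖iteratedFDeriv ℝ l (B j) x‖ ≤
      max 1 (2 ^ k * ∑ m ∈ Finset.Iic (k, l), D m) * wt k x := by
    unfold wt
    rw [Real.rpow_neg (by positivity), Real.rpow_natCast, ← div_eq_mul_inv,
      le_div_iff₀ (by positivity)]
    linarith
  exact h4.trans (mul_le_mul_of_nonneg_left (wt_anti hk x) (by positivity))

lemma SBdd.decay {n : ℕ} {ι : Type*} {B : ι → Sch n} (hB : SBdd B) (M : ℝ) :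
    ∃ C : ℝ, 0 < C ∧ ∀ j x, ‖B j x‖ ≤ C * wt M x := by
  obtain ⟨C, h0, hC⟩ := hB.decay_l 0 M
  exact ⟨C, h0, fun j x => by simpa using hC j x⟩

lemma sch_decay {n : ℕ} (φ : Sch n) (M : ℝ) : ∃ C : ℝ, 0 < C ∧ ∀ x, ‖φ x‖ ≤ C * wt M x := by
  obtain ⟨C, h0, hC⟩ := (SBdd.const φ).decay M
  exact ⟨C, h0, fun x => hC () x⟩

lemma dilate_apply {n : ℕ} (ψ : Sch n) {t : ℝ} (ht : t ≠ 0) (x : Rn n) :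
    dilate ψ t x = ψ (t • x) := by
  unfold dilate
  rw [dif_neg ht]
  rfl

lemma shiftReflect_apply {n : ℕ} (ψ : Sch n) (x y : Rn n) : shiftReflect ψ x y = ψ (x - y) := rfl

/-- pointwise formula for the inverse Fourier transform -/
lemma invFourierS_eq {n : ℕ} (φ : Sch n) : invFourierS φ = 𝓕⁻ φ := rfl
lemma fourierS_eq {n : ℕ} (φ : Sch n) : fourierS φ = 𝓕 φ := rfl

lemma invFourierS_apply {n : ℕ} (φ : Sch n) (x : Rn n) :
    invFourierS φ x = ∫ ξ : Rn n, Complex.exp (((2 * π * inner ℝ ξ x : ℝ) : ℂ) * Complex.I) • φ ξ := by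
  rw [invFourierS_eq, SchwartzMap.fourierInv_coe, Real.fourierInv_eq']

lemma fourierS_apply {n : ℕ} (φ : Sch n) (x : Rn n) :
    fourierS φ x = ∫ ξ : Rn n, Complex.exp (((-2 * π * inner ℝ ξ x : ℝ) : ℂ) * Complex.I) • φ ξ := by
  rw [fourierS_eq, SchwartzMap.fourier_coe, Real.fourier_eq']

lemma invFourier_dilate {n : ℕ} (Φ : Sch n) {t : ℝ} (ht : 0 < t) (x : Rn n) :
    invFourierS Φ x = t ^ n * invFourierS (dilate Φ t) (t • x) := by
  rw [invFourierS_apply, invFourierS_apply]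
  have h := Measure.integral_comp_smul (volume : Measure (Rn n))
    (fun ξ : Rn n => Complex.exp (((2 * π * inner ℝ ξ x : ℝ) : ℂ) * Complex.I) • Φ ξ) t
  have h2 : ∀ ξ : Rn n, Complex.exp (((2 * π * inner ℝ (t • ξ) x : ℝ) : ℂ) * Complex.I) • Φ (t • ξ)
      = Complex.exp (((2 * π * inner ℝ ξ (t • x) : ℝ) : ℂ) * Complex.I) • dilate Φ t ξ := by
    intro ξ
    rw [dilate_apply _ ht.ne', real_inner_smul_left, real_inner_smul_right]
  simp_rw [h2] at h
  rw [h]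
  simp only [finrank_euclideanSpace, Fintype.card_fin]
  rw [abs_of_pos (by positivity), Complex.real_smul]
  have : (t : ℂ) ≠ 0 := by exact_mod_cast ht.ne'
  rw [Complex.ofReal_inv, Complex.ofReal_pow, ← mul_assoc, mul_inv_cancel₀ (pow_ne_zero _ this),
    one_mul]

/-- derivative bounds for a resolution of unity -/
lemma res_deriv {n : ℕ} {φ : ℕ → Sch n} (hφ : SmoothResolution n φ) (l : ℕ) :
    ∃ C : ℝ, 0 < C ∧ ∀ j x, ‖iteratedFDeriv ℝ l (φ j) x‖ ≤ C * ((2 : ℝ) ^ (j * l))⁻¹ := by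
  choose c hc using hφ.deriv_bound
  refine ⟨max 1 (∑ I : Fin l → Fin n, c (fun i => (List.ofFn I).count i)), by positivity,
    fun j x => ?_⟩
  refine (iteratedFDeriv_sch_le _ _).trans ?_
  have h : ∀ I : Fin l → Fin n, ‖mderiv (fun i => (List.ofFn I).count i) (⇑(φ j)) x‖ ≤
      c (fun i => (List.ofFn I).count i) * ((2 : ℝ) ^ (j * l))⁻¹ := by
    intro I
    refine (hc _ j x).trans (le_of_eq ?_)
    rw [mdeg_count, neg_mul, Real.rpow_neg (by norm_num)]
    congr 2
    rw [← Nat.cast_mul, Real.rpow_natCast]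
  refine (Finset.sum_le_sum fun I _ => h I).trans ?_
  rw [← Finset.sum_mul]
  exact mul_le_mul_of_nonneg_right (le_max_right _ _) (by positivity)

lemma two_pow_ne (j : ℕ) : (2 : ℝ) ^ j ≠ 0 := by positivity

/-- the rescaled pieces -/
def resc {n : ℕ} (φ : ℕ → Sch n) (j : ℕ) : Sch n := dilate (φ j) ((2 : ℝ) ^ j)

lemma resc_apply {n : ℕ} (φ : ℕ → Sch n) (j : ℕ) (x : Rn n) :
    resc φ j x = φ j ((2 : ℝ) ^ j • x) := dilate_apply _ (two_pow_ne j) x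

lemma resc_supp {n : ℕ} {φ : ℕ → Sch n} (hφ : SmoothResolution n φ) (j : ℕ) (x : Rn n)
    (hx : 2 < ‖x‖) : resc φ j x = 0 := by
  rw [resc_apply]
  by_contra h
  have hn : ‖(2 : ℝ) ^ j • x‖ = 2 ^ j * ‖x‖ := by rw [norm_smul]; simp
  rcases Nat.eq_zero_or_pos j with rfl | hj
  · have := hφ.supp0 h
    simp only [mem_ofPred_eq, hn] at this
    simp at this; linarith
  · have := (hφ.suppj j hj h).2
    rw [hn, Real.rpow_add (by norm_num), Real.rpow_natCast, Real.rpow_one] at this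
    have h2 : (0 : ℝ) < 2 ^ j := by positivity
    nlinarith

lemma resc_supp' {n : ℕ} {φ : ℕ → Sch n} (hφ : SmoothResolution n φ) (j : ℕ) (hj : 0 < j)
    (x : Rn n) (hx : ‖x‖ < 1 / 2) : resc φ j x = 0 := by
  rw [resc_apply]
  by_contra h
  have hn : ‖(2 : ℝ) ^ j • x‖ = 2 ^ j * ‖x‖ := by rw [norm_smul]; simp
  have := (hφ.suppj j hj h).1
  rw [hn, Real.rpow_sub (by norm_num), Real.rpow_natCast, Real.rpow_one] at this
  have h2 : (0 : ℝ) < 2 ^ j := by positivity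
  nlinarith

lemma resc_bdd {n : ℕ} {φ : ℕ → Sch n} (hφ : SmoothResolution n φ) : SBdd (resc φ) := by
  intro k l
  obtain ⟨C, h0, hC⟩ := res_deriv hφ l
  refine ⟨2 ^ k * C, fun j => ?_⟩
  refine SchwartzMap.seminorm_le_bound ℝ k l _ (by positivity) fun x => ?_
  by_cases hx : 2 < ‖x‖
  · have : iteratedFDeriv ℝ l (resc φ j) x = 0 := by
      have he : (resc φ j : Rn n → ℂ) =ᶠ[𝓝 x] fun _ => 0 := by
        filter_upwards [(isOpen_lt continuous_const continuous_norm).mem_nhds hx] with y hy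
        exact resc_supp hφ j y hy
      rw [(he.iteratedFDeriv ℝ l).eq_of_nhds]
      simp
    rw [this]; simp; positivity
  · have h1 : (resc φ j : Rn n → ℂ) = fun x => φ j ((2 : ℝ) ^ j • x) := by
      ext x; exact resc_apply _ _ _
    rw [h1, iteratedFDeriv_comp_const_smul _ ((φ j).smooth l), norm_smul]
    have h2 := hC j ((2 : ℝ) ^ j • x)
    have h3 : ‖x‖ ^ k ≤ 2 ^ k := pow_le_pow_left₀ (norm_nonneg _) (not_lt.1 hx) k
    refine mul_le_mul h3 ?_ (by positivity) (by positivity)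
    rw [← pow_mul, norm_pow, Real.norm_ofNat]
    calc _ ≤ (2 : ℝ) ^ (j * l) * (C * ((2 : ℝ) ^ (j * l))⁻¹) :=
          mul_le_mul_of_nonneg_left h2 (by positivity)
      _ = C := by field_simp

/-- kernel at unit scale -/
def Psi {n : ℕ} (φ : ℕ → Sch n) (j : ℕ) : Sch n := invFourierS (resc φ j)

lemma Psi_bdd {n : ℕ} {φ : ℕ → Sch n} (hφ : SmoothResolution n φ) : SBdd (Psi φ) :=
  (resc_bdd hφ).mapC ((FourierTransform.fourierCLE ℂ (Sch n)).symm.toContinuousLinearMap)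

lemma invFourier_res {n : ℕ} (φ : ℕ → Sch n) (j : ℕ) (x : Rn n) :
    invFourierS (φ j) x = ((2 : ℝ) ^ j) ^ n * Psi φ j ((2 : ℝ) ^ j • x) := by
  have := invFourier_dilate (φ j) (t := (2 : ℝ) ^ j) (by positivity) x
  push_cast at this ⊢
  exact this


lemma iter_deriv_invF {n : ℕ} (K : ℕ) (i : Fin n) (g : Sch n) : ∀ g' : Sch n,
    (∀ ξ : Rn n, g' ξ = (2 * π * Complex.I * (ξ i : ℂ)) ^ K * g ξ) →
    (fun ψ : Sch n => (∂_{eb i} ψ : Sch n))^[K] (invFourierS g) = invFourierS g' := by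
  have ht : Function.HasTemperateGrowth (fun x : Rn n => inner ℝ x (eb i)) := by fun_prop
  induction K with
  | zero =>
    intro g' h
    have : g' = g := by ext ξ; simpa using h ξ
    rw [this]; rfl
  | succ K ih =>
    intro g' h
    set T : Sch n → Sch n := fun f => (2 * π * Complex.I : ℂ) • smulLeftCLM ℂ (fun x : Rn n => inner ℝ x (eb i)) f
    have hT : ∀ f ξ, T f ξ = 2 * π * Complex.I * (ξ i : ℂ) * f ξ := by
      intro f ξ
      change (2 * π * Complex.I : ℂ) • (smulLeftCLM ℂ (fun x : Rn n => inner ℝ x (eb i)) f) ξ = _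
      rw [smulLeftCLM_apply_apply ht]
      simp [EuclideanSpace.inner_single_right]
      ring
    have hK : ∀ k ξ, (T^[k] g) ξ = (2 * π * Complex.I * (ξ i : ℂ)) ^ k * g ξ := by
      intro k ξ
      induction k with
      | zero => simp
      | succ k ih => rw [Function.iterate_succ', Function.comp, hT, ih]; ring
    rw [Function.iterate_succ', Function.comp, ih (T^[K] g) (hK K), invFourierS_eq,
      SchwartzMap.lineDerivOp_fourierInv_eq, invFourierS_eq]
    congr 1
    change T (T^[K] g) = g'
    ext ξ
    rw [hT, hK, h]; ring

lemma exists_H (n K : ℕ) : ∃ H : Fin n → Sch n,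
    ∀ ξ : Rn n, 1 / 2 ≤ ‖ξ‖ → ‖ξ‖ ≤ 2 → ∑ i, (ξ i : ℂ) ^ K * H i ξ = 1 := by
  let b1 : ContDiffBump (0 : Rn n) := ⟨2, 3, by norm_num, by norm_num⟩
  let b2 : ContDiffBump (0 : Rn n) := ⟨1/4, 1/2, by norm_num, by norm_num⟩
  let D : Rn n → ℝ := fun ξ => ∑ k, (ξ k) ^ (2 * K)
  have hD0 : ∀ ξ : Rn n, ξ ≠ 0 → 0 < D ξ := by
    intro ξ hξ
    obtain ⟨k, hk⟩ : ∃ k, ξ k ≠ 0 := by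
      by_contra! h
      exact hξ (by ext k; simpa using h k)
    refine Finset.sum_pos' (fun k _ => ?_) ⟨k, Finset.mem_univ _, ?_⟩
    · rw [pow_mul]; positivity
    · rw [pow_mul]; positivity
  let h : Fin n → Rn n → ℝ := fun i ξ => b1 ξ * ((1 - b2 ξ) * ((ξ i) ^ K / D ξ))
  have hsm : ∀ i, ContDiff ℝ ((⊤ : ℕ∞) : WithTop ℕ∞) (h i) := by
    intro i
    refine b1.contDiff.mul ?_
    rw [contDiff_iff_contDiffAt]
    intro ξ
    by_cases hξ : ξ = 0
    · have : (fun ξ : Rn n => (1 - b2 ξ) * ((ξ i) ^ K / D ξ)) =ᶠ[𝓝 ξ] fun _ => 0 := by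
        filter_upwards [b2.eventuallyEq_one_of_mem_ball (x := ξ) (by simp [hξ, b2])] with y hy
        simp [hy]
      exact (contDiffAt_const).congr_of_eventuallyEq this
    · refine ContDiffAt.mul (contDiffAt_const.sub b2.contDiff.contDiffAt) ?_
      refine ContDiffAt.div ?_ ?_ (hD0 ξ hξ).ne'
      · exact ContDiff.contDiffAt (by fun_prop)
      · exact ContDiff.contDiffAt (by simp only [D]; fun_prop)
  have hcs : ∀ i, HasCompactSupport (fun ξ => ((h i ξ : ℝ) : ℂ)) := by
    intro i
    have : HasCompactSupport (h i) := b1.hasCompactSupport.mul_right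
    exact this.comp_left (g := fun r : ℝ => (r : ℂ)) Complex.ofReal_zero
  refine ⟨fun i => (hcs i).toSchwartzMap (Complex.ofRealCLM.contDiff.comp (hsm i)), fun ξ h1 h2 => ?_⟩
  have e1 : b1 ξ = 1 := b1.one_of_mem_closedBall (by simpa [b1] using h2)
  have e2 : b2 ξ = 0 := b2.zero_of_le_dist (by simpa [b2] using h1)
  have hξ : ξ ≠ 0 := by rintro rfl; simp at h1; norm_num at h1
  have : ∑ i, (ξ i) ^ K * h i ξ = 1 := by
    simp only [h, e1, e2, one_mul, sub_zero, ← mul_div_assoc]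
    rw [← Finset.sum_div, div_eq_one_iff_eq (hD0 ξ hξ).ne']
    exact Finset.sum_congr rfl fun k _ => by rw [two_mul, pow_add]
  change ∑ i, (ξ i : ℂ) ^ K * ((h i ξ : ℝ) : ℂ) = 1
  exact_mod_cast this

/-- cancellation: the kernels are sums of pure high order derivatives -/
lemma cancel {n : ℕ} {φ : ℕ → Sch n} (hφ : SmoothResolution n φ) (K : ℕ) :
    ∃ X : Fin n → ℕ → Sch n, (∀ i, SBdd (X i)) ∧ ∀ j, 0 < j →
      Psi φ j = ∑ i, (fun ψ : Sch n => (∂_{eb i} ψ : Sch n))^[K] (X i j) := by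
  obtain ⟨H, hH⟩ := exists_H n K
  let c : ℂ := (2 * π * Complex.I)⁻¹ ^ K
  have hc0 : (2 * π * Complex.I : ℂ) ≠ 0 := by simp [Real.pi_ne_zero]
  let Y : Fin n → ℕ → Sch n := fun i j => c • smulLeftCLM ℂ (H i) (resc φ j)
  have hY : ∀ i j ξ, Y i j ξ = c * (H i ξ * resc φ j ξ) := by
    intro i j ξ
    simp [Y, smulLeftCLM_apply_apply (H i).hasTemperateGrowth]
  refine ⟨fun i j => invFourierS (Y i j), fun i => ?_, fun j hj => ?_⟩
  · have h1 : SBdd (Y i) := (resc_bdd hφ).mapC (c • smulLeftCLM ℂ (H i))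
    exact h1.mapC ((FourierTransform.fourierCLE ℂ (Sch n)).symm.toContinuousLinearMap)
  · have hcoord : ∀ i : Fin n, Function.HasTemperateGrowth (fun ξ : Rn n => ((ξ i : ℝ) : ℂ) ^ K) := by
      intro i
      have h1 : Function.HasTemperateGrowth (fun x : Rn n => inner ℝ x (eb i)) := by fun_prop
      have h2 : Function.HasTemperateGrowth (fun x : Rn n => ((inner ℝ x (eb i) : ℝ) : ℂ)) :=
        by fun_prop
      have h3 : (fun x : Rn n => ((inner ℝ x (eb i) : ℝ) : ℂ)) = fun x : Rn n => ((x i : ℝ) : ℂ) := by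
        ext x; simp [EuclideanSpace.inner_single_right]
      rw [h3] at h2
      have h4 : ∀ k : ℕ, Function.HasTemperateGrowth (fun ξ : Rn n => ((ξ i : ℝ) : ℂ) ^ k) := by
        intro k
        induction k with
        | zero => simp
        | succ k ih => simp only [pow_succ]; exact ih.mul h2
      exact h4 K
    let Z : Fin n → Sch n := fun i => smulLeftCLM ℂ (fun ξ : Rn n => ((ξ i : ℝ) : ℂ) ^ K) ((2 * π * Complex.I : ℂ) ^ K • Y i j)
    have hZ : ∀ i ξ, Z i ξ = (2 * π * Complex.I * (ξ i : ℂ)) ^ K * Y i j ξ := by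
      intro i ξ
      simp only [Z, smulLeftCLM_apply_apply (hcoord i), SchwartzMap.smul_apply, smul_eq_mul]
      ring
    have h1 : ∀ i, (fun ψ : Sch n => (∂_{eb i} ψ : Sch n))^[K] (invFourierS (Y i j)) = invFourierS (Z i) :=
      fun i => iter_deriv_invF K i _ _ (hZ i)
    simp_rw [h1]
    have h2 : ∑ i, invFourierS (Z i) = invFourierS (∑ i, Z i) := by
      simp only [invFourierS]
      rw [map_sum]
    rw [h2, Psi]
    congr 1
    ext ξ
    rw [SchwartzMap.sum_apply]
    have h3 : ∀ i, Z i ξ = ((ξ i : ℂ) ^ K * H i ξ) * resc φ j ξ := by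
      intro i
      rw [hZ, hY]
      have : (2 * π * Complex.I : ℂ) ^ K * c = 1 := by
        rw [← mul_pow, mul_inv_cancel₀ hc0, one_pow]
      rw [mul_pow]
      linear_combination ((ξ i : ℂ) ^ K * H i ξ) * resc φ j ξ * this
    simp_rw [h3]
    rw [← Finset.sum_mul]
    by_cases ha : ‖ξ‖ < 1 / 2
    · rw [resc_supp' hφ j hj ξ ha]; simp
    by_cases hb : 2 < ‖ξ‖
    · rw [resc_supp hφ j ξ hb]; simp
    rw [hH ξ (not_lt.1 ha) (not_lt.1 hb), one_mul]


lemma pd_eq_fderiv {F : Type*} [NormedAddCommGroup F] [NormedSpace ℝ F] {n : ℕ} (i : Fin n)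
    {g : Rn n → F} (hg : Differentiable ℝ g) : pd i g = fun x => fderiv ℝ g x (eb i) := by
  ext x
  exact (hg x).lineDeriv_eq_fderiv

lemma pd_contDiff {F : Type*} [NormedAddCommGroup F] [NormedSpace ℝ F] {n : ℕ} (i : Fin n) {k : ℕ}
    {g : Rn n → F} (hg : ContDiff ℝ (k + 1 : ℕ) g) : ContDiff ℝ k (pd i g) := by
  rw [pd_eq_fderiv i (hg.differentiable (by simp))]
  exact (hg.fderiv_right (m := k) (by norm_cast)).clm_apply contDiff_const

lemma pd_support {F : Type*} [NormedAddCommGroup F] [NormedSpace ℝ F] {n : ℕ} (i : Fin n)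
    {g : Rn n → F} {S : Set (Rn n)} (hS : IsClosed S) (h : Function.support g ⊆ S) :
    Function.support (pd i g) ⊆ S := by
  intro x hx
  by_contra hxS
  apply hx
  have : g =ᶠ[𝓝 x] fun _ => 0 := by
    filter_upwards [hS.isOpen_compl.mem_nhds hxS] with y hy
    by_contra h0
    exact hy (h h0)
  unfold pd
  rw [this.lineDeriv_eq]
  simp [lineDeriv]

lemma pd_iter_support {F : Type*} [NormedAddCommGroup F] [NormedSpace ℝ F] {n : ℕ} (i : Fin n)
    (K : ℕ) {S : Set (Rn n)} (hS : IsClosed S) {g : Rn n → F} (h : Function.support g ⊆ S) :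
    Function.support ((pd i)^[K] g) ⊆ S := by
  induction K generalizing g with
  | zero => exact h
  | succ K ih => exact ih (pd_support i hS h)

lemma pd_iter_eq_mderiv {F : Type*} [NormedAddCommGroup F] [NormedSpace ℝ F] {n : ℕ} (i : Fin n)
    (K : ℕ) (g : Rn n → F) : (pd i)^[K] g = mderiv (Pi.single i K) g := by
  have : flatIdx (Pi.single i K : Fin n → ℕ) = List.replicate K i := by
    rw [List.eq_replicate_iff]
    constructor
    · rw [flatIdx_length]; simp [mdeg]
    · intro b hb
      simp only [flatIdx, List.mem_flatMap, List.mem_finRange, true_and, List.mem_replicate] at hb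
      obtain ⟨a, ha, rfl⟩ := hb
      by_contra hne
      exact ha (by simp [hne])
  rw [mderiv_eq_flat, this, foldr_replicate_iter]

lemma mdeg_single {n : ℕ} (i : Fin n) (K : ℕ) : mdeg (Pi.single i K : Fin n → ℕ) = K := by
  simp [mdeg]

lemma cs_of_ball {F : Type*} [NormedAddCommGroup F] {n : ℕ} {g : Rn n → F} {c : Rn n} {R : ℝ}
    (h : Function.support g ⊆ closedBall c R) : HasCompactSupport g :=
  HasCompactSupport.of_support_subset_isCompact (isCompact_closedBall c R) h

lemma ibp_one (Y : Sch n) (i : Fin n) {t : ℝ} (ht : t ≠ 0) (x : Rn n) {a : Rn n → E}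
    (ha : ContDiff ℝ 1 a) (hc : HasCompactSupport a) :
    ∫ y, (∂_{eb i} Y : Sch n) (t • (x - y)) • a y = t⁻¹ • ∫ y, Y (t • (x - y)) • pd i a y := by
  have hd : Differentiable ℝ a := ha.differentiable (by simp)
  have hpc : Continuous (pd i a) := by
    rw [pd_eq_fderiv i hd]
    exact (ha.continuous_fderiv (by simp)).clm_apply continuous_const
  have hps : HasCompactSupport (pd i a) := by
    rw [pd_eq_fderiv i hd]
    exact hc.fderiv_apply (𝕜 := ℝ) _
  have hdY : Continuous (∂_{eb i} Y : Sch n) := SchwartzMap.continuous _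
  have hY : Continuous Y := SchwartzMap.continuous _
  have hl : ∀ y, HasLineDerivAt ℝ (fun y => Y (t • (x - y)))
      (-((t : ℂ) * (∂_{eb i} Y : Sch n) (t • (x - y)))) y (eb i) := by
    intro y
    have h1 : HasFDerivAt (fun y : Rn n => t • (x - y)) (t • -(ContinuousLinearMap.id ℝ (Rn n))) y :=
      ((hasFDerivAt_id y).const_sub x).const_smul t
    have h2 := (Y.differentiableAt (x := t • (x - y))).hasFDerivAt.comp y h1
    have h3 := h2.hasLineDerivAt (eb i)
    convert! h3 using 1
    rw [SchwartzMap.lineDerivOp_apply_eq_fderiv]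
    simp
  have key := integral_bilinear_hasLineDerivAt_right_eq_neg_left_of_integrable
    (μ := (volume : Measure (Rn n))) (v := eb i)
    (B := (ContinuousLinearMap.lsmul ℝ ℂ : ℂ →L[ℝ] E →L[ℝ] E))
    (f := fun y => Y (t • (x - y))) (f' := fun y => -((t : ℂ) * (∂_{eb i} Y : Sch n) (t • (x - y))))
    (g := a) (g' := pd i a)
    (Continuous.integrable_of_hasCompactSupport (by
      simp only [ContinuousLinearMap.lsmul_apply]; exact Continuous.smul (by fun_prop) ha.continuous)
      (by simp only [ContinuousLinearMap.lsmul_apply]; exact hc.smul_left))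
    (Continuous.integrable_of_hasCompactSupport (by
      simp only [ContinuousLinearMap.lsmul_apply]; exact Continuous.smul (by fun_prop) hpc)
      (by simp only [ContinuousLinearMap.lsmul_apply]; exact hps.smul_left))
    (Continuous.integrable_of_hasCompactSupport (by
      simp only [ContinuousLinearMap.lsmul_apply]; exact Continuous.smul (by fun_prop) ha.continuous)
      (by simp only [ContinuousLinearMap.lsmul_apply]; exact hc.smul_left))
    (fun y _ => hl y)
    (fun y _ => (hd y).lineDifferentiableAt.hasLineDerivAt)
  simp only [ContinuousLinearMap.lsmul_apply] at key
  rw [key, ← integral_neg]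
  simp_rw [neg_smul, neg_neg, mul_smul, Complex.coe_smul]
  rw [integral_smul, smul_smul, inv_mul_cancel₀ ht, one_smul]

lemma ibp_iter (Y : Sch n) (i : Fin n) {t : ℝ} (ht : t ≠ 0) (x : Rn n) (K : ℕ) {a : Rn n → E}
    (ha : ContDiff ℝ K a) {c : Rn n} {R : ℝ} (hc : Function.support a ⊆ closedBall c R) :
    ∫ y, ((fun ψ : Sch n => (∂_{eb i} ψ : Sch n))^[K] Y) (t • (x - y)) • a y
      = (t ^ K)⁻¹ • ∫ y, Y (t • (x - y)) • (pd i)^[K] a y := by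
  induction K generalizing a with
  | zero => simp
  | succ K ih =>
    rw [Function.iterate_succ', Function.comp,
      ibp_one _ i ht x (ha.of_le (by simp)) (cs_of_ball hc),
      ih (pd_contDiff i ha) (pd_support i isClosed_closedBall hc), smul_smul,
      Function.iterate_succ, Function.comp, pow_succ, mul_inv, mul_comm]

/-- the node of the cube -/
def xm {n : ℕ} (ν : ℕ) (m : Fin n → ℤ) : Rn n := ((2 : ℝ) ^ ν)⁻¹ • zpt m

lemma norm_le_of_coord {n : ℕ} {z : Rn n} {b : ℝ} (h : ∀ i, |z i| ≤ b) : ‖z‖ ≤ n * b := by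
  have : ‖z‖ ≤ ∑ i, ‖z i‖ := by
    have h1 : z = ∑ i, z i • eb i := by
      ext k
      simp [eb, Finset.sum_apply, Pi.single_apply]
    calc ‖z‖ = ‖∑ i, z i • eb i‖ := by rw [← h1]
      _ ≤ ∑ i, ‖z i • eb i‖ := norm_sum_le _ _
      _ = _ := Finset.sum_congr rfl fun i _ => by rw [norm_smul, eb_norm, mul_one]
  refine this.trans ((Finset.sum_le_sum fun i _ => h i).trans ?_)
  simp

lemma two_rpow_neg (ν : ℕ) : (2 : ℝ) ^ (-(ν : ℝ)) = ((2 : ℝ) ^ ν)⁻¹ := by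
  rw [Real.rpow_neg (by norm_num), Real.rpow_natCast]

lemma dQ_subset {n : ℕ} (d : ℝ) (ν : ℕ) (m : Fin n → ℤ) :
    dQ d ν m ⊆ closedBall (xm ν m) ((n * d) * ((2 : ℝ) ^ ν)⁻¹) := by
  intro x hx
  rw [mem_closedBall, dist_eq_norm]
  have := norm_le_of_coord (z := x - xm ν m) (b := |d| * ((2 : ℝ) ^ ν)⁻¹) ?_
  · rcases isEmpty_or_nonempty (Fin n) with hn | ⟨⟨i⟩⟩
    · have : n = 0 := by rw [← Fintype.card_fin n]; exact Fintype.card_eq_zero_iff.2 hn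
      subst this
      simp [Subsingleton.elim x (xm ν m)]
    · have hd : 0 ≤ d := by
        have h2 := (abs_nonneg _).trans (hx i)
        by_contra h
        have : d * 2 ^ (-(ν : ℝ)) < 0 := mul_neg_of_neg_of_pos (not_le.1 h) (by positivity)
        linarith
      rw [abs_of_nonneg hd, ← mul_assoc] at this
      exact this
  · intro i
    have h := hx i
    rw [two_rpow_neg] at h
    have e : (x - xm ν m) i = x i - ((2 : ℝ) ^ ν)⁻¹ * m i := by simp [xm, zpt]
    rw [e]
    refine h.trans ?_
    have h2 := le_abs_self d
    have h3 := abs_nonneg d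
    have : (0 : ℝ) < ((2 : ℝ) ^ ν)⁻¹ := by positivity
    nlinarith

lemma wt_scale_integrable {n : ℕ} {M : ℝ} (hM : (n : ℝ) < M) {t : ℝ} (ht : t ≠ 0) (x : Rn n) :
    Integrable (fun y : Rn n => wt M (t • (x - y))) := by
  have h1 : Integrable (fun y : Rn n => wt M (t • y)) := (wt_integrable hM).comp_smul ht
  exact h1.comp_sub_left x

lemma wt_scale_integral {n : ℕ} (M : ℝ) {t : ℝ} (ht : 0 < t) (x : Rn n) :
    ∫ y : Rn n, wt M (t • (x - y)) = (t ^ n)⁻¹ * ∫ y : Rn n, wt M y := by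
  rw [integral_sub_left_eq_self (fun y : Rn n => wt M (t • y)) volume x,
    Measure.integral_comp_smul]
  simp [abs_of_pos ht]


/-- the common part of the atom conditions -/
def AtomLike (s' : ℝ) (K : ℕ) (d : ℝ) (ν : ℕ) (m : Fin n → ℤ) (a : Rn n → E) : Prop :=
  ContDiff ℝ K a ∧ Function.support a ⊆ dQ d ν m ∧
    (∀ α : Fin n → ℕ, mdeg α ≤ K → ∀ x,
      ‖mderiv α a x‖ ≤ 2 ^ (-(ν : ℝ) * s' + (mdeg α : ℝ) * (ν : ℝ)))

lemma mderiv_zero (a : Rn n → E) : mderiv (0 : Fin n → ℕ) a = a := by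
  rw [mderiv_eq_flat]
  have : flatIdx (0 : Fin n → ℕ) = [] := by
    rw [← List.length_eq_zero_iff, flatIdx_length]; simp [mdeg]
  rw [this]; rfl

lemma wt_shift {M : ℝ} (hM : 0 ≤ M) {t ρ : ℝ} (ht : 0 ≤ t) {R : ℝ} (hR : t * ρ ≤ R) {x y c : Rn n}
    (hy : y ∈ closedBall c ρ) : wt M (t • (x - y)) ≤ (1 + R) ^ M * wt M (t • (x - c)) := by
  have h := wt_add_le hM (t • (x - y)) (t • (y - c))
  rw [← smul_add, sub_add_sub_cancel] at h
  refine h.trans (mul_le_mul_of_nonneg_right ?_ (wt_pos _ _).le)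
  refine Real.rpow_le_rpow (by positivity) ?_ hM
  rw [norm_smul, Real.norm_eq_abs, abs_of_nonneg ht]
  rw [mem_closedBall, dist_eq_norm] at hy
  have := mul_le_mul_of_nonneg_left hy ht
  linarith

/-- estimate without cancellation -/
lemma est_A {M : ℝ} (hM : 0 ≤ M) {R : ℝ} (hR : 0 ≤ R) : ∃ C : ℝ, 0 < C ∧
    ∀ (Y : Sch n) (D : ℝ), 0 ≤ D → (∀ z, ‖Y z‖ ≤ D * wt M z) → ∀ (t r : ℝ), 0 < t → t ≤ r →
    ∀ (c : Rn n) (b : Rn n → E) (A : ℝ), 0 ≤ A → Function.support b ⊆ closedBall c (R * r⁻¹) →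
    (∀ y, ‖b y‖ ≤ A) → ∀ x, ‖∫ y, Y (t • (x - y)) • b y‖ ≤ C * D * A * (r ^ n)⁻¹ * wt M (t • (x - c)) := by
  set V := (volume (ball (0 : Rn n) 1)).toReal
  refine ⟨(1 + R) ^ M * (R ^ n * V) + 1, by positivity, ?_⟩
  intro Y D hD hY t r ht htr c b A hA hs hb x
  have hr : 0 < r := ht.trans_le htr
  set g : Rn n → ℝ := (closedBall c (R * r⁻¹)).indicator
    (fun _ => D * ((1 + R) ^ M * wt M (t • (x - c))) * A)
  have hfin : volume (closedBall c (R * r⁻¹)) ≠ ∞ := measure_closedBall_lt_top.ne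
  have hgi : Integrable g :=
    (integrableOn_const hfin).integrable_indicator measurableSet_closedBall
  have h1 : ‖∫ y, Y (t • (x - y)) • b y‖ ≤ ∫ y, g y := by
    refine norm_integral_le_of_norm_le hgi (Eventually.of_forall fun y => ?_)
    by_cases hy : y ∈ closedBall c (R * r⁻¹)
    · simp only [g, indicator_of_mem hy]
      rw [norm_smul]
      refine mul_le_mul ((hY _).trans (mul_le_mul_of_nonneg_left ?_ hD)) (hb y) (norm_nonneg _)
        (mul_nonneg hD (mul_nonneg (by positivity) (wt_pos _ _).le))
      refine wt_shift hM ht.le ?_ hy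
      have : t * r⁻¹ ≤ 1 := by rw [← div_eq_mul_inv, div_le_one hr]; exact htr
      nlinarith
    · simp only [g, indicator_of_notMem hy]
      have : b y = 0 := by by_contra h; exact hy (hs h)
      simp [this]
  refine h1.trans ?_
  rw [integral_indicator measurableSet_closedBall, setIntegral_const, smul_eq_mul, Measure.real,
    Measure.addHaar_closedBall _ _ (by positivity), ENNReal.toReal_mul,
    ENNReal.toReal_ofReal (by positivity), finrank_euclideanSpace, Fintype.card_fin, mul_pow, inv_pow]
  change R ^ n * (r ^ n)⁻¹ * V * _ ≤ _
  have hw := (wt_pos M (t • (x - c))).le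
  have : 0 ≤ D * A * (r ^ n)⁻¹ * wt M (t • (x - c)) := by positivity
  nlinarith

/-- estimate on the fine side -/
lemma est_B {M : ℝ} (hM : 0 ≤ M) {R : ℝ} (hR : 0 ≤ R) : ∃ C : ℝ, 0 < C ∧
    ∀ (Y : Sch n) (D : ℝ), 0 ≤ D → (∀ z, ‖Y z‖ ≤ D * wt (M + (n + 1)) z) →
    ∀ (t r : ℝ), 0 < r → r ≤ t →
    ∀ (c : Rn n) (b : Rn n → E) (A : ℝ), 0 ≤ A → Function.support b ⊆ closedBall c (R * r⁻¹) →
    (∀ y, ‖b y‖ ≤ A) → ∀ x, ‖∫ y, Y (t • (x - y)) • b y‖ ≤ C * D * A * (t ^ n)⁻¹ * wt M (r • (x - c)) := by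
  set V := ∫ y : Rn n, wt (n + 1) y
  have hV : 0 ≤ V := integral_nonneg fun y => (wt_pos _ _).le
  refine ⟨(1 + R) ^ M * V + 1, by positivity, ?_⟩
  intro Y D hD hY t r hr hrt c b A hA hs hb x
  have ht : 0 < t := hr.trans_le hrt
  have hw := (wt_pos M (r • (x - c))).le
  set Q := D * ((1 + R) ^ M * wt M (r • (x - c))) * A
  have hQ : 0 ≤ Q := by positivity
  have h1 : ‖∫ y, Y (t • (x - y)) • b y‖ ≤ ∫ y, Q * wt (n + 1) (t • (x - y)) := by
    refine norm_integral_le_of_norm_le ((wt_scale_integrable (by linarith) ht.ne' x).const_mul _)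
      (Eventually.of_forall fun y => ?_)
    by_cases hy : y ∈ closedBall c (R * r⁻¹)
    · rw [norm_smul]
      have h2 : wt M (t • (x - y)) ≤ wt M (r • (x - y)) := by
        unfold wt
        refine Real.rpow_le_rpow_of_nonpos (by positivity) ?_ (by linarith)
        rw [norm_smul, norm_smul, Real.norm_eq_abs, Real.norm_eq_abs, abs_of_pos ht, abs_of_pos hr]
        have := mul_le_mul_of_nonneg_right hrt (norm_nonneg (x - y))
        linarith
      have h3 : wt M (r • (x - y)) ≤ (1 + R) ^ M * wt M (r • (x - c)) := by
        refine wt_shift hM hr.le ?_ hy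
        have : r * (R * r⁻¹) = R := by field_simp
        exact this.le
      have h4 : ‖Y (t • (x - y))‖ ≤ D * ((1 + R) ^ M * wt M (r • (x - c)) * wt (n + 1) (t • (x - y))) := by
        refine (hY _).trans (mul_le_mul_of_nonneg_left ?_ hD)
        rw [wt_mul]
        exact mul_le_mul_of_nonneg_right (h2.trans h3) (wt_pos _ _).le
      calc _ ≤ _ := mul_le_mul h4 (hb y) (norm_nonneg _) ((norm_nonneg _).trans h4)
        _ = _ := by simp only [Q]; ring
    · have : b y = 0 := by by_contra h; exact hy (hs h)
      rw [this, smul_zero, norm_zero]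
      exact mul_nonneg hQ (wt_pos _ _).le
  refine h1.trans ?_
  rw [integral_const_mul, wt_scale_integral _ ht]
  change Q * ((t ^ n)⁻¹ * V) ≤ _
  simp only [Q]
  have : 0 ≤ D * A * (t ^ n)⁻¹ * wt M (r • (x - c)) := by positivity
  nlinarith

/-- decay factor for interaction of scale `j` and an atom -/
def kap {n : ℕ} (K : ℕ) (M : ℝ) (j ν : ℕ) (m : Fin n → ℤ) (x : Rn n) : ℝ :=
  if j ≤ ν then ((2 : ℝ) ^ (ν - j)) ⁻¹ ^ n * wt M ((2 : ℝ) ^ j • (x - xm ν m))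
  else ((2 : ℝ) ^ (j - ν))⁻¹ ^ K * wt M ((2 : ℝ) ^ ν • (x - xm ν m))

lemma atom_est {φ : ℕ → Sch n} (hφ : SmoothResolution n φ) (s' : ℝ) (K : ℕ) {d : ℝ} (hd : 0 ≤ d)
    {M : ℝ} (hM : 0 ≤ M) : ∃ C : ℝ, 0 < C ∧ ∀ (j ν : ℕ) (m : Fin n → ℤ) (a : Rn n → E),
      AtomLike s' K d ν m a → ∀ x,
      ‖∫ y, shiftReflect (invFourierS (φ j)) x y • a y‖ ≤
        C * (2 : ℝ) ^ (-(ν : ℝ) * s') * kap K M j ν m x := by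
  obtain ⟨X, hX, hPsi⟩ := cancel hφ K
  obtain ⟨D, hD0, hD⟩ := (Psi_bdd hφ).decay M
  choose D' hD0' hD' using fun i => (hX i).decay (M + (n + 1))
  have hR : 0 ≤ n * d := by positivity
  obtain ⟨CA, hCA, hA⟩ := est_A (n := n) (E := E) hM hR
  obtain ⟨CB, hCB, hB⟩ := est_B (n := n) (E := E) hM hR
  refine ⟨CA * D + CB * ∑ i, D' i, add_pos_of_pos_of_nonneg (by positivity)
    (mul_nonneg hCB.le (Finset.sum_nonneg fun i _ => (hD0' i).le)), ?_⟩
  intro j ν m a ⟨ha1, ha2, ha3⟩ x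
  have hsum : 0 ≤ ∑ i, D' i := Finset.sum_nonneg fun i _ => (hD0' i).le
  have hs := ha2.trans (dQ_subset d ν m)
  have h2j : (0 : ℝ) < 2 ^ j := by positivity
  have h2ν : (0 : ℝ) < 2 ^ ν := by positivity
  have hb : ∀ y, ‖a y‖ ≤ (2 : ℝ) ^ (-(ν : ℝ) * s') := by
    intro y
    have := ha3 0 (by simp [mdeg]) y
    rw [mderiv_zero] at this
    simpa [mdeg] using this
  have e0 : ∫ y, shiftReflect (invFourierS (φ j)) x y • a y
      = ((2 : ℝ) ^ j) ^ n • ∫ y, Psi φ j ((2 : ℝ) ^ j • (x - y)) • a y := by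
    rw [← integral_smul]
    congr 1
    ext y
    rw [shiftReflect_apply, invFourier_res, mul_smul, ← Complex.ofReal_pow, ← Complex.ofReal_pow, Complex.coe_smul]
  rw [e0, norm_smul, Real.norm_eq_abs, abs_of_pos (by positivity)]
  set A : ℝ := (2 : ℝ) ^ (-(ν : ℝ) * s')
  have hApos : 0 < A := by positivity
  by_cases hjν : j ≤ ν
  · have h1 := hA (Psi φ j) D hD0.le (hD j) (2 ^ j) (2 ^ ν) h2j
      (pow_le_pow_right₀ (by norm_num) hjν) (xm ν m) a A hApos.le hs hb x
    rw [kap, if_pos hjν]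
    have e1 : ((2 : ℝ) ^ j) ^ n * ((2 ^ ν) ^ n)⁻¹ = ((2 : ℝ) ^ (ν - j)) ⁻¹ ^ n := by
      rw [← inv_pow, ← mul_pow]
      congr 1
      rw [pow_sub₀ _ (by norm_num) hjν]
      field_simp
    have hw := (wt_pos M ((2 : ℝ) ^ j • (x - xm ν m))).le
    calc _ ≤ ((2 : ℝ) ^ j) ^ n * _ := mul_le_mul_of_nonneg_left h1 (by positivity)
      _ = (CA * D) * A * (((2 : ℝ) ^ (ν - j)) ⁻¹ ^ n * wt M ((2 : ℝ) ^ j • (x - xm ν m))) := by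
          rw [← e1]; ring
      _ ≤ _ := by
          refine mul_le_mul_of_nonneg_right (mul_le_mul_of_nonneg_right ?_ hApos.le) (by positivity)
          have : 0 ≤ CB * ∑ i, D' i := by positivity
          linarith
  · push Not at hjν
    rw [kap, if_neg (not_le.2 hjν)]
    have hcont : ∀ ψ : Sch n, Integrable (fun y => ψ ((2 : ℝ) ^ j • (x - y)) • a y) := by
      intro ψ
      refine Continuous.integrable_of_hasCompactSupport ?_ (cs_of_ball hs).smul_left
      have := ψ.continuous
      exact Continuous.smul (by fun_prop) ha1.continuous
    have e2 : ∫ y, Psi φ j ((2 : ℝ) ^ j • (x - y)) • a y =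
        ∑ i, (((2 : ℝ) ^ j) ^ K)⁻¹ • ∫ y, X i j ((2 : ℝ) ^ j • (x - y)) • (pd i)^[K] a y := by
      rw [hPsi j (by omega)]
      simp_rw [sum_apply, Finset.sum_smul]
      rw [integral_finsetSum _ fun i _ => hcont _]
      exact Finset.sum_congr rfl fun i _ => ibp_iter _ i h2j.ne' x K ha1 hs
    have hb2 : ∀ i y, ‖(pd i)^[K] a y‖ ≤ A * ((2 : ℝ) ^ ν) ^ K := by
      intro i y
      rw [pd_iter_eq_mderiv]
      refine (ha3 _ (mdeg_single i K).le y).trans (le_of_eq ?_)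
      rw [mdeg_single, Real.rpow_add (by norm_num), ← pow_mul, ← Real.rpow_natCast 2 (ν * K)]
      congr 2
      push_cast; ring
    set W := wt M ((2 : ℝ) ^ ν • (x - xm ν m))
    have hw : 0 ≤ W := (wt_pos M _).le
    have h3 : ∀ i, ‖(((2 : ℝ) ^ j) ^ K)⁻¹ • ∫ y, X i j ((2 : ℝ) ^ j • (x - y)) • (pd i)^[K] a y‖ ≤
        (((2 : ℝ) ^ j) ^ K)⁻¹ * (CB * D' i * (A * ((2 : ℝ) ^ ν) ^ K) * (((2 : ℝ) ^ j) ^ n)⁻¹ * W) := by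
      intro i
      rw [norm_smul, Real.norm_eq_abs, abs_of_pos (by positivity)]
      refine mul_le_mul_of_nonneg_left ?_ (by positivity)
      exact hB (X i j) (D' i) (hD0' i).le (hD' i j) (2 ^ j) (2 ^ ν) h2ν
        (pow_le_pow_right₀ (by norm_num) hjν.le) (xm ν m) _ _ (by positivity)
        (pd_iter_support i K isClosed_closedBall hs) (hb2 i) x
    have e1 : ((2 : ℝ) ^ ν) ^ K * (((2 : ℝ) ^ j) ^ K)⁻¹ = ((2 : ℝ) ^ (j - ν))⁻¹ ^ K := by
      rw [← inv_pow, ← mul_pow]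
      congr 1
      rw [pow_sub₀ _ (by norm_num) hjν.le]
      field_simp
    rw [e2]
    calc _ ≤ ((2 : ℝ) ^ j) ^ n * _ := mul_le_mul_of_nonneg_left
          ((norm_sum_le _ _).trans (Finset.sum_le_sum fun i _ => h3 i)) (by positivity)
      _ = (CB * ∑ i, D' i) * A * (((2 : ℝ) ^ (j - ν))⁻¹ ^ K * W) := by
          rw [← e1, Finset.mul_sum, Finset.mul_sum, Finset.sum_mul, Finset.sum_mul]
          refine Finset.sum_congr rfl fun i _ => ?_
          field_simp
      _ ≤ _ := by
          refine mul_le_mul_of_nonneg_right (mul_le_mul_of_nonneg_right ?_ hApos.le) (by positivity)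
          have : 0 ≤ CA * D := by positivity
          linarith


/-- powers of two in `ℝ≥0∞` -/
def e2 (x : ℝ) : ℝ≥0∞ := (2 : ℝ≥0∞) ^ x

lemma e2_add (x y : ℝ) : e2 (x + y) = e2 x * e2 y :=
  ENNReal.rpow_add _ _ (by norm_num) (by norm_num)

lemma e2_zero : e2 0 = 1 := ENNReal.rpow_zero

lemma e2_ofReal (x : ℝ) : ENNReal.ofReal ((2 : ℝ) ^ x) = e2 x := by
  rw [← ENNReal.ofReal_rpow_of_pos (by norm_num)]
  simp [e2]

lemma e2_rpow (x y : ℝ) : e2 x ^ y = e2 (x * y) := (ENNReal.rpow_mul _ _ _).symm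

lemma e2_mono {x y : ℝ} (h : x ≤ y) : e2 x ≤ e2 y :=
  ENNReal.rpow_le_rpow_of_exponent_le (by norm_num) h

lemma e2_ne_top (x : ℝ) : e2 x ≠ ∞ := by rw [← e2_ofReal]; exact ENNReal.ofReal_ne_top

lemma e2_pow_ofReal (k : ℕ) : ENNReal.ofReal ((2 : ℝ) ^ k) = e2 k := by
  rw [← e2_ofReal, Real.rpow_natCast]

/-- geometric constant -/
def geo (δ : ℝ) : ℝ≥0∞ := ∑' z : ℤ, e2 (-(δ * |(z : ℝ)|))

lemma geo_ne_top {δ : ℝ} (hδ : 0 < δ) : geo δ ≠ ∞ := by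
  have h1 : Summable (fun z : ℤ => (2 : ℝ) ^ (-(δ * |(z : ℝ)|))) := by
    have h0 : Summable (fun k : ℕ => ((2 : ℝ) ^ (-δ)) ^ k) :=
      summable_geometric_of_lt_one (by positivity)
        (Real.rpow_lt_one_of_one_lt_of_neg (by norm_num) (by linarith))
    have h2 : ∀ k : ℕ, (2 : ℝ) ^ (-(δ * (k : ℝ))) = ((2 : ℝ) ^ (-δ)) ^ k := by
      intro k
      rw [← Real.rpow_natCast, ← Real.rpow_mul (by norm_num)]
      congr 1; ring
    refine Summable.of_nat_of_neg ?_ ?_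
    · simpa [h2] using h0
    · simpa [h2] using h0
  unfold geo
  simp_rw [← e2_ofReal]
  rw [← ENNReal.ofReal_tsum_of_nonneg (fun z => by positivity) h1]
  exact ENNReal.ofReal_ne_top

lemma geo_left (δ : ℝ) (j : ℕ) : ∑' ν : ℕ, e2 (-(δ * |(j : ℝ) - ν|)) ≤ geo δ := by
  have := ENNReal.tsum_comp_le_tsum_of_injective (f := fun ν : ℕ => (j : ℤ) - ν)
    (fun a b h => by simpa using h) (fun z : ℤ => e2 (-(δ * |(z : ℝ)|)))
  simpa [geo] using this

lemma geo_right (δ : ℝ) (ν : ℕ) : ∑' j : ℕ, e2 (-(δ * |(j : ℝ) - ν|)) ≤ geo δ := by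
  have := geo_left δ ν
  simpa [abs_sub_comm] using this

lemma tsum_rpow_le_of_le_one {ι : Type*} (f : ι → ℝ≥0∞) {u : ℝ} (h0 : 0 < u) (h1 : u ≤ 1) :
    (∑' i, f i) ^ u ≤ ∑' i, f i ^ u := by
  have h : ∑' i, f i ≤ (∑' i, f i ^ u) ^ u⁻¹ := by
    rw [ENNReal.tsum_eq_iSup_sum]
    refine iSup_le fun s => ?_
    have h2 : (∑ i ∈ s, f i) ^ u ≤ ∑' i, f i ^ u := by
      refine le_trans ?_ (ENNReal.sum_le_tsum s)
      exact Finset.le_sum_of_subadditive (fun x : ℝ≥0∞ => x ^ u) (by simp [h0])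
        (fun x y => ENNReal.rpow_add_le_add_rpow x y h0.le h1) s f
    calc _ = ((∑ i ∈ s, f i) ^ u) ^ u⁻¹ := by
          rw [← ENNReal.rpow_mul, mul_inv_cancel₀ h0.ne', ENNReal.rpow_one]
      _ ≤ _ := ENNReal.rpow_le_rpow h2 (by positivity)
  calc _ ≤ ((∑' i, f i ^ u) ^ u⁻¹) ^ u := ENNReal.rpow_le_rpow h h0.le
    _ = _ := by rw [← ENNReal.rpow_mul, inv_mul_cancel₀ h0.ne', ENNReal.rpow_one]

lemma tsum_rpow_le_of_one_le {ι : Type*} (c k : ι → ℝ≥0∞) {u : ℝ} (h1 : 1 ≤ u) {A : ℝ≥0∞}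
    (hA : ∑' i, k i ≤ A) : (∑' i, c i * k i) ^ u ≤ A ^ (u - 1) * ∑' i, c i ^ u * k i := by
  have h0 : 0 < u := by linarith
  have h : ∑' i, c i * k i ≤ A ^ (1 - u⁻¹) * (∑' i, c i ^ u * k i) ^ u⁻¹ := by
    rw [ENNReal.tsum_eq_iSup_sum]
    refine iSup_le fun s => ?_
    have h2 := ENNReal.inner_le_weight_mul_Lp_of_nonneg s h1 k c
    simp_rw [mul_comm (k _)] at h2
    refine h2.trans (mul_le_mul' (ENNReal.rpow_le_rpow ((ENNReal.sum_le_tsum s).trans hA) ?_)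
      (ENNReal.rpow_le_rpow (ENNReal.sum_le_tsum s) (by positivity)))
    have := inv_le_one_of_one_le₀ h1
    linarith
  refine (ENNReal.rpow_le_rpow h h0.le).trans (le_of_eq ?_)
  rw [ENNReal.mul_rpow_of_nonneg _ _ h0.le, ← ENNReal.rpow_mul, ← ENNReal.rpow_mul,
    inv_mul_cancel₀ h0.ne', ENNReal.rpow_one, sub_mul, one_mul, inv_mul_cancel₀ h0.ne']

lemma tsum_rpow_le {ι : Type*} (c k : ι → ℝ≥0∞) {u : ℝ} (h0 : 0 < u) {A : ℝ≥0∞}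
    (hA : 1 ≤ u → ∑' i, k i ≤ A) :
    (∑' i, c i * k i) ^ u ≤ A ^ (max (u - 1) 0) * ∑' i, c i ^ u * k i ^ (min 1 u) := by
  rcases le_total 1 u with h | h
  · rw [max_eq_left (by linarith), min_eq_left h]
    simpa using tsum_rpow_le_of_one_le c k h (hA h)
  · rw [max_eq_right (by linarith), min_eq_right h, ENNReal.rpow_zero, one_mul]
    refine (tsum_rpow_le_of_le_one _ h0 h).trans (le_of_eq ?_)
    simp_rw [ENNReal.mul_rpow_of_nonneg _ _ h0.le]

lemma rpow_inv_cancel (b : ℝ≥0∞) {P : ℝ} (hP : 0 < P) : (b ^ P) ^ P⁻¹ = b := by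
  rw [← ENNReal.rpow_mul, mul_inv_cancel₀ hP.ne', ENNReal.rpow_one]

lemma rpow_inv_cancel' (b : ℝ≥0∞) {P : ℝ} (hP : 0 < P) : (b ^ P⁻¹) ^ P = b := by
  rw [← ENNReal.rpow_mul, inv_mul_cancel₀ hP.ne', ENNReal.rpow_one]

/-- discrete Young type inequality -/
lemma young_lq {P δ : ℝ} (hP : 0 < P) (hδ : 0 < δ) {q : ℝ≥0∞} (hq : 0 < q) {C : ℝ≥0∞} (hC : C ≠ ∞) :
    ∃ C' : ℝ≥0∞, C' ≠ ∞ ∧ ∀ b L : ℕ → ℝ≥0∞,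
      (∀ j : ℕ, b j ^ P ≤ C * ∑' ν : ℕ, L ν ^ P * e2 (-(δ * |(j : ℝ) - ν|))) →
      lqSum q b ≤ C' * lqSum q L := by
  by_cases hqt : q = ∞
  · refine ⟨(C * geo δ) ^ P⁻¹, ENNReal.rpow_ne_top_of_nonneg (by positivity)
      (ENNReal.mul_ne_top hC (geo_ne_top hδ)), fun b L h => ?_⟩
    simp only [lqSum, if_pos hqt]
    refine iSup_le fun j => ?_
    have h1 : b j ^ P ≤ C * geo δ * (⨆ ν, L ν) ^ P := by
      refine (h j).trans ?_
      rw [mul_assoc]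
      refine mul_le_mul' le_rfl ?_
      calc _ ≤ ∑' ν : ℕ, (⨆ ν, L ν) ^ P * e2 (-(δ * |(j : ℝ) - ν|)) :=
            ENNReal.tsum_le_tsum fun ν => mul_le_mul'
              (ENNReal.rpow_le_rpow (le_iSup L ν) hP.le) le_rfl
        _ ≤ _ := by
            rw [ENNReal.tsum_mul_left, mul_comm]
            exact mul_le_mul' (geo_left δ j) le_rfl
    calc b j = (b j ^ P) ^ P⁻¹ := (rpow_inv_cancel _ hP).symm
      _ ≤ _ := ENNReal.rpow_le_rpow h1 (by positivity)
      _ = _ := by rw [ENNReal.mul_rpow_of_nonneg _ _ (by positivity), rpow_inv_cancel _ hP]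
  · set Q := q.toReal
    have hQ : 0 < Q := ENNReal.toReal_pos hq.ne' hqt
    set u := Q / P
    have hu : 0 < u := by positivity
    set δ' := δ * min 1 u
    have hδ' : 0 < δ' := mul_pos hδ (lt_min one_pos hu)
    set D : ℝ≥0∞ := C ^ u * (geo δ ^ (max (u - 1) 0) * geo δ')
    have hD : D ≠ ∞ := ENNReal.mul_ne_top (ENNReal.rpow_ne_top_of_nonneg hu.le hC)
      (ENNReal.mul_ne_top (ENNReal.rpow_ne_top_of_nonneg (le_max_right _ _) (geo_ne_top hδ))
        (geo_ne_top hδ'))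
    refine ⟨D ^ (1 / Q), ENNReal.rpow_ne_top_of_nonneg (by positivity) hD, fun b L h => ?_⟩
    simp only [lqSum, if_neg hqt]
    rw [← ENNReal.mul_rpow_of_nonneg _ _ (by positivity)]
    refine ENNReal.rpow_le_rpow ?_ (by positivity)
    have h1 : ∀ j, b j ^ Q ≤ C ^ u * (geo δ ^ (max (u - 1) 0) *
        ∑' ν : ℕ, L ν ^ Q * e2 (-(δ' * |(j : ℝ) - ν|))) := by
      intro j
      have e : b j ^ Q = (b j ^ P) ^ u := by
        rw [← ENNReal.rpow_mul]; congr 1; simp only [u]; field_simp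
      rw [e]
      refine (ENNReal.rpow_le_rpow (h j) hu.le).trans ?_
      rw [ENNReal.mul_rpow_of_nonneg _ _ hu.le]
      refine mul_le_mul' le_rfl ((tsum_rpow_le _ _ hu fun _ => geo_left δ j).trans (le_of_eq ?_))
      congr 1
      refine tsum_congr fun ν => ?_
      rw [← ENNReal.rpow_mul, e2_rpow]
      congr 2
      · simp only [u]; field_simp
      · simp only [δ']; ring
    calc _ ≤ _ := ENNReal.tsum_le_tsum h1
      _ = C ^ u * (geo δ ^ (max (u - 1) 0) *
        ∑' ν : ℕ, L ν ^ Q * ∑' j : ℕ, e2 (-(δ' * |(j : ℝ) - ν|))) := by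
          rw [ENNReal.tsum_mul_left, ENNReal.tsum_mul_left, ENNReal.tsum_comm]
          simp_rw [ENNReal.tsum_mul_left]
      _ ≤ C ^ u * (geo δ ^ (max (u - 1) 0) * ∑' ν : ℕ, L ν ^ Q * geo δ') := by
          gcongr with ν
          exact geo_right _ _
      _ = _ := by rw [ENNReal.tsum_mul_right]; simp only [D]; ring

lemma volume_box {n : ℕ} (a : Fin n → ℝ) {h : ℝ} (hh : 0 ≤ h) :
    volume {y : Rn n | ∀ i, a i ≤ y i ∧ y i < a i + h} = ENNReal.ofReal (h ^ n) := by
  have h1 : {y : Rn n | ∀ i, a i ≤ y i ∧ y i < a i + h} =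
      WithLp.ofLp ⁻¹' (Set.univ.pi fun i => Set.Ico (a i) (a i + h)) := by
    ext y; simp
  rw [h1, (PiLp.volume_preserving_ofLp (Fin n)).measure_preimage
    (MeasurableSet.univ_pi fun i => measurableSet_Ico).nullMeasurableSet, Real.volume_pi_Ico]
  simp [ENNReal.ofReal_pow hh]

/-- lattice sums of weights -/
lemma lattice_sum {n : ℕ} {M : ℝ} (hM : (n : ℝ) < M) : ∃ C : ℝ≥0∞, C ≠ ∞ ∧
    ∀ (h : ℝ), 0 < h → h ≤ 1 → ∀ x : Rn n,
      ENNReal.ofReal (h ^ n) * ∑' m : Fin n → ℤ, ENNReal.ofReal (wt M (x - h • zpt m)) ≤ C := by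
  have hM0 : 0 ≤ M := (Nat.cast_nonneg n).trans hM.le
  refine ⟨ENNReal.ofReal ((1 + n) ^ M) * ENNReal.ofReal (∫ y : Rn n, wt M y),
    ENNReal.mul_ne_top ENNReal.ofReal_ne_top ENNReal.ofReal_ne_top, fun h h0 h1 x => ?_⟩
  let S : (Fin n → ℤ) → Set (Rn n) := fun m => {y | ∀ i, h * m i ≤ y i ∧ y i < h * m i + h}
  have hS : ∀ m, MeasurableSet (S m) := by
    intro m
    have : S m = WithLp.ofLp ⁻¹' (Set.univ.pi fun i => Set.Ico (h * m i) (h * m i + h)) := by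
      ext y; simp [S]
    rw [this]
    exact (PiLp.volume_preserving_ofLp (Fin n)).measurable (MeasurableSet.univ_pi fun i => measurableSet_Ico)
  have hdis : Pairwise (Function.onFun Disjoint S) := by
    intro m m' hne
    rw [Function.onFun, Set.disjoint_left]
    intro y hy hy'
    apply hne
    ext i
    have a1 := hy i
    have a2 := hy' i
    have b1 : (m i : ℝ) < m' i + 1 := by
      have : h * m i < h * (m' i + 1) := by linarith
      exact lt_of_mul_lt_mul_left this h0.le
    have b2 : (m' i : ℝ) < m i + 1 := by
      have : h * m' i < h * (m i + 1) := by linarith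
      exact lt_of_mul_lt_mul_left this h0.le
    have c1 : m i < m' i + 1 := by exact_mod_cast b1
    have c2 : m' i < m i + 1 := by exact_mod_cast b2
    omega
  have key : ∀ m, ENNReal.ofReal (h ^ n) * ENNReal.ofReal (wt M (x - h • zpt m)) ≤
      ENNReal.ofReal ((1 + n) ^ M) * ∫⁻ y in S m, ENNReal.ofReal (wt M (x - y)) := by
    intro m
    rw [← lintegral_const_mul' _ _ ENNReal.ofReal_ne_top]
    have hv : volume (S m) = ENNReal.ofReal (h ^ n) := volume_box (fun i => h * m i) h0.le
    rw [← hv, mul_comm, ← setLIntegral_const]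
    refine setLIntegral_mono' (hS m) fun y hy => ?_
    rw [← ENNReal.ofReal_mul (by positivity)]
    refine ENNReal.ofReal_le_ofReal ?_
    have h2 := wt_add_le hM0 (x - h • zpt m) (h • zpt m - y)
    rw [sub_add_sub_cancel] at h2
    refine h2.trans (mul_le_mul_of_nonneg_right ?_ (wt_pos _ _).le)
    refine Real.rpow_le_rpow (by positivity) ?_ hM0
    have : ‖h • zpt m - y‖ ≤ n * 1 := by
      refine norm_le_of_coord fun i => ?_
      have := hy i
      simp only [zpt, PiLp.sub_apply, PiLp.smul_apply, smul_eq_mul]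
      rw [abs_le]; constructor <;> linarith
    linarith
  rw [← ENNReal.tsum_mul_left]
  refine (ENNReal.tsum_le_tsum key).trans ?_
  rw [ENNReal.tsum_mul_left, ← lintegral_iUnion hS hdis]
  refine mul_le_mul' le_rfl ?_
  refine (setLIntegral_le_lintegral _ _).trans ?_
  rw [lintegral_sub_left_eq_self (fun y : Rn n => ENNReal.ofReal (wt M y)) x,
    ofReal_integral_eq_lintegral_ofReal (wt_integrable hM) (Eventually.of_forall fun y => (wt_pos _ _).le)]


lemma hasSum_enorm_le {ι : Type*} {F : Type*} [NormedAddCommGroup F] {f : ι → F} {b : F}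
    (h : HasSum f b) : ‖b‖ₑ ≤ ∑' i, ‖f i‖ₑ := by
  refine le_of_tendsto (continuous_enorm.continuousAt.tendsto.comp h) (Eventually.of_forall fun s => ?_)
  exact (enorm_sum_le _ _).trans (ENNReal.sum_le_tsum s)

lemma wt_rpow {M u : ℝ} (x : Rn n) : wt M x ^ u = wt (M * u) x := by
  unfold wt
  rw [← Real.rpow_mul (by positivity)]; congr 1; ring

lemma wt_scale_lintegral {M : ℝ} (hM : (n : ℝ) < M) {t : ℝ} (ht : 0 < t) (c : Rn n) :
    ∫⁻ x : Rn n, ENNReal.ofReal (wt M (t • (x - c))) =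
      ENNReal.ofReal (t ^ n)⁻¹ * ENNReal.ofReal (∫ y : Rn n, wt M y) := by
  have h : ∀ x : Rn n, wt M (t • (x - c)) = wt M (t • (c - x)) := fun x => by
    rw [← wt_neg, ← smul_neg, neg_sub]
  simp_rw [h]
  rw [← ofReal_integral_eq_lintegral_ofReal (wt_scale_integrable hM ht.ne' c)
    (Eventually.of_forall fun y => (wt_pos _ _).le), wt_scale_integral M ht c,
    ENNReal.ofReal_mul (by positivity)]

lemma wt_scale_lattice {M : ℝ} (hM : (n : ℝ) < M) : ∃ C : ℝ≥0∞, C ≠ ∞ ∧ ∀ (i ν : ℕ), i ≤ ν →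
    ∀ x : Rn n, ∑' m : Fin n → ℤ, ENNReal.ofReal (wt M ((2 : ℝ) ^ i • (x - xm ν m))) ≤
      C * e2 (((ν : ℝ) - i) * n) := by
  obtain ⟨C, hC, h⟩ := lattice_sum hM
  refine ⟨C, hC, fun i ν hi x => ?_⟩
  have h1 := h ((2 : ℝ) ^ i * ((2 : ℝ) ^ ν)⁻¹) (by positivity) (by
    rw [← div_eq_mul_inv, div_le_one (by positivity)]
    exact pow_le_pow_right₀ (by norm_num) hi) ((2 : ℝ) ^ i • x)
  have e1 : ENNReal.ofReal (((2 : ℝ) ^ i * ((2 : ℝ) ^ ν)⁻¹) ^ n) = e2 (-(((ν : ℝ) - i) * n)) := by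
    rw [← e2_ofReal]
    congr 1
    rw [← Real.rpow_natCast 2 i, ← Real.rpow_natCast 2 ν, ← Real.rpow_neg (by norm_num),
      ← Real.rpow_add (by norm_num), ← Real.rpow_natCast, ← Real.rpow_mul (by norm_num)]
    congr 1; ring
  rw [e1] at h1
  have e3 : ∀ m : Fin n → ℤ, (2 : ℝ) ^ i • x - ((2 : ℝ) ^ i * ((2 : ℝ) ^ ν)⁻¹) • zpt m
      = (2 : ℝ) ^ i • (x - xm ν m) := by
    intro m; rw [xm, smul_sub, smul_smul]
  simp_rw [e3] at h1
  calc _ = e2 (((ν : ℝ) - i) * n) * (e2 (-(((ν : ℝ) - i) * n)) *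
        ∑' m : Fin n → ℤ, ENNReal.ofReal (wt M ((2 : ℝ) ^ i • (x - xm ν m)))) := by
        rw [← mul_assoc, ← e2_add, add_neg_cancel, e2_zero, one_mul]
    _ ≤ e2 (((ν : ℝ) - i) * n) * C := mul_le_mul' le_rfl h1
    _ = _ := mul_comm _ _

lemma kap_le {K : ℕ} {M : ℝ} {j ν : ℕ} (h : j ≤ ν) (m : Fin n → ℤ) (x : Rn n) :
    ENNReal.ofReal (kap K M j ν m x) =
      e2 (-(((ν : ℝ) - j) * n)) * ENNReal.ofReal (wt M ((2 : ℝ) ^ j • (x - xm ν m))) := by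
  rw [kap, if_pos h, ENNReal.ofReal_mul (by positivity), ← e2_ofReal]
  congr 2
  rw [← Real.rpow_natCast 2 (ν - j), ← Real.rpow_neg (by norm_num), ← Real.rpow_natCast,
    ← Real.rpow_mul (by norm_num), Nat.cast_sub h]
  congr 1; ring

lemma kap_gt {K : ℕ} {M : ℝ} {j ν : ℕ} (h : ν < j) (m : Fin n → ℤ) (x : Rn n) :
    ENNReal.ofReal (kap K M j ν m x) =
      e2 (-(((j : ℝ) - ν) * K)) * ENNReal.ofReal (wt M ((2 : ℝ) ^ ν • (x - xm ν m))) := by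
  rw [kap, if_neg (not_le.2 h), ENNReal.ofReal_mul (by positivity), ← e2_ofReal]
  congr 2
  rw [← Real.rpow_natCast 2 (j - ν), ← Real.rpow_neg (by norm_num), ← Real.rpow_natCast,
    ← Real.rpow_mul (by norm_num), Nat.cast_sub h.le]
  congr 1; ring

/-- weighted decay factor -/
def kk {n : ℕ} (s : ℝ) (K : ℕ) (M : ℝ) (j ν : ℕ) (m : Fin n → ℤ) (x : Rn n) : ℝ≥0∞ :=
  e2 (((j : ℝ) - ν) * s) * ENNReal.ofReal (kap K M j ν m x)

lemma kk_meas (s : ℝ) (K : ℕ) (M : ℝ) (j ν : ℕ) (m : Fin n → ℤ) :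
    Measurable (kk (n := n) s K M j ν m) := by
  unfold kk kap
  have h : ∀ t : ℝ, Continuous fun x : Rn n => wt M (t • (x - xm ν m)) := fun t =>
    (wt_cont M).comp (by fun_prop)
  refine Measurable.const_mul (ENNReal.measurable_ofReal.comp ?_) _
  split_ifs
  · exact ((h _).measurable).const_mul _
  · exact ((h _).measurable).const_mul _

lemma kk_sum {s : ℝ} {K : ℕ} {M : ℝ} (hM : (n : ℝ) < M) {δ : ℝ} (h1 : δ ≤ s) (h2 : δ ≤ K - s) :
    ∃ C : ℝ≥0∞, C ≠ ∞ ∧ ∀ j ν (x : Rn n),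
      ∑' m : Fin n → ℤ, kk s K M j ν m x ≤ C * e2 (-(δ * |(j : ℝ) - ν|)) := by
  obtain ⟨C, hC, h⟩ := wt_scale_lattice (n := n) hM
  refine ⟨C, hC, fun j ν x => ?_⟩
  unfold kk
  rw [ENNReal.tsum_mul_left]
  rcases le_or_gt j ν with hj | hj
  · simp_rw [kap_le hj]
    have hj' : (j : ℝ) ≤ ν := by exact_mod_cast hj
    rw [ENNReal.tsum_mul_left, abs_of_nonpos (by linarith)]
    calc _ ≤ e2 (((j : ℝ) - ν) * s) * (e2 (-(((ν : ℝ) - j) * n)) * (C * e2 (((ν : ℝ) - j) * n))) :=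
          mul_le_mul' le_rfl (mul_le_mul' le_rfl (h j ν hj x))
      _ = C * (e2 (((j : ℝ) - ν) * s) * (e2 (-(((ν : ℝ) - j) * n)) * e2 (((ν : ℝ) - j) * n))) := by ring
      _ ≤ _ := by
        rw [← e2_add, ← e2_add]
        refine mul_le_mul' le_rfl (e2_mono ?_)
        nlinarith
  · simp_rw [kap_gt hj]
    have hj' : (ν : ℝ) < j := by exact_mod_cast hj
    rw [ENNReal.tsum_mul_left, abs_of_nonneg (by linarith)]
    calc _ ≤ e2 (((j : ℝ) - ν) * s) * (e2 (-(((j : ℝ) - ν) * K)) * (C * e2 (((ν : ℝ) - ν) * n))) :=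
          mul_le_mul' le_rfl (mul_le_mul' le_rfl (h ν ν le_rfl x))
      _ = C * (e2 (((j : ℝ) - ν) * s) * (e2 (-(((j : ℝ) - ν) * K)) * e2 (((ν : ℝ) - ν) * n))) := by ring
      _ ≤ _ := by
        rw [← e2_add, ← e2_add]
        refine mul_le_mul' le_rfl (e2_mono ?_)
        nlinarith

lemma kk_int {s : ℝ} {K : ℕ} {M u : ℝ} (hu : 0 < u) (hM : (n : ℝ) < M * u) {δ : ℝ}
    (h1 : δ ≤ s * u - n * (1 - u)) (h2 : δ ≤ (K - s) * u) :
    ∃ C : ℝ≥0∞, C ≠ ∞ ∧ ∀ j ν (m : Fin n → ℤ),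
      ∫⁻ x : Rn n, kk s K M j ν m x ^ u ≤ C * e2 (-(δ * |(j : ℝ) - ν|)) * e2 (-(ν * n)) := by
  refine ⟨ENNReal.ofReal (∫ y : Rn n, wt (M * u) y), ENNReal.ofReal_ne_top, fun j ν m => ?_⟩
  have hwt : ∀ x : Rn n, ENNReal.ofReal (wt M x) ^ u = ENNReal.ofReal (wt (M * u) x) := fun x => by
    rw [ENNReal.ofReal_rpow_of_pos (wt_pos _ _), wt_rpow]
  have e1 : ∀ i : ℕ, ENNReal.ofReal (((2 : ℝ) ^ i) ^ n)⁻¹ = e2 (-(i * n)) := by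
    intro i
    rw [← e2_ofReal, Real.rpow_neg (by norm_num), ← pow_mul, ← Real.rpow_natCast]
    push_cast; rfl
  unfold kk
  rcases le_or_gt j ν with hj | hj
  · simp_rw [kap_le hj, ENNReal.mul_rpow_of_nonneg _ _ hu.le, hwt, e2_rpow]
    have hj' : (j : ℝ) ≤ ν := by exact_mod_cast hj
    rw [lintegral_const_mul' _ _ (e2_ne_top _), lintegral_const_mul' _ _ (e2_ne_top _),
      wt_scale_lintegral hM (by positivity), e1, abs_of_nonpos (by linarith), ← mul_assoc, ← mul_assoc,
      ← e2_add, ← e2_add, mul_comm,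
      mul_assoc (ENNReal.ofReal _), ← e2_add]
    refine mul_le_mul' le_rfl (e2_mono ?_)
    nlinarith
  · simp_rw [kap_gt hj, ENNReal.mul_rpow_of_nonneg _ _ hu.le, hwt, e2_rpow]
    have hj' : (ν : ℝ) < j := by exact_mod_cast hj
    rw [lintegral_const_mul' _ _ (e2_ne_top _), lintegral_const_mul' _ _ (e2_ne_top _),
      wt_scale_lintegral hM (by positivity), e1, abs_of_nonneg (by linarith), ← mul_assoc, ← mul_assoc,
      ← e2_add, ← e2_add, mul_comm,
      mul_assoc (ENNReal.ofReal _), ← e2_add]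
    refine mul_le_mul' le_rfl (e2_mono ?_)
    nlinarith

lemma point_bound {φ : ℕ → Sch n} (hφ : SmoothResolution n φ) (s' : ℝ) (K : ℕ) {d : ℝ} (hd : 0 ≤ d)
    {M : ℝ} (hM : 0 ≤ M) (s : ℝ) : ∃ C : ℝ≥0∞, C ≠ ∞ ∧ ∀ (f : TDist n E)
      (lam : ℕ → (Fin n → ℤ) → ℂ) (a : ℕ → (Fin n → ℤ) → Rn n → E),
      (∀ ν m, AtomLike s' K d ν m (a ν m)) → RepresentsAtomic f lam a → ∀ (j : ℕ) (x : Rn n),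
      e2 (j * s) * ‖mOp (φ j) f x‖ₑ ≤ C * ∑' νm : ℕ × (Fin n → ℤ),
        (‖lam νm.1 νm.2‖ₑ * e2 (νm.1 * (s - s'))) * kk s K M j νm.1 νm.2 x := by
  obtain ⟨C, hC0, hC⟩ := atom_est (E := E) hφ s' K hd hM
  refine ⟨‖((2 * π) ^ (-(n : ℝ) / 2) : ℝ)‖ₑ * ENNReal.ofReal C,
    ENNReal.mul_ne_top enorm_ne_top ENNReal.ofReal_ne_top, ?_⟩
  intro f lam a ha hf j x
  have h1 := hasSum_enorm_le (hf (shiftReflect (invFourierS (φ j)) x))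
  rw [mOp, tdConv, enorm_smul, mul_comm, mul_assoc, mul_assoc]
  refine mul_le_mul' le_rfl ?_
  rw [mul_comm]
  refine (mul_le_mul' le_rfl h1).trans ?_
  rw [← ENNReal.tsum_mul_left, ← ENNReal.tsum_mul_left]
  refine ENNReal.tsum_le_tsum fun νm => ?_
  rw [enorm_smul]
  have h2 : ‖∫ y, shiftReflect (invFourierS (φ j)) x y • a νm.1 νm.2 y‖ₑ ≤
      ENNReal.ofReal C * e2 (-(νm.1 : ℝ) * s') * ENNReal.ofReal (kap K M j νm.1 νm.2 x) := by
    rw [← ofReal_norm, ← e2_ofReal, ← ENNReal.ofReal_mul hC0.le, ← ENNReal.ofReal_mul (by positivity)]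
    exact ENNReal.ofReal_le_ofReal (hC j νm.1 νm.2 _ (ha _ _) x)
  refine (mul_le_mul' le_rfl (mul_le_mul' le_rfl h2)).trans (le_of_eq ?_)
  unfold kk
  have e : e2 (j * s) * e2 (-(νm.1 : ℝ) * s') = e2 (νm.1 * (s - s')) * e2 (((j : ℝ) - νm.1) * s) := by
    rw [← e2_add, ← e2_add]; congr 1; ring
  calc _ = (e2 (j * s) * e2 (-(νm.1 : ℝ) * s')) * (‖lam νm.1 νm.2‖ₑ *
        (ENNReal.ofReal C * ENNReal.ofReal (kap K M j νm.1 νm.2 x))) := by ring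
    _ = _ := by rw [e]; ring


lemma is1Atom_atomLike {K : ℕ} {d : ℝ} {m : Fin n → ℤ} {a : Rn n → E} (s' : ℝ)
    (h : Is1Atom K d m a) : AtomLike s' K d 0 m a :=
  ⟨h.1, h.2.1, fun α hα x => by simpa using h.2.2 α hα x⟩

lemma isSPAtom_atomLike {s : ℝ} {p : ℝ≥0∞} {K : ℕ} {d : ℝ} {ν : ℕ} {m : Fin n → ℤ} {a : Rn n → E}
    (h : IsSPAtom s p K (-1) d ν m a) : AtomLike (s - (n : ℝ) / p.toReal) K d ν m a :=
  ⟨h.1, h.2.1, h.2.2.1⟩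

lemma dir1_fin {φ : ℕ → Sch n} (hφ : SmoothResolution n φ) {p q : ℝ≥0∞} (hp0 : 0 < p) (hpt : p ≠ ∞)
    (hq : 0 < q) {s : ℝ} (hs : sigmaP n p < s) {K : ℕ} (hK : s < K) {d : ℝ} (hd : 0 ≤ d) :
    ∃ C : ℝ≥0∞, C ≠ ∞ ∧ ∀ (f : TDist n E)
      (lam : ℕ → (Fin n → ℤ) → ℂ) (a : ℕ → (Fin n → ℤ) → Rn n → E),
      (∀ ν m, AtomLike (s - (n : ℝ) / p.toReal) K d ν m (a ν m)) → RepresentsAtomic f lam a →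
      besovNorm s p q φ f ≤ C * bNorm p q lam := by
  set P := p.toReal with hPdef
  have hP : 0 < P := ENNReal.toReal_pos hp0.ne' hpt
  have hs0 : 0 < s := lt_of_le_of_lt (le_max_right _ _) hs
  have hs1 : (n : ℝ) * (1 / P - 1) < s := lt_of_le_of_lt (le_max_left _ _) hs
  set u := min 1 P with hu
  have hu0 : 0 < u := lt_min one_pos hP
  have hu1 : u ≤ 1 := min_le_left _ _
  obtain ⟨M, hM1, hM2⟩ : ∃ M : ℝ, (n : ℝ) < M * u ∧ (n : ℝ) < M := by
    refine ⟨(n + 1) / u, by rw [div_mul_cancel₀ _ hu0.ne']; linarith, ?_⟩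
    rw [lt_div_iff₀ hu0]
    have : (0 : ℝ) ≤ n := n.cast_nonneg
    nlinarith
  have hM0 : 0 ≤ M := (Nat.cast_nonneg n).trans hM2.le
  have hsu : 0 < s * u - n * (1 - u) := by
    rcases le_total 1 P with h | h
    · have : u = 1 := min_eq_left h
      rw [this]; simpa using hs0
    · have : u = P := min_eq_right h
      rw [this]
      have h2 := mul_lt_mul_of_pos_right hs1 hP
      have h3 : (n : ℝ) * (1 / P - 1) * P = n * (1 - P) := by field_simp
      linarith
  set δ := min (s * u - n * (1 - u)) ((K - s) * u) with hδ
  have hδ0 : 0 < δ := lt_min hsu (mul_pos (by linarith) hu0)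
  set δ' := min s (K - s) with hδ'
  have hδ0' : 0 < δ' := lt_min hs0 (by linarith)
  obtain ⟨C1, hC1, h1⟩ := point_bound (E := E) hφ (s - (n : ℝ) / P) K hd hM0 s
  obtain ⟨C2, hC2, h2⟩ := kk_sum (n := n) (s := s) (K := K) hM2 (min_le_left _ _ : δ' ≤ s) (min_le_right _ _)
  obtain ⟨C3, hC3, h3⟩ := kk_int (n := n) (s := s) (K := K) hu0 hM1 (min_le_left _ _ : δ ≤ _) (min_le_right _ _)
  set A := C2 * geo δ' with hA
  have hAt : A ≠ ∞ := ENNReal.mul_ne_top hC2 (geo_ne_top hδ0')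
  have hsum : ∀ j (x : Rn n), ∑' νm : ℕ × (Fin n → ℤ), kk s K M j νm.1 νm.2 x ≤ A := by
    intro j x
    rw [ENNReal.tsum_prod (f := fun ν m => kk s K M j ν m x)]
    refine (ENNReal.tsum_le_tsum fun ν => h2 j ν x).trans ?_
    rw [ENNReal.tsum_mul_left]
    exact mul_le_mul' le_rfl (geo_left _ _)
  set CC := C1 ^ P * A ^ (max (P - 1) 0) * C3 with hCC
  have hCCt : CC ≠ ∞ := by
    refine ENNReal.mul_ne_top (ENNReal.mul_ne_top ?_ ?_) hC3
    · exact ENNReal.rpow_ne_top_of_nonneg hP.le hC1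
    · exact ENNReal.rpow_ne_top_of_nonneg (le_max_right _ _) hAt
  obtain ⟨C4, hC4, h4⟩ := young_lq hP hδ0 hq hCCt
  refine ⟨C4, hC4, fun f lam a ha hf => ?_⟩
  unfold besovNorm bNorm
  simp only [if_neg hpt]
  refine h4 _ _ fun j => ?_
  have e0 : ∀ x, e2 (j * s) * ‖mOp (φ j) f x‖ₑ ≤ _ := h1 f lam a ha hf j
  rw [eLpNorm_eq_lintegral_rpow_enorm_toReal hp0.ne' hpt]
  change (e2 (j * s) * _) ^ P ≤ _
  rw [ENNReal.mul_rpow_of_nonneg _ _ hP.le, one_div, rpow_inv_cancel' _ hP,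
    ← lintegral_const_mul' _ _ (ENNReal.rpow_ne_top_of_nonneg hP.le (e2_ne_top _))]
  calc _ ≤ ∫⁻ x, C1 ^ P * (A ^ (max (P - 1) 0) * ∑' νm : ℕ × (Fin n → ℤ),
        (‖lam νm.1 νm.2‖ₑ * e2 (νm.1 * (n / P))) ^ P * kk s K M j νm.1 νm.2 x ^ u) := by
        refine lintegral_mono fun x => ?_
        rw [← ENNReal.mul_rpow_of_nonneg _ _ hP.le]
        refine (ENNReal.rpow_le_rpow (e0 x) hP.le).trans ?_
        rw [ENNReal.mul_rpow_of_nonneg _ _ hP.le]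
        refine mul_le_mul' le_rfl ?_
        simp only [sub_sub_cancel]
        exact tsum_rpow_le _ _ hP fun _ => hsum j x
    _ = C1 ^ P * (A ^ (max (P - 1) 0) * ∑' νm : ℕ × (Fin n → ℤ),
        (‖lam νm.1 νm.2‖ₑ * e2 (νm.1 * (n / P))) ^ P * ∫⁻ x, kk s K M j νm.1 νm.2 x ^ u) := by
        rw [lintegral_const_mul' _ _ (ENNReal.rpow_ne_top_of_nonneg hP.le hC1),
          lintegral_const_mul' _ _ (ENNReal.rpow_ne_top_of_nonneg (le_max_right _ _) hAt),
          lintegral_tsum]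
        · congr 3
          ext νm
          rw [lintegral_const_mul _ ((kk_meas s K M j νm.1 νm.2).pow_const _)]
        · intro νm
          exact (((kk_meas s K M j νm.1 νm.2).pow_const _).const_mul _).aemeasurable
    _ ≤ C1 ^ P * (A ^ (max (P - 1) 0) * ∑' νm : ℕ × (Fin n → ℤ),
          C3 * (‖lam νm.1 νm.2‖ₑ ^ P * e2 (-(δ * |(j : ℝ) - νm.1|)))) := by
        refine mul_le_mul' le_rfl (mul_le_mul' le_rfl (ENNReal.tsum_le_tsum fun νm => ?_))
        refine (mul_le_mul' le_rfl (h3 j νm.1 νm.2)).trans (le_of_eq ?_)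
        rw [ENNReal.mul_rpow_of_nonneg _ _ hP.le, e2_rpow]
        have : e2 (νm.1 * (n / P) * P) * e2 (-(νm.1 * n)) = 1 := by
          rw [← e2_add, ← e2_zero]; congr 1; field_simp; ring
        calc _ = C3 * (‖lam νm.1 νm.2‖ₑ ^ P * e2 (-(δ * |(j : ℝ) - νm.1|))) *
              (e2 (νm.1 * (n / P) * P) * e2 (-(νm.1 * n))) := by ring
          _ = _ := by rw [this, mul_one]
    _ = _ := by
        rw [ENNReal.tsum_mul_left, ENNReal.tsum_prod (f := fun ν m => ‖lam ν m‖ₑ ^ P * e2 (-(δ * |(j : ℝ) - ν|))),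
          hCC, mul_assoc, mul_assoc]
        congr 4
        ext ν
        rw [ENNReal.tsum_mul_right, ← hPdef, rpow_inv_cancel' _ hP]
        rfl

lemma dir1_inf {φ : ℕ → Sch n} (hφ : SmoothResolution n φ) {q : ℝ≥0∞}
    (hq : 0 < q) {s : ℝ} (hs0 : 0 < s) {K : ℕ} (hK : s < K) {d : ℝ} (hd : 0 ≤ d) :
    ∃ C : ℝ≥0∞, C ≠ ∞ ∧ ∀ (f : TDist n E)
      (lam : ℕ → (Fin n → ℤ) → ℂ) (a : ℕ → (Fin n → ℤ) → Rn n → E),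
      (∀ ν m, AtomLike s K d ν m (a ν m)) → RepresentsAtomic f lam a →
      besovNorm s ∞ q φ f ≤ C * bNorm ∞ q lam := by
  have hM2 : (n : ℝ) < n + 1 := by linarith
  set δ := min s (K - s) with hδ
  have hδ0 : 0 < δ := lt_min hs0 (by linarith)
  obtain ⟨C1, hC1, h1⟩ := point_bound (E := E) hφ s K hd ((Nat.cast_nonneg n).trans hM2.le) s
  obtain ⟨C2, hC2, h2⟩ := kk_sum (n := n) (s := s) (K := K) hM2 (min_le_left _ _ : δ ≤ s) (min_le_right _ _)
  obtain ⟨C4, hC4, h4⟩ := young_lq one_pos hδ0 hq (ENNReal.mul_ne_top hC1 hC2)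
  refine ⟨C4, hC4, fun f lam a ha hf => ?_⟩
  unfold besovNorm bNorm
  simp only [if_true]
  refine h4 _ _ fun j => ?_
  simp only [ENNReal.rpow_one]
  set B := C1 * C2 * ∑' ν : ℕ, (⨆ m : Fin n → ℤ, (‖lam ν m‖₊ : ℝ≥0∞)) * e2 (-(δ * |(j : ℝ) - ν|)) with hB
  have e0 : ∀ x, e2 (j * s) * ‖mOp (φ j) f x‖ₑ ≤ B := by
    intro x
    refine (h1 f lam a ha hf j x).trans ?_
    rw [hB, mul_assoc]
    refine mul_le_mul' le_rfl ?_
    rw [ENNReal.tsum_prod (f := fun ν m => (‖lam ν m‖ₑ * e2 (ν * (s - s))) * kk s K (n + 1) j ν m x),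
      ← ENNReal.tsum_mul_left]
    refine ENNReal.tsum_le_tsum fun ν => ?_
    calc _ ≤ ∑' m : Fin n → ℤ, (⨆ m : Fin n → ℤ, (‖lam ν m‖₊ : ℝ≥0∞)) * kk s K (n + 1) j ν m x := by
          refine ENNReal.tsum_le_tsum fun m => ?_
          rw [sub_self, mul_zero, e2_zero, mul_one]
          exact mul_le_mul' (le_iSup (fun m : Fin n → ℤ => (‖lam ν m‖₊ : ℝ≥0∞)) m) le_rfl
      _ ≤ _ := by
          rw [ENNReal.tsum_mul_left]
          refine (mul_le_mul' le_rfl (h2 j ν x)).trans (le_of_eq (by ring))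
  change e2 (j * s) * _ ≤ B
  rw [eLpNorm_exponent_top]
  have hB' : ∀ x, ‖mOp (φ j) f x‖ₑ ≤ e2 (-(j * s)) * B := by
    intro x
    calc _ = e2 (-(j * s)) * (e2 (j * s) * ‖mOp (φ j) f x‖ₑ) := by
          rw [← mul_assoc, ← e2_add, neg_add_cancel, e2_zero, one_mul]
      _ ≤ _ := mul_le_mul' le_rfl (e0 x)
  have h5 : eLpNormEssSup (mOp (φ j) f) volume ≤ e2 (-(j * s)) * B :=
    essSup_le_of_ae_le _ (Eventually.of_forall hB')
  refine (mul_le_mul' le_rfl h5).trans (le_of_eq ?_)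
  rw [← mul_assoc, ← e2_add, add_neg_cancel, e2_zero, one_mul]

lemma dir1 {φ : ℕ → Sch n} (hφ : SmoothResolution n φ) {p q : ℝ≥0∞} (hp0 : 0 < p)
    (hq : 0 < q) {s : ℝ} (hs : sigmaP n p < s) {K : ℕ} (hK : s < K) {d : ℝ} (hd : 0 ≤ d) :
    ∃ C : ℝ≥0∞, C ≠ ∞ ∧ ∀ (f : TDist n E)
      (lam : ℕ → (Fin n → ℤ) → ℂ) (a : ℕ → (Fin n → ℤ) → Rn n → E),
      (∀ m, Is1Atom K d m (a 0 m)) → (∀ ν m, 0 < ν → IsSPAtom s p K (-1) d ν m (a ν m)) →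
      RepresentsAtomic f lam a →
      besovNorm s p q φ f ≤ C * bNorm p q lam := by
  have hat : ∀ a : ℕ → (Fin n → ℤ) → Rn n → E, (∀ m, Is1Atom K d m (a 0 m)) →
      (∀ ν m, 0 < ν → IsSPAtom s p K (-1) d ν m (a ν m)) →
      ∀ ν m, AtomLike (s - (n : ℝ) / p.toReal) K d ν m (a ν m) := by
    intro a h0 h1 ν m
    rcases Nat.eq_zero_or_pos ν with rfl | hν
    · exact is1Atom_atomLike _ (h0 m)
    · exact isSPAtom_atomLike (h1 ν m hν)
  by_cases hpt : p = ∞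
  · subst hpt
    obtain ⟨C, hC, h⟩ := dir1_inf (E := E) hφ hq (lt_of_le_of_lt (le_max_right _ _) hs) hK hd
    refine ⟨C, hC, fun f lam a h0 h1 hf => h f lam a (fun ν m => ?_) hf⟩
    simpa using hat a h0 h1 ν m
  · obtain ⟨C, hC, h⟩ := dir1_fin (E := E) hφ hp0 hpt hq hs hK hd
    exact ⟨C, hC, fun f lam a h0 h1 hf => h f lam a (hat a h0 h1) hf⟩


lemma lineDeriv_shift (ψ : Sch n) (x e : Rn n) :
    ∂_{e} (shiftReflect ψ x) = - shiftReflect (∂_{e} ψ) x := by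
  ext y
  rw [SchwartzMap.lineDerivOp_apply_eq_fderiv]
  have h1 : HasFDerivAt (fun y : Rn n => ψ (x - y))
      ((fderiv ℝ ψ (x - y)).comp (-(ContinuousLinearMap.id ℝ (Rn n)))) y :=
    (ψ.differentiableAt.hasFDerivAt).comp y ((hasFDerivAt_id y).const_sub x)
  have h2 : (⇑(shiftReflect ψ x) : Rn n → ℂ) = fun y => ψ (x - y) := rfl
  rw [h2, h1.fderiv]
  change _ = -(∂_{e} ψ) (x - y)
  rw [SchwartzMap.lineDerivOp_apply_eq_fderiv]
  simp

lemma shiftReflect_smul (c : ℂ) (ψ : Sch n) (x : Rn n) :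
    shiftReflect (c • ψ) x = c • shiftReflect ψ x := by
  ext y; rfl

lemma shiftReflect_neg (ψ : Sch n) (x : Rn n) :
    shiftReflect (-ψ) x = - shiftReflect ψ x := by
  ext y; rfl

lemma dlS_append (L : List (Fin n)) (i : Fin n) (φ : Sch n) :
    dlS (L ++ [i]) φ = dlS L (∂_{eb i} φ) := by
  simp [dlS, List.foldr_append]

/-- derivative as a continuous linear map -/
def dlC {n : ℕ} : List (Fin n) → (Sch n →L[ℂ] Sch n)
  | [] => ContinuousLinearMap.id ℂ _
  | i :: L => (LineDeriv.lineDerivOpCLM ℂ (Sch n) (eb i)).comp (dlC L)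

lemma dlC_apply (L : List (Fin n)) (φ : Sch n) : dlC L φ = dlS L φ := by
  induction L with
  | nil => rfl
  | cons i L ih =>
    simp only [dlC, ContinuousLinearMap.comp_apply, ih, dlS, List.foldr_cons]
    rfl

lemma dlS_neg (L : List (Fin n)) (φ : Sch n) : dlS L (-φ) = - dlS L φ := by
  rw [← dlC_apply, map_neg, dlC_apply]

lemma dl_shift (L : List (Fin n)) : ∀ (ψ : Sch n) (x : Rn n),
    dlS L (shiftReflect ψ x) = shiftReflect ((-1 : ℂ) ^ L.length • dlS L ψ) x := by
  induction L using List.reverseRecOn with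
  | nil => intro ψ x; simp [dlS]
  | append_singleton L i ih =>
    intro ψ x
    rw [dlS_append, lineDeriv_shift, dlS_neg, ih, dlS_append, ← shiftReflect_neg]
    congr 1
    simp [pow_succ]

lemma ex_base (χ φ : Sch n) (y : Rn n) :
    ∫ x, φ x * shiftReflect (invFourierS χ) x y = fourierS (smulLeftCLM ℂ χ (invFourierS φ)) y := by
  have h0 : ∫ x, φ x * shiftReflect (invFourierS χ) x y =
      ∫ x, (φ.compSubConstCLM ℂ (-y)) x * (𝓕⁻ χ) x := by
    refine Eq.trans ?_ (integral_sub_right_eq_self (μ := volume) (fun x => (φ.compSubConstCLM ℂ (-y)) x * (𝓕⁻ χ : Sch n) x) y)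
    refine integral_congr_ae (Eventually.of_forall fun x => ?_)
    simp only [compSubConstCLM_apply, sub_neg_eq_add, sub_add_cancel]
    rfl
  rw [h0, ← SchwartzMap.integral_fourierInv_mul_eq, fourierS_apply]
  refine integral_congr_ae (Eventually.of_forall fun ξ => ?_)
  simp only
  rw [smulLeftCLM_apply_apply χ.hasTemperateGrowth, ← invFourierS_eq, invFourierS_apply,
    invFourierS_apply]
  have : ∫ v : Rn n, Complex.exp (((2 * π * inner ℝ v ξ : ℝ) : ℂ) * Complex.I) • φ v =
      Complex.exp (((2 * π * inner ℝ ξ y : ℝ) : ℂ) * Complex.I) *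
        ∫ v : Rn n, Complex.exp (((2 * π * inner ℝ v ξ : ℝ) : ℂ) * Complex.I) •
          (φ.compSubConstCLM ℂ (-y)) v := by
    rw [← integral_sub_right_eq_self (fun v => Complex.exp (((2 * π * inner ℝ v ξ : ℝ) : ℂ) * Complex.I) •
          (φ.compSubConstCLM ℂ (-y)) v) y, ← integral_const_mul]
    refine integral_congr_ae (Eventually.of_forall fun v => ?_)
    simp only [compSubConstCLM_apply, sub_neg_eq_add, sub_add_cancel, smul_eq_mul]
    rw [← mul_assoc, ← Complex.exp_add]
    congr 2
    rw [inner_sub_left, real_inner_comm ξ y]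
    push_cast; ring
  rw [this, smul_eq_mul, smul_eq_mul]
  have e : Complex.exp (((-2 * π * inner ℝ ξ y : ℝ) : ℂ) * Complex.I) *
      Complex.exp (((2 * π * inner ℝ ξ y : ℝ) : ℂ) * Complex.I) = 1 := by
    rw [← Complex.exp_add, ← Complex.exp_zero]; congr 1; push_cast; ring
  calc _ = (∫ v : Rn n, Complex.exp (((2 * π * inner ℝ v ξ : ℝ) : ℂ) * Complex.I) •
          (φ.compSubConstCLM ℂ (-y)) v) * χ ξ * 1 := by rw [mul_one]
    _ = _ := by rw [← e]; ring

lemma ex_pt (L : List (Fin n)) : ∀ (χ φ : Sch n) (y : Rn n),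
    ∫ x, φ x * dlS L (shiftReflect (invFourierS χ) x) y =
      dlS L (fourierS (smulLeftCLM ℂ χ (invFourierS φ))) y := by
  induction L using List.reverseRecOn with
  | nil => exact ex_base
  | append_singleton L i ih =>
    intro χ φ y
    have ht : Function.HasTemperateGrowth (fun ξ : Rn n => inner ℝ ξ (eb i)) := by fun_prop
    set χ' : Sch n := -(2 * π * Complex.I) • smulLeftCLM ℂ (fun ξ : Rn n => inner ℝ ξ (eb i)) χ with hχ'
    have h1 : ∀ x, dlS (L ++ [i]) (shiftReflect (invFourierS χ) x) =
        dlS L (shiftReflect (invFourierS χ') x) := by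
      intro x
      rw [dlS_append, lineDeriv_shift, ← shiftReflect_neg]
      congr 2
      rw [invFourierS_eq, SchwartzMap.lineDerivOp_fourierInv_eq, hχ', neg_smul, invFourierS,
        map_neg]
      rfl
    have h2 : dlS (L ++ [i]) (fourierS (smulLeftCLM ℂ χ (invFourierS φ))) =
        dlS L (fourierS (smulLeftCLM ℂ χ' (invFourierS φ))) := by
      rw [dlS_append, fourierS_eq, SchwartzMap.lineDerivOp_fourier_eq, fourierS_eq]
      congr 2
      ext ξ
      rw [smulLeftCLM_apply_apply χ'.hasTemperateGrowth, hχ', smul_apply, smulLeftCLM_apply_apply ht,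
        smulLeftCLM_apply_apply χ.hasTemperateGrowth, smul_apply, smulLeftCLM_apply_apply ht]
      simp only [smul_eq_mul, Complex.real_smul]
      ring
    simp_rw [h1, h2]
    exact ih χ' φ y


/-- polynomial weight -/
def pw (n K : ℕ) (y : Rn n) : ℂ := (((1 + ‖y‖ ^ 2 : ℝ)) : ℂ) ^ K

lemma pw_temp (n K : ℕ) : Function.HasTemperateGrowth (pw n K) := by
  unfold pw; fun_prop

lemma pw_norm (K : ℕ) (y : Rn n) : ‖pw n K y‖ = (1 + ‖y‖ ^ 2) ^ K := by
  rw [pw, norm_pow, Complex.norm_real, Real.norm_of_nonneg (by positivity)]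

lemma pw_le (K : ℕ) (y : Rn n) : ‖pw n K y‖ * wt (2 * K) y ≤ 1 := by
  rw [pw_norm, wt, Real.rpow_neg (by positivity), ← div_eq_mul_inv, div_le_one (by positivity)]
  have : (1 + ‖y‖) ^ (2 * (K : ℝ)) = ((1 + ‖y‖) ^ 2) ^ K := by
    rw [← pow_mul, ← Real.rpow_natCast]; push_cast; rfl
  rw [this]
  refine pow_le_pow_left₀ (by positivity) ?_ _
  nlinarith [norm_nonneg y]

/-- embedding into a Banach space -/
def Jm (n K L : ℕ) : Sch n →L[ℂ] ((Fin n → Fin (L + 1)) → BoundedContinuousFunction (Rn n) ℂ) :=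
  ContinuousLinearMap.pi fun α =>
    (toBoundedContinuousFunctionCLM ℂ (Rn n) ℂ).comp
      ((smulLeftCLM ℂ (pw n K)).comp (dlC (flatIdx fun i => (α i : ℕ))))

lemma Jm_apply (K L : ℕ) (φ : Sch n) (α : Fin n → Fin (L + 1)) (y : Rn n) :
    Jm n K L φ α y = pw n K y * dlS (flatIdx fun i => (α i : ℕ)) φ y := by
  change (smulLeftCLM ℂ (pw n K) (dlC _ φ)) y = _
  rw [smulLeftCLM_apply_apply (pw_temp n K), dlC_apply, smul_eq_mul]

lemma schSemi_le (K L : ℕ) (φ : Sch n) :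
    schSemi K L φ ≤ (Fintype.card (Fin n → Fin (L + 1)) : ℝ) * ‖Jm n K L φ‖ := by
  refine ciSup_le fun x => ?_
  rw [Finset.mul_sum]
  have : (Fintype.card (Fin n → Fin (L + 1)) : ℝ) * ‖Jm n K L φ‖ =
      ∑ _α : Fin n → Fin (L + 1), ‖Jm n K L φ‖ := by
    rw [Finset.sum_const, Finset.card_univ, nsmul_eq_mul]
  rw [this]
  refine Finset.sum_le_sum fun α _ => ?_
  split_ifs
  · have h1 : ‖Jm n K L φ α x‖ ≤ ‖Jm n K L φ‖ :=
      ((Jm n K L φ α).norm_coe_le_norm x).trans (norm_le_pi_norm _ α)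
    refine le_trans ?_ h1
    rw [Jm_apply, norm_mul, pw_norm]
    rw [show (fun y => φ y) = ⇑φ from rfl, mderiv_sch]
    refine mul_le_mul_of_nonneg_right ?_ (norm_nonneg _)
    rw [← Real.rpow_natCast _ K]
    refine Real.rpow_le_rpow_of_exponent_le (le_add_of_nonneg_right (sq_nonneg ‖x‖)) ?_
    have : (0 : ℝ) ≤ K := K.cast_nonneg
    linarith
  · rw [mul_zero]; exact norm_nonneg _

lemma td_bound (f : TDist n E) : ∃ (C : ℝ) (K L : ℕ), 0 ≤ C ∧ ∀ φ, ‖f.toFun φ‖ ≤ C * ‖Jm n K L φ‖ := by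
  obtain ⟨c, K, L, h⟩ := f.bound
  refine ⟨|c| * Fintype.card (Fin n → Fin (L + 1)), K, L, by positivity, fun φ => (h φ).trans ?_⟩
  rw [mul_assoc]
  have h0 : 0 ≤ schSemi K L φ := by
    refine Real.iSup_nonneg fun x => mul_nonneg (by positivity) (Finset.sum_nonneg fun α _ => ?_)
    split_ifs <;> positivity
  calc c * schSemi K L φ ≤ |c| * schSemi K L φ := mul_le_mul_of_nonneg_right (le_abs_self c) h0
    _ ≤ _ := mul_le_mul_of_nonneg_left (schSemi_le K L φ) (abs_nonneg c)

lemma td_continuous (f : TDist n E) : Continuous f.toFun := by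
  obtain ⟨C, K, L, hC, h⟩ := td_bound f
  refine continuous_of_continuousAt_zero f.toFun.toAddMonoidHom ?_
  rw [ContinuousAt, map_zero]
  refine squeeze_zero_norm h ?_
  have : Continuous fun φ => C * ‖Jm n K L φ‖ := (continuous_const.mul ((Jm n K L).continuous.norm))
  have h2 := this.tendsto 0
  simpa using h2

lemma shift_comp_growth (K : ℕ) (ψ : Sch n) : ∃ C : ℝ, 0 < C ∧ ∀ x y : Rn n,
    ‖pw n K y * shiftReflect ψ x y‖ ≤ C * (1 + ‖x‖) ^ (2 * (K : ℝ)) := by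
  obtain ⟨C, hC, h⟩ := sch_decay ψ (2 * K)
  refine ⟨C, hC, fun x y => ?_⟩
  rw [norm_mul, shiftReflect_apply]
  have h1 := wt_add_le (M := 2 * K) (by positivity) (x - y) (-x)
  rw [norm_neg, show x - y + -x = -y by abel, wt_neg] at h1
  have hx : (0 : ℝ) ≤ (1 + ‖x‖) ^ (2 * (K : ℝ)) := by positivity
  calc _ ≤ ‖pw n K y‖ * (C * ((1 + ‖x‖) ^ (2 * (K : ℝ)) * wt (2 * K) y)) := by
        refine mul_le_mul_of_nonneg_left ((h _).trans ?_) (norm_nonneg _)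
        exact mul_le_mul_of_nonneg_left h1 hC.le
    _ = C * (1 + ‖x‖) ^ (2 * (K : ℝ)) * (‖pw n K y‖ * wt (2 * K) y) := by ring
    _ ≤ C * (1 + ‖x‖) ^ (2 * (K : ℝ)) * 1 := mul_le_mul_of_nonneg_left (pw_le K y) (by positivity)
    _ = _ := mul_one _

lemma shift_comp_lip (K : ℕ) (ψ : Sch n) : ∃ C : ℝ, 0 < C ∧ ∀ x x' y : Rn n, ‖x' - x‖ ≤ 1 →
    ‖pw n K y * shiftReflect ψ x' y - pw n K y * shiftReflect ψ x y‖ ≤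
      C * (2 + ‖x‖) ^ (2 * (K : ℝ)) * ‖x' - x‖ := by
  obtain ⟨C, hC, h⟩ := SBdd.decay_l (B := fun _ : Unit => ψ) (fun k l => ⟨_, fun _ => le_rfl⟩) 1 (2 * K)
  refine ⟨C, hC, fun x x' y hx => ?_⟩
  rw [← mul_sub, norm_mul, shiftReflect_apply, shiftReflect_apply]
  have hb : ‖ψ (x' - y) - ψ (x - y)‖ ≤ C * ((2 + ‖x‖) ^ (2 * (K : ℝ)) * wt (2 * K) y) *
      ‖(x' - y) - (x - y)‖ := by
    refine Convex.norm_image_sub_le_of_norm_fderiv_le (𝕜 := ℝ) (s := closedBall (x - y) 1)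
      (fun z _ => ψ.differentiableAt) (fun z hz => ?_) (convex_closedBall _ _) (by simp)
      (by rw [mem_closedBall, dist_eq_norm]; simpa using hx)
    have h1 := h () z
    rw [norm_iteratedFDeriv_one] at h1
    refine h1.trans (mul_le_mul_of_nonneg_left ?_ hC.le)
    have h2 := wt_add_le (M := 2 * K) (by positivity) z (-y - z)
    rw [show z + (-y - z) = -y by abel, wt_neg] at h2
    refine h2.trans (mul_le_mul_of_nonneg_right ?_ (wt_pos _ _).le)
    refine Real.rpow_le_rpow (by positivity) ?_ (by positivity)
    rw [mem_closedBall, dist_eq_norm] at hz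
    have h3 : ‖-y - z‖ ≤ ‖z - (x - y)‖ + ‖x‖ := by
      rw [show -y - z = -(z - (x - y)) - x by abel]
      refine (norm_sub_le _ _).trans ?_
      rw [norm_neg]
    linarith
  rw [sub_sub_sub_cancel_right] at hb
  calc _ ≤ ‖pw n K y‖ * (C * ((2 + ‖x‖) ^ (2 * (K : ℝ)) * wt (2 * K) y) * ‖x' - x‖) :=
        mul_le_mul_of_nonneg_left hb (norm_nonneg _)
    _ = C * (2 + ‖x‖) ^ (2 * (K : ℝ)) * ‖x' - x‖ * (‖pw n K y‖ * wt (2 * K) y) := by ring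
    _ ≤ C * (2 + ‖x‖) ^ (2 * (K : ℝ)) * ‖x' - x‖ * 1 :=
        mul_le_mul_of_nonneg_left (pw_le K y) (by positivity)
    _ = _ := mul_one _

lemma Jm_shift_cont (K L : ℕ) (ψ : Sch n) : Continuous fun x => Jm n K L (shiftReflect ψ x) := by
  refine continuous_pi fun α => ?_
  obtain ⟨C, hC, h⟩ := shift_comp_lip K
    ((-1 : ℂ) ^ (flatIdx fun i => (α i : ℕ)).length • dlS (flatIdx fun i => (α i : ℕ)) ψ)
  rw [continuous_iff_continuousAt]
  intro x
  rw [ContinuousAt, tendsto_iff_dist_tendsto_zero]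
  have h0 : Tendsto (fun x' : Rn n => C * (2 + ‖x‖) ^ (2 * (K : ℝ)) * ‖x' - x‖) (𝓝 x) (𝓝 0) := by
    have : Continuous fun x' : Rn n => C * (2 + ‖x‖) ^ (2 * (K : ℝ)) * ‖x' - x‖ := by fun_prop
    simpa using this.tendsto x
  refine squeeze_zero' (Eventually.of_forall fun _ => dist_nonneg) ?_ h0
  filter_upwards [closedBall_mem_nhds x one_pos] with x' hx'
  rw [mem_closedBall, dist_eq_norm] at hx'
  refine (BoundedContinuousFunction.dist_le (by positivity)).2 fun y => ?_
  rw [dist_eq_norm, Jm_apply, Jm_apply, dl_shift, dl_shift]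
  exact h x x' y hx'

lemma Jm_shift_growth (K L : ℕ) (ψ : Sch n) : ∃ C : ℝ, 0 < C ∧ ∀ x,
    ‖Jm n K L (shiftReflect ψ x)‖ ≤ C * (1 + ‖x‖) ^ (2 * (K : ℝ)) := by
  have h := fun α : Fin n → Fin (L + 1) => shift_comp_growth K
    ((-1 : ℂ) ^ (flatIdx fun i => (α i : ℕ)).length • dlS (flatIdx fun i => (α i : ℕ)) ψ)
  choose C hC h using h
  refine ⟨∑ α, C α + 1, by have := Finset.sum_nonneg fun α (_ : α ∈ Finset.univ) => (hC α).le; linarith, fun x => ?_⟩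
  refine (pi_norm_le_iff_of_nonneg ?_).2 fun α => ?_
  · have := Finset.sum_nonneg fun α (_ : α ∈ Finset.univ) => (hC α).le
    positivity
  · have h1 : C α ≤ ∑ α, C α + 1 := by
      have := Finset.single_le_sum (fun α _ => (hC α).le) (Finset.mem_univ α)
      linarith
    have h2 : (0 : ℝ) ≤ (1 + ‖x‖) ^ (2 * (K : ℝ)) := by positivity
    have h3 : (0 : ℝ) ≤ ∑ α, C α + 1 := (hC α).le.trans h1
    refine (BoundedContinuousFunction.norm_le (by positivity)).2 fun y => ?_
    rw [Jm_apply, dl_shift]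
    exact (h α x y).trans (mul_le_mul_of_nonneg_right h1 h2)

lemma td_growth (f : TDist n E) : ∃ N : ℝ, 0 ≤ N ∧ ∀ ψ : Sch n, ∃ C : ℝ, 0 < C ∧ ∀ x,
    ‖f.toFun (shiftReflect ψ x)‖ ≤ C * (1 + ‖x‖) ^ N := by
  obtain ⟨C, K, L, hC, h⟩ := td_bound f
  refine ⟨2 * K, by positivity, fun ψ => ?_⟩
  obtain ⟨C', hC', h'⟩ := Jm_shift_growth K L ψ
  refine ⟨(C + 1) * C', by positivity, fun x => (h _).trans ?_⟩
  rw [mul_assoc]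
  refine mul_le_mul (by linarith) (h' x) (norm_nonneg _) (by positivity)

lemma td_cont (f : TDist n E) (ψ : Sch n) : Continuous fun x => f.toFun (shiftReflect ψ x) := by
  obtain ⟨C, K, L, hC, h⟩ := td_bound f
  rw [continuous_iff_continuousAt]
  intro x
  rw [ContinuousAt, tendsto_iff_norm_sub_tendsto_zero]
  have h0 := (((Jm_shift_cont K L ψ).sub (continuous_const (y := Jm n K L (shiftReflect ψ x)))).norm.const_smul C).tendsto x
  simp only [Pi.smul_apply, Pi.sub_apply, sub_self, norm_zero, smul_eq_mul, mul_zero] at h0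
  refine squeeze_zero (fun _ => norm_nonneg _) (fun x' => ?_) h0
  rw [← map_sub]
  change _ ≤ C * ‖Jm n K L (shiftReflect ψ x') - Jm n K L (shiftReflect ψ x)‖
  rw [← map_sub]
  exact h _

lemma td_ex [CompleteSpace E] (f : TDist n E) (χ φ : Sch n) :
    ∫ x, φ x • f.toFun (shiftReflect (invFourierS χ) x) =
      f.toFun (fourierS (smulLeftCLM ℂ χ (invFourierS φ))) := by
  obtain ⟨C, K, L, hC, h⟩ := td_bound f
  set R := (LinearMap.range (Jm n K L).toLinearMap).topologicalClosure with hR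
  have : CompleteSpace R := (Submodule.isClosed_topologicalClosure _).completeSpace_coe
  let J' : Sch n →ₗ[ℂ] R := (Jm n K L).toLinearMap.codRestrict R fun φ =>
    Submodule.le_topologicalClosure _ (LinearMap.mem_range_self _ φ)
  have hJ' : ∀ φ, ((J' φ : R) : (Fin n → Fin (L + 1)) → BoundedContinuousFunction (Rn n) ℂ) = Jm n K L φ :=
    fun φ => rfl
  have hd : DenseRange J' := by
    intro r
    rw [mem_closure_iff_seq_limit]
    have hr : (r : (Fin n → Fin (L + 1)) → BoundedContinuousFunction (Rn n) ℂ) ∈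
        closure ((LinearMap.range (Jm n K L).toLinearMap : Submodule ℂ _) : Set _) := r.2
    rw [mem_closure_iff_seq_limit] at hr
    obtain ⟨u, hu, hu'⟩ := hr
    choose g hg using hu
    refine ⟨fun k => J' (g k), fun k => ⟨g k, rfl⟩, ?_⟩
    rw [tendsto_subtype_rng]
    simp only [hJ']
    convert! hu' using 2 with k
    exact hg k
  have hn : ∃ C, ∀ φ, ‖f.toFun φ‖ ≤ C * ‖J' φ‖ := ⟨C, h⟩
  let F : R →L[ℂ] E := f.toFun.extendOfNorm J'
  have hF : ∀ φ, F (J' φ) = f.toFun φ := fun φ => LinearMap.extendOfNorm_eq hd hn φ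
  have hcont : Continuous fun x => J' (shiftReflect (invFourierS χ) x) :=
    Continuous.subtype_mk (Jm_shift_cont K L _) _
  obtain ⟨C', hC', hg⟩ := Jm_shift_growth K L (invFourierS χ)
  obtain ⟨C2, hC2, h2⟩ := sch_decay φ (n + 1 + 2 * K)
  have : SecondCountableTopologyEither (Rn n) R := secondCountableTopologyEither_of_left _ _
  have hint : Integrable fun x => φ x • J' (shiftReflect (invFourierS χ) x) := by
    refine Integrable.mono' ((wt_integrable (n := n) (M := n + 1) (by linarith)).const_mul (C2 * C'))
      (φ.continuous.smul hcont).aestronglyMeasurable (Eventually.of_forall fun x => ?_)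
    rw [norm_smul]
    have e : wt (n + 1 + 2 * K) x * (1 + ‖x‖) ^ (2 * (K : ℝ)) = wt (n + 1) x := by
      unfold wt
      rw [← Real.rpow_add (by positivity)]; congr 1; ring
    calc _ ≤ (C2 * wt (n + 1 + 2 * K) x) * (C' * (1 + ‖x‖) ^ (2 * (K : ℝ))) :=
          mul_le_mul (h2 x) (hg x) (norm_nonneg _) (by have := wt_pos (n + 1 + 2 * K) x; positivity)
      _ = C2 * C' * (wt (n + 1 + 2 * K) x * (1 + ‖x‖) ^ (2 * (K : ℝ))) := by ring
      _ = _ := by rw [e]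
  have h3 : ∫ x, φ x • f.toFun (shiftReflect (invFourierS χ) x) =
      F (∫ x, φ x • J' (shiftReflect (invFourierS χ) x)) := by
    rw [← F.integral_comp_comm hint]
    simp only [map_smul, hF]
  rw [h3, ← hF]
  congr 1
  apply Subtype.ext
  funext α
  ext y
  have ev : ∀ r : R, (r : (Fin n → Fin (L + 1)) → BoundedContinuousFunction (Rn n) ℂ) α y =
      ((BoundedContinuousFunction.evalCLM ℂ y).comp ((ContinuousLinearMap.proj α).comp R.subtypeL)) r :=
    fun r => rfl
  rw [ev, ← ContinuousLinearMap.integral_comp_comm _ hint]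
  have e1 : ∀ x, ((BoundedContinuousFunction.evalCLM ℂ y).comp
      ((ContinuousLinearMap.proj α).comp R.subtypeL)) (φ x • J' (shiftReflect (invFourierS χ) x)) =
      φ x * (pw n K y * dlS (flatIdx fun i => (α i : ℕ)) (shiftReflect (invFourierS χ) x) y) := by
    intro x
    rw [map_smul, ← ev, hJ', Jm_apply, smul_eq_mul]
  simp_rw [e1]
  rw [hJ', Jm_apply, ← ex_pt, ← integral_const_mul]
  refine integral_congr_ae (Eventually.of_forall fun x => ?_)
  ring


lemma res_zero {φ : ℕ → Sch n} (hφ : SmoothResolution n φ) {N : ℕ} {z : Rn n}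
    (hz : ‖z‖ < 2 ^ ((N : ℝ) - 1)) {j : ℕ} (hj : 0 < j) (hjN : N ≤ j) : φ j z = 0 := by
  by_contra hne
  have h := (hφ.suppj j hj hne).1
  have : (2 : ℝ) ^ ((N : ℝ) - 1) ≤ 2 ^ ((j : ℝ) - 1) :=
    Real.rpow_le_rpow_of_exponent_le (by norm_num) (by have : (N : ℝ) ≤ j := by exact_mod_cast hjN
                                                       linarith)
  linarith

lemma res_semi {φ : ℕ → Sch n} (hφ : SmoothResolution n φ) (g : Sch n) (k l : ℕ) :
    Summable fun j => SchwartzMap.seminorm ℝ k l (smulLeftCLM ℂ (φ j) g) := by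
  have hc : ∀ i, ∃ C : ℝ, 0 < C ∧ ∀ j x, ‖iteratedFDeriv ℝ i (φ j) x‖ ≤ C := by
    intro i
    obtain ⟨C, hC, h⟩ := res_deriv hφ i
    refine ⟨C, hC, fun j x => (h j x).trans ?_⟩
    refine mul_le_of_le_one_right hC.le (inv_le_one_of_one_le₀ (one_le_pow₀ (by norm_num)))
  choose C hC hC' using hc
  set D := ∑ i ∈ Finset.range (l + 1), (l.choose i : ℝ) * C i *
    (SchwartzMap.seminorm ℝ (k + 1) (l - i) g) with hD
  have hD0 : 0 ≤ D := Finset.sum_nonneg fun i _ => by have := (hC i).le; positivity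
  rw [← summable_nat_add_iff 1]
  refine Summable.of_nonneg_of_le (fun _ => apply_nonneg _ _) (fun j => ?_)
    ((summable_geometric_of_lt_one (by norm_num : (0 : ℝ) ≤ 1 / 2) (by norm_num)).mul_left D)
  refine SchwartzMap.seminorm_le_bound ℝ k l _ (by positivity) fun x => ?_
  have hco : (⇑(smulLeftCLM ℂ (φ (j + 1)) g) : Rn n → ℂ) = fun y => φ (j + 1) y * g y := by
    ext y; rw [smulLeftCLM_apply_apply (φ (j + 1)).hasTemperateGrowth, smul_eq_mul]
  have h2j : (2 : ℝ) ^ (((j + 1 : ℕ) : ℝ) - 1) = 2 ^ j := by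
    rw [← Real.rpow_natCast]; push_cast; congr 1; ring
  by_cases hx : ‖x‖ < 2 ^ j
  · have h0 : (⇑(smulLeftCLM ℂ (φ (j + 1)) g) : Rn n → ℂ) =ᶠ[𝓝 x] fun _ => 0 := by
      have : ∀ᶠ z in 𝓝 x, ‖z‖ < 2 ^ j := continuous_norm.continuousAt.eventually_lt continuousAt_const hx
      filter_upwards [this] with z hz
      rw [hco]
      simp only
      rw [res_zero hφ (N := j + 1) (by rw [h2j]; exact hz) (Nat.succ_pos j) le_rfl, zero_mul]
    have h1 : iteratedFDeriv ℝ l (⇑(smulLeftCLM ℂ (φ (j + 1)) g)) x = 0 := by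
      rw [(h0.iteratedFDeriv ℝ l).eq_of_nhds]; simp
    rw [h1, norm_zero, mul_zero]; positivity
  · push Not at hx
    rw [hco]
    have h1 := norm_iteratedFDeriv_mul_le (𝕜 := ℝ) (N := l) ((φ (j + 1)).smooth l) (g.smooth l) x
      (n := l) le_rfl
    refine (mul_le_mul_of_nonneg_left h1 (by positivity)).trans ?_
    rw [Finset.mul_sum, hD, Finset.sum_mul]
    refine Finset.sum_le_sum fun i _ => ?_
    have h3 := SchwartzMap.le_seminorm ℝ (k + 1) (l - i) g x
    have h4 : ‖x‖ ^ k * ‖iteratedFDeriv ℝ (l - i) g x‖ ≤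
        SchwartzMap.seminorm ℝ (k + 1) (l - i) g * (1 / 2) ^ j := by
      rw [one_div, inv_pow, ← div_eq_mul_inv, le_div_iff₀ (by positivity)]
      refine le_trans ?_ h3
      rw [pow_succ]
      calc _ = ‖x‖ ^ k * ‖iteratedFDeriv ℝ (l - i) g x‖ * 2 ^ j := rfl
        _ ≤ ‖x‖ ^ k * ‖iteratedFDeriv ℝ (l - i) g x‖ * ‖x‖ := mul_le_mul_of_nonneg_left hx (by positivity)
        _ = _ := by ring
    calc _ = (l.choose i : ℝ) * ‖iteratedFDeriv ℝ i (φ (j + 1)) x‖ *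
          (‖x‖ ^ k * ‖iteratedFDeriv ℝ (l - i) g x‖) := by ring
      _ ≤ (l.choose i : ℝ) * C i * (SchwartzMap.seminorm ℝ (k + 1) (l - i) g * (1 / 2) ^ j) := by
          refine mul_le_mul (mul_le_mul_of_nonneg_left (hC' i _ x) (by positivity)) h4 (by positivity) ?_
          have := (hC i).le; positivity
      _ = _ := by ring

lemma res_hasSum {φ : ℕ → Sch n} (hφ : SmoothResolution n φ) (g : Sch n) :
    HasSum (fun j => smulLeftCLM ℂ (φ j) g) g := by
  rw [HasSum, SummationFilter.unconditional_filter, (schwartz_withSeminorms ℝ (Rn n) ℂ).tendsto_nhds]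
  rintro ⟨k, l⟩ ε hε
  obtain ⟨s₀, hs₀⟩ := summable_iff_vanishing_norm.1 (res_semi hφ g k l) (ε / 2) (by linarith)
  filter_upwards [eventually_ge_atTop s₀] with s hs
  refine lt_of_le_of_lt ?_ (half_lt_self hε)
  refine SchwartzMap.seminorm_le_bound ℝ k l _ (by linarith) fun x => ?_
  obtain ⟨N, hN⟩ : ∃ N : ℕ, 0 < N ∧ ‖x‖ < 2 ^ ((N : ℝ) - 1) := by
    obtain ⟨M, hM⟩ := pow_unbounded_of_one_lt ‖x‖ (by norm_num : (1 : ℝ) < 2)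
    refine ⟨M + 1, Nat.succ_pos _, ?_⟩
    push_cast
    rwa [add_sub_cancel_right, Real.rpow_natCast]
  set t := Finset.range N \ s with ht
  have hdis : Disjoint t s₀ := Finset.disjoint_of_subset_right hs Finset.sdiff_disjoint
  have hne : (⇑(∑ j ∈ s, smulLeftCLM ℂ (φ j) g - g) : Rn n → ℂ) =ᶠ[𝓝 x]
      ⇑(-(∑ j ∈ t, smulLeftCLM ℂ (φ j) g)) := by
    have : ∀ᶠ z in 𝓝 x, ‖z‖ < 2 ^ ((N : ℝ) - 1) :=
      continuous_norm.continuousAt.eventually_lt continuousAt_const hN.2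
    filter_upwards [this] with z hz
    have e1 : ∀ u : Finset ℕ, (∑ j ∈ u, smulLeftCLM ℂ (φ j) g) z = (∑ j ∈ u, φ j z) * g z := by
      intro u
      rw [sum_apply, Finset.sum_mul]
      refine Finset.sum_congr rfl fun j _ => ?_
      rw [smulLeftCLM_apply_apply (φ j).hasTemperateGrowth, smul_eq_mul]
    have hz0 : ∀ j, j ∉ Finset.range N → φ j z = 0 := fun j hj => by
      have hj' : N ≤ j := by simpa using hj
      exact res_zero hφ hz (hN.1.trans_le hj') hj'
    have e2 : ∑ j ∈ Finset.range N, φ j z = 1 := by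
      rw [← hφ.sum_eq z, tsum_eq_sum hz0]
    have e3 : ∑ j ∈ Finset.range N ∩ s, φ j z = ∑ j ∈ s, φ j z := by
      refine Finset.sum_subset Finset.inter_subset_right fun j hj hj' => hz0 j fun hj2 => hj' ?_
      exact Finset.mem_inter.2 ⟨hj2, hj⟩
    have e4 := Finset.sum_inter_add_sum_sdiff (Finset.range N) s (fun j => φ j z)
    rw [sub_apply, neg_apply, e1, e1]
    rw [e3, e2] at e4
    rw [ht]
    linear_combination (g z) * e4
  rw [(hne.iteratedFDeriv ℝ l).eq_of_nhds]
  refine (SchwartzMap.le_seminorm ℝ k l _ x).trans ?_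
  rw [map_neg_eq_map]
  refine (Finset.le_sum_of_subadditive (SchwartzMap.seminorm ℝ k l) (map_zero (SchwartzMap.seminorm ℝ k l)).le (map_add_le_add _) _ _).trans ?_
  exact (le_abs_self _).trans (hs₀ t hdis).le

lemma td_res {φ : ℕ → Sch n} (hφ : SmoothResolution n φ) (f : TDist n E) (h : Sch n) :
    HasSum (fun j => f.toFun (fourierS (smulLeftCLM ℂ (φ j) (invFourierS h)))) (f.toFun h) := by
  have h1 := (res_hasSum hφ (invFourierS h)).map
    (f.toFun.toAddMonoidHom.comp (FourierTransform.fourierCLE ℂ (Sch n)).toLinearEquiv.toLinearMap.toAddMonoidHom)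
    ((td_continuous f).comp (FourierTransform.fourierCLE ℂ (Sch n)).continuous)
  have e : f.toFun (fourierS (invFourierS h)) = f.toFun h := by
    congr 1
    exact (FourierTransform.fourierCLE ℂ (Sch n)).apply_symm_apply h
  rw [← e]
  exact h1


lemma wt_shift_le {M : ℝ} (hM : 0 ≤ M) (x y z : Rn n) :
    wt M (x - y) ≤ (1 + ‖z - x‖) ^ M * wt M (z - y) := by
  have := wt_add_le hM (x - y) (z - x)
  rwa [show x - y + (z - x) = z - y by abel] at this

lemma wt_mul_pow (N : ℝ) (y : Rn n) : wt N y * (1 + ‖y‖) ^ N = 1 := by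
  unfold wt
  rw [← Real.rpow_add (by positivity), neg_add_cancel, Real.rpow_zero]

lemma grow_bd {N : ℝ} (hN : 0 ≤ N) (x y : Rn n) :
    wt (N + (n + 1)) (x - y) * (1 + ‖y‖) ^ N ≤ (1 + ‖x‖) ^ N * wt (n + 1) (x - y) := by
  rw [wt_mul]
  have h := wt_add_le hN (y - x) x
  rw [sub_add_cancel, wt_sub_comm] at h
  have h2 : wt N (x - y) * (1 + ‖y‖) ^ N ≤ (1 + ‖x‖) ^ N := by
    calc _ ≤ (1 + ‖x‖) ^ N * wt N y * (1 + ‖y‖) ^ N := by gcongr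
      _ = _ := by rw [mul_assoc, wt_mul_pow, mul_one]
  calc _ = wt N (x - y) * (1 + ‖y‖) ^ N * wt (n + 1) (x - y) := by ring
    _ ≤ _ := mul_le_mul_of_nonneg_right h2 (wt_pos _ _).le

lemma wt_sub_integrable {M : ℝ} (hM : (n : ℝ) < M) (x : Rn n) :
    Integrable fun y : Rn n => wt M (x - y) :=
  (wt_integrable hM).comp_sub_left x

lemma schF_decay {F : Type*} [NormedAddCommGroup F] [NormedSpace ℝ F] (Θ : SchwartzMap (Rn n) F)
    (M : ℝ) : ∃ C : ℝ, 0 < C ∧ ∀ x, ‖Θ x‖ ≤ C * wt M x := by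
  obtain ⟨k, hk⟩ := exists_nat_ge M
  refine ⟨2 ^ k * (Finset.Iic (k, 0)).sup (fun m => SchwartzMap.seminorm ℝ m.1 m.2) Θ + 1,
    by have := apply_nonneg ((Finset.Iic (k, 0)).sup (fun m => SchwartzMap.seminorm ℝ (E := Rn n) (F := F) m.1 m.2)) Θ
       positivity, fun x => ?_⟩
  have h := SchwartzMap.one_add_le_sup_seminorm_apply (𝕜 := ℝ) (m := (k, 0)) (k := k) (n := 0) le_rfl le_rfl Θ x
  rw [norm_iteratedFDeriv_zero] at h
  have h2 := wt_anti hk x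
  refine le_trans ?_ (mul_le_mul_of_nonneg_left h2
    (by have := apply_nonneg ((Finset.Iic (k, 0)).sup (fun m => SchwartzMap.seminorm ℝ (E := Rn n) (F := F) m.1 m.2)) Θ
        positivity))
  have h3 := wt_mul_pow (k : ℝ) x
  rw [Real.rpow_natCast] at h3
  have h4 := wt_pos (k : ℝ) x
  calc ‖Θ x‖ = wt k x * ((1 + ‖x‖) ^ k * ‖Θ x‖) := by rw [← mul_assoc, h3, one_mul]
    _ ≤ wt k x * (2 ^ k * (Finset.Iic (k, 0)).sup (fun m => SchwartzMap.seminorm ℝ m.1 m.2) Θ + 1) :=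
        mul_le_mul_of_nonneg_left (h.trans (by simp)) h4.le
    _ = _ := mul_comm _ _

/-- polynomial growth -/
def PolyG (g : Rn n → E) : Prop :=
  Continuous g ∧ ∃ N C : ℝ, 0 ≤ N ∧ 0 < C ∧ ∀ y, ‖g y‖ ≤ C * (1 + ‖y‖) ^ N

/-- generalised convolution -/
def cv {F G : Type*} [NormedAddCommGroup F] [NormedSpace ℝ F] [NormedAddCommGroup G] [NormedSpace ℝ G]
    (B : F →L[ℝ] E →L[ℝ] G) (Θ : SchwartzMap (Rn n) F) (g : Rn n → E) (x : Rn n) : G :=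
  ∫ y, B (Θ (x - y)) (g y)

/-- maximal-type mean -/
def TT (A : ℝ) (g : Rn n → E) (x : Rn n) : ℝ≥0∞ :=
  ∫⁻ y, ENNReal.ofReal (wt A (x - y)) * ‖g y‖ₑ

section
variable {F G : Type*} [NormedAddCommGroup F] [NormedSpace ℝ F] [NormedAddCommGroup G] [NormedSpace ℝ G]

lemma cv_ptbound (B : F →L[ℝ] E →L[ℝ] G) (Θ : SchwartzMap (Rn n) F) {g : Rn n → E} (hg : PolyG g) :
    ∃ D : Rn n → ℝ, (∀ x, 0 ≤ D x) ∧ ∀ x₀ x y, ‖x₀ - x‖ ≤ 1 →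
      ‖B (Θ (x - y)) (g y)‖ ≤ D x₀ * wt (n + 1) (x₀ - y) := by
  obtain ⟨_, N, C, hN, hC, hb⟩ := hg
  obtain ⟨C', hC', hb'⟩ := schF_decay Θ (N + (n + 1))
  have hM : (0 : ℝ) ≤ N + (n + 1) := by positivity
  refine ⟨fun x => ‖B‖ * C' * 2 ^ (N + (n + 1)) * C * (1 + ‖x‖) ^ N, fun x => by positivity,
    fun x₀ x y h => ?_⟩
  have h1 := wt_shift_le hM x y x₀
  have h2 : (1 + ‖x₀ - x‖) ^ (N + (n + 1)) ≤ (2 : ℝ) ^ (N + (n + 1)) :=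
    Real.rpow_le_rpow (by positivity) (by linarith) hM
  have h3 := grow_bd hN x₀ y
  have w0 := (wt_pos (N + (n + 1)) (x₀ - y)).le
  calc _ ≤ ‖B‖ * ‖Θ (x - y)‖ * ‖g y‖ := B.le_opNorm₂ _ _
    _ ≤ ‖B‖ * (C' * (2 ^ (N + (n + 1)) * wt (N + (n + 1)) (x₀ - y))) * (C * (1 + ‖y‖) ^ N) := by
        gcongr
        · exact (hb' _).trans (mul_le_mul_of_nonneg_left (h1.trans (mul_le_mul_of_nonneg_right h2 w0)) hC'.le)
        · exact hb y
    _ = ‖B‖ * C' * 2 ^ (N + (n + 1)) * C * (wt (N + (n + 1)) (x₀ - y) * (1 + ‖y‖) ^ N) := by ring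
    _ ≤ ‖B‖ * C' * 2 ^ (N + (n + 1)) * C * ((1 + ‖x₀‖) ^ N * wt (n + 1) (x₀ - y)) := by gcongr
    _ = _ := by ring

lemma cv_integrand_cont (B : F →L[ℝ] E →L[ℝ] G) (Θ : SchwartzMap (Rn n) F) {g : Rn n → E} (hg : PolyG g)
    (x : Rn n) : Continuous fun y => B (Θ (x - y)) (g y) := by
  have h1 : Continuous fun y => Θ (x - y) := Θ.continuous.comp (by fun_prop)
  exact (B.continuous.comp h1).clm_apply hg.1

lemma cv_integrable (B : F →L[ℝ] E →L[ℝ] G) (Θ : SchwartzMap (Rn n) F) {g : Rn n → E} (hg : PolyG g)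
    (x : Rn n) : Integrable fun y => B (Θ (x - y)) (g y) := by
  obtain ⟨D, _, hD⟩ := cv_ptbound B Θ hg
  refine Integrable.mono' ((wt_sub_integrable (by linarith : (n : ℝ) < n + 1) x).const_mul (D x))
    (cv_integrand_cont B Θ hg x).aestronglyMeasurable (Eventually.of_forall fun y => ?_)
  exact hD x x y (by simp)

lemma cv_hasFDerivAt (B : F →L[ℝ] E →L[ℝ] G) (Θ : SchwartzMap (Rn n) F) {g : Rn n → E} (hg : PolyG g)
    (x : Rn n) : HasFDerivAt (cv B Θ g)
      (cv (B.precompL (Rn n)) (SchwartzMap.fderivCLM ℝ (Rn n) F Θ) g x) x := by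
  obtain ⟨D, _, hD⟩ := cv_ptbound (B.precompL (Rn n)) (SchwartzMap.fderivCLM ℝ (Rn n) F Θ) hg
  refine hasFDerivAt_integral_of_dominated_of_fderiv_le (𝕜 := ℝ) (s := ball x 1)
    (F := fun x y => B (Θ (x - y)) (g y))
    (F' := fun x y => B.precompL (Rn n) (SchwartzMap.fderivCLM ℝ (Rn n) F Θ (x - y)) (g y))
    (bound := fun y => D x * wt (n + 1) (x - y)) (ball_mem_nhds x one_pos) ?_ ?_ ?_ ?_ ?_ ?_
  · exact Eventually.of_forall fun z => (cv_integrand_cont B Θ hg z).aestronglyMeasurable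
  · exact cv_integrable B Θ hg x
  · exact (cv_integrable (B.precompL (Rn n)) (SchwartzMap.fderivCLM ℝ (Rn n) F Θ) hg x).aestronglyMeasurable
  · refine Eventually.of_forall fun y z hz => hD x z y ?_
    rw [← dist_eq_norm, dist_comm]
    exact (mem_ball.1 hz).le
  · exact (wt_sub_integrable (by linarith : (n : ℝ) < n + 1) x).const_mul (D x)
  · refine Eventually.of_forall fun y z _ => ?_
    have h1 : HasFDerivAt (fun z => Θ (z - y)) (fderiv ℝ Θ (z - y)) z := by
      have := (Θ.differentiableAt (x := z - y)).hasFDerivAt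
      exact this.comp z ((hasFDerivAt_id z).sub_const y)
    have h2 := ((B.flip (g y)).hasFDerivAt (x := Θ (z - y))).comp z h1
    exact h2

lemma cv_bound (A : ℝ) (B : F →L[ℝ] E →L[ℝ] G) (Θ : SchwartzMap (Rn n) F) :
    ∃ C : ℝ≥0∞, C ≠ ∞ ∧ ∀ g : Rn n → E, ∀ x, ‖cv B Θ g x‖ₑ ≤ C * TT A g x := by
  obtain ⟨C, hC, h⟩ := schF_decay Θ A
  refine ⟨ENNReal.ofReal (‖B‖ * C), ENNReal.ofReal_ne_top, fun g x => ?_⟩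
  refine (enorm_integral_le_lintegral_enorm _).trans ?_
  unfold TT
  rw [← lintegral_const_mul' _ _ ENNReal.ofReal_ne_top]
  refine lintegral_mono fun y => ?_
  rw [← mul_assoc, ← ENNReal.ofReal_mul (by positivity), ← ofReal_norm (g y), ← ofReal_norm (B _ _),
    ← ENNReal.ofReal_mul (by have := wt_pos A (x - y); positivity)]
  refine ENNReal.ofReal_le_ofReal ((B.le_opNorm₂ _ _).trans ?_)
  rw [mul_assoc ‖B‖ C]
  gcongr
  exact h _
end

lemma cv_iter (A : ℝ) (l : ℕ) : ∀ {F : Type} {G : Type _} [NormedAddCommGroup F] [NormedSpace ℝ F]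
    [NormedAddCommGroup G] [NormedSpace ℝ G]
    (B : F →L[ℝ] E →L[ℝ] G) (Θ : SchwartzMap (Rn n) F),
    ∃ C : ℝ≥0∞, C ≠ ∞ ∧ ∀ g : Rn n → E, PolyG g → ContDiff ℝ l (cv B Θ g) ∧
      ∀ x, ‖iteratedFDeriv ℝ l (cv B Θ g) x‖ₑ ≤ C * TT A g x := by
  induction l with
  | zero =>
    intro F G _ _ _ _ B Θ
    obtain ⟨C, hC, h⟩ := cv_bound (E := E) A B Θ
    refine ⟨C, hC, fun g hg => ⟨?_, fun x => ?_⟩⟩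
    · refine contDiff_zero.2 ?_
      exact continuous_iff_continuousAt.2 fun x => (cv_hasFDerivAt B Θ hg x).continuousAt
    · rw [← ofReal_norm, norm_iteratedFDeriv_zero, ofReal_norm]
      exact h g x
  | succ l ih =>
    intro F G _ _ _ _ B Θ
    obtain ⟨C, hC, h⟩ := ih (B.precompL (Rn n)) (SchwartzMap.fderivCLM ℝ (Rn n) F Θ)
    refine ⟨C, hC, fun g hg => ?_⟩
    have hd : fderiv ℝ (cv B Θ g) = cv (B.precompL (Rn n)) (SchwartzMap.fderivCLM ℝ (Rn n) F Θ) g :=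
      funext fun x => (cv_hasFDerivAt B Θ hg x).fderiv
    refine ⟨?_, fun x => ?_⟩
    · push_cast
      rw [contDiff_succ_iff_fderiv]
      refine ⟨fun x => (cv_hasFDerivAt B Θ hg x).differentiableAt, by simp, ?_⟩
      rw [hd]; exact (h g hg).1
    · rw [← ofReal_norm, ← norm_iteratedFDeriv_fderiv, ofReal_norm, hd]
      exact (h g hg).2 x


set_option linter.unusedSectionVars false

/-- weighted `p`-mean -/
def II (B p : ℝ) (g : Rn n → E) (x : Rn n) : ℝ≥0∞ :=
  ∫⁻ y, ENNReal.ofReal (wt B (x - y)) * ‖g y‖ₑ ^ p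

lemma TT_eq (A : ℝ) (g : Rn n → E) (x : Rn n) : TT A g x = II A 1 g x := by
  unfold TT II; simp

lemma II_shift {B : ℝ} (hB : 0 ≤ B) (p : ℝ) (g : Rn n → E) (x y : Rn n) :
    II B p g y ≤ ENNReal.ofReal ((1 + ‖x - y‖) ^ B) * II B p g x := by
  unfold II
  rw [← lintegral_const_mul' _ _ ENNReal.ofReal_ne_top]
  refine lintegral_mono fun z => ?_
  rw [← mul_assoc, ← ENNReal.ofReal_mul (by positivity)]
  gcongr
  exact wt_shift_le hB y z x

lemma TT_shift {A : ℝ} (hA : 0 ≤ A) (g : Rn n → E) (x y : Rn n) :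
    TT A g y ≤ ENNReal.ofReal ((1 + ‖x - y‖) ^ A) * TT A g x := by
  rw [TT_eq, TT_eq]; exact II_shift hA 1 g x y

lemma II_anti {B B' : ℝ} (h : B ≤ B') (p : ℝ) (g : Rn n → E) (x : Rn n) :
    II B' p g x ≤ II B p g x := by
  unfold II
  refine lintegral_mono fun z => ?_
  gcongr
  exact wt_anti h _

lemma PP_core {A p : ℝ} (hp : 0 < p) (hp1 : p ≤ 1) {g : Rn n → E} {x : Rn n} {D : ℝ≥0∞}
    (hD : D ≠ ∞) (h : ∀ y, ‖g y‖ₑ ≤ ENNReal.ofReal ((1 + ‖x - y‖) ^ A) * D) :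
    TT A g x ≤ D ^ (1 - p) * II (A * p) p g x := by
  have h1p : 0 ≤ 1 - p := by linarith
  unfold TT II
  rw [← lintegral_const_mul' _ _ (ENNReal.rpow_ne_top_of_nonneg h1p hD)]
  refine lintegral_mono fun y => ?_
  have e1 : ‖g y‖ₑ = ‖g y‖ₑ ^ (1 - p) * ‖g y‖ₑ ^ p := by
    rw [← ENNReal.rpow_add_of_nonneg _ _ h1p hp.le, sub_add_cancel, ENNReal.rpow_one]
  have e2 : ENNReal.ofReal (wt A (x - y)) * ENNReal.ofReal ((1 + ‖x - y‖) ^ A) ^ (1 - p) =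
      ENNReal.ofReal (wt (A * p) (x - y)) := by
    rw [ENNReal.ofReal_rpow_of_pos (by positivity), ← ENNReal.ofReal_mul (wt_pos _ _).le]
    congr 1
    unfold wt
    rw [← Real.rpow_mul (by positivity), ← Real.rpow_add (by positivity)]
    congr 1; ring
  calc _ = ENNReal.ofReal (wt A (x - y)) * (‖g y‖ₑ ^ (1 - p) * ‖g y‖ₑ ^ p) := by rw [← e1]
    _ ≤ ENNReal.ofReal (wt A (x - y)) *
        ((ENNReal.ofReal ((1 + ‖x - y‖) ^ A) * D) ^ (1 - p) * ‖g y‖ₑ ^ p) := by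
        gcongr; exact h y
    _ = (ENNReal.ofReal (wt A (x - y)) * ENNReal.ofReal ((1 + ‖x - y‖) ^ A) ^ (1 - p)) *
        D ^ (1 - p) * ‖g y‖ₑ ^ p := by
        rw [ENNReal.mul_rpow_of_nonneg _ _ h1p]; ring
    _ = _ := by rw [e2]; ring

lemma PP_step {A p : ℝ} (hA : 0 ≤ A) (hp : 0 < p) (hp1 : p ≤ 1) {g : Rn n → E} {C : ℝ≥0∞} (hC : C ≠ ∞)
    (h : ∀ y, ‖g y‖ₑ ≤ C * TT A g y) (x : Rn n) (hx : TT A g x ≠ ∞) :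
    TT A g x ^ p ≤ C ^ (1 - p) * II (A * p) p g x := by
  have h1p : 0 ≤ 1 - p := by linarith
  have := PP_core (A := A) hp hp1 (ENNReal.mul_ne_top hC hx) (x := x) (g := g) fun y => by
    refine (h y).trans ?_
    calc C * TT A g y ≤ C * (ENNReal.ofReal ((1 + ‖x - y‖) ^ A) * TT A g x) := by
          gcongr; exact TT_shift hA g x y
      _ = _ := by ring
  by_cases h0 : TT A g x = 0
  · rw [h0, ENNReal.zero_rpow_of_pos hp]; exact zero_le
  have hne : TT A g x ^ (1 - p) ≠ 0 := (ENNReal.rpow_pos (pos_iff_ne_zero.2 h0) hx).ne'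
  have hnt : TT A g x ^ (1 - p) ≠ ∞ := ENNReal.rpow_ne_top_of_nonneg h1p hx
  rw [← ENNReal.mul_le_mul_iff_right hne hnt]
  calc _ = TT A g x := by
        rw [← ENNReal.rpow_add_of_nonneg _ _ h1p hp.le, sub_add_cancel, ENNReal.rpow_one]
    _ ≤ _ := this
    _ = _ := by rw [ENNReal.mul_rpow_of_nonneg _ _ h1p]; ring

lemma TT_finite {g : Rn n → E} (hg : PolyG g) : ∃ N : ℝ, ∀ A, N ≤ A → ∀ x, TT A g x ≠ ∞ := by
  obtain ⟨_, N, C, hN, hC, hb⟩ := hg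
  refine ⟨N + (n + 1), fun A hA x => ?_⟩
  rw [TT_eq]
  refine ne_top_of_le_ne_top ?_ (II_anti hA 1 g x)
  unfold II
  have h1 : Integrable fun y : Rn n => C * (1 + ‖x‖) ^ N * wt (n + 1) (x - y) :=
    (wt_sub_integrable (by linarith : (n : ℝ) < n + 1) x).const_mul _
  refine ne_top_of_le_ne_top h1.lintegral_lt_top.ne (lintegral_mono fun y => ?_)
  rw [ENNReal.rpow_one, ← ofReal_norm, ← ENNReal.ofReal_mul (wt_pos _ _).le]
  refine ENNReal.ofReal_le_ofReal ?_
  have h3 := grow_bd hN x y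
  calc _ ≤ wt (N + (n + 1)) (x - y) * (C * (1 + ‖y‖) ^ N) :=
        mul_le_mul_of_nonneg_left (hb y) (wt_pos _ _).le
    _ = C * (wt (N + (n + 1)) (x - y) * (1 + ‖y‖) ^ N) := by ring
    _ ≤ C * ((1 + ‖x‖) ^ N * wt (n + 1) (x - y)) := by gcongr
    _ = _ := by ring

/-- scalar multiplication as a bilinear map -/
def Bs (E : Type*) [NormedAddCommGroup E] [NormedSpace ℂ E] : ℂ →L[ℝ] E →L[ℝ] E :=
  ContinuousLinearMap.lsmul ℝ ℂ

lemma PP_small {A p : ℝ} (hA : 0 ≤ A) (hp : 0 < p) (hp1 : p ≤ 1) (Θ : Sch n) :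
    ∃ C : ℝ≥0∞, C ≠ ∞ ∧ ∀ g : Rn n → E, PolyG g → (∀ x, g x = cv (Bs E) Θ g x) →
      ∀ x, TT A g x ^ p ≤ C * II (A * p) p g x := by
  have h1p : 0 ≤ 1 - p := by linarith
  obtain ⟨C, hC, hb⟩ := cv_bound (E := E) A (Bs E) Θ
  refine ⟨C ^ (1 - p), ENNReal.rpow_ne_top_of_nonneg h1p hC, fun g hg hr x => ?_⟩
  have hb1 : ∀ y, ‖g y‖ₑ ≤ C * TT A g y := fun y => by
    conv_lhs => rw [hr y]
    exact hb g y
  by_cases hx : TT A g x = ∞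
  swap
  · exact PP_step hA hp hp1 hC hb1 x hx
  by_cases hI : II (A * p) p g x = ∞
  · rw [hI]
    by_cases hC0 : C ^ (1 - p) = 0
    · exfalso
      have h0 : ∀ y, ‖g y‖ₑ = 0 := by
        intro y
        have hC1 : C = 0 := by
          rcases (ENNReal.rpow_eq_zero_iff).1 hC0 with h | h
          · exact h.1
          · exact absurd h.1 hC
        have := hb1 y
        rw [hC1, zero_mul] at this
        exact le_antisymm this zero_le
      unfold TT at hx
      simp [h0] at hx
    · rw [ENNReal.mul_top hC0]; exact le_top
  exfalso
  obtain ⟨N, hN⟩ := TT_finite hg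
  set A' := max A N with hA'
  have hAA : A ≤ A' := le_max_left _ _
  have hA'0 : 0 ≤ A' := hA.trans hAA
  obtain ⟨C', hC', hb'⟩ := cv_bound (E := E) A' (Bs E) Θ
  have hb2 : ∀ y, ‖g y‖ₑ ≤ C' * TT A' g y := fun y => by
    conv_lhs => rw [hr y]
    exact hb' g y
  set C'' := C' ^ (1 - p)
  have hC'' : C'' ≠ ∞ := ENNReal.rpow_ne_top_of_nonneg h1p hC'
  have key : ∀ y, ‖g y‖ₑ ≤ ENNReal.ofReal ((1 + ‖x - y‖) ^ A) * (C' * (C'' * II (A * p) p g x) ^ p⁻¹) := by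
    intro y
    have h1 := PP_step hA'0 hp hp1 hC' hb2 y (hN A' (le_max_right _ _) y)
    have h2 : TT A' g y ≤ (C'' * (ENNReal.ofReal ((1 + ‖x - y‖) ^ (A * p)) * II (A * p) p g x)) ^ p⁻¹ := by
      rw [ENNReal.le_rpow_inv_iff hp]
      refine h1.trans ?_
      gcongr
      refine (II_anti ?_ p g y).trans (II_shift (by positivity) p g x y)
      exact mul_le_mul_of_nonneg_right hAA hp.le
    refine (hb2 y).trans ?_
    calc _ ≤ C' * (C'' * (ENNReal.ofReal ((1 + ‖x - y‖) ^ (A * p)) * II (A * p) p g x)) ^ p⁻¹ := by gcongr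
      _ = C' * (ENNReal.ofReal ((1 + ‖x - y‖) ^ (A * p)) * (C'' * II (A * p) p g x)) ^ p⁻¹ := by
          congr 2; ring
      _ = C' * (ENNReal.ofReal ((1 + ‖x - y‖) ^ A) * (C'' * II (A * p) p g x) ^ p⁻¹) := by
          rw [ENNReal.mul_rpow_of_nonneg _ _ (inv_pos.2 hp).le, ENNReal.ofReal_rpow_of_pos (by positivity),
            ← Real.rpow_mul (by positivity), mul_assoc, mul_inv_cancel₀ hp.ne', mul_one]
      _ = _ := by ring
  have hDt : C' * (C'' * II (A * p) p g x) ^ p⁻¹ ≠ ∞ :=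
    ENNReal.mul_ne_top hC' (ENNReal.rpow_ne_top_of_nonneg (inv_pos.2 hp).le (ENNReal.mul_ne_top hC'' hI))
  have := PP_core hp hp1 hDt key
  rw [hx, top_le_iff] at this
  exact ENNReal.mul_ne_top (ENNReal.rpow_ne_top_of_nonneg h1p hDt) hI this

lemma PP_big {A p : ℝ} (hA : (n : ℝ) < A) (hp1 : 1 ≤ p) :
    ∃ C : ℝ≥0∞, C ≠ ∞ ∧ ∀ g : Rn n → E, Continuous g →
      ∀ x, TT A g x ^ p ≤ C * II A p g x := by
  have hp : 0 < p := by linarith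
  have hW : ∀ x : Rn n, ∫⁻ y, ENNReal.ofReal (wt A (x - y)) = ∫⁻ y : Rn n, ENNReal.ofReal (wt A y) := fun x =>
    lintegral_sub_left_eq_self (fun y => ENNReal.ofReal (wt A y)) x
  have hWf : ∫⁻ y : Rn n, ENNReal.ofReal (wt A y) ≠ ∞ := (wt_integrable hA).lintegral_lt_top.ne
  rcases hp1.eq_or_lt with h1 | h1
  · subst h1
    exact ⟨1, by simp, fun g _ x => by rw [ENNReal.rpow_one, one_mul, TT_eq]⟩
  refine ⟨(∫⁻ y : Rn n, ENNReal.ofReal (wt A y)) ^ (p - 1), ENNReal.rpow_ne_top_of_nonneg (by linarith) hWf,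
    fun g hg x => ?_⟩
  have hc : p.HolderConjugate (p / (p - 1)) := Real.HolderConjugate.conjExponent h1
  set r := p / (p - 1)
  have hwm : Measurable fun y : Rn n => ENNReal.ofReal (wt A (x - y)) :=
    ((wt_cont A).comp (by fun_prop : Continuous fun y : Rn n => x - y)).measurable.ennreal_ofReal
  have hgm : Measurable fun y : Rn n => ‖g y‖ₑ := hg.enorm.measurable
  have hH := ENNReal.lintegral_mul_le_Lp_mul_Lq (volume : Measure (Rn n)) hc
    (f := fun y => ENNReal.ofReal (wt A (x - y)) ^ p⁻¹ * ‖g y‖ₑ)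
    (g := fun y => ENNReal.ofReal (wt A (x - y)) ^ r⁻¹)
    ((hwm.pow_const _).mul hgm).aemeasurable (hwm.pow_const _).aemeasurable
  have e1 : ∀ y : Rn n, (ENNReal.ofReal (wt A (x - y)) ^ p⁻¹ * ‖g y‖ₑ) *
      (ENNReal.ofReal (wt A (x - y)) ^ r⁻¹) = ENNReal.ofReal (wt A (x - y)) * ‖g y‖ₑ := by
    intro y
    rw [mul_right_comm, ← ENNReal.rpow_add_of_nonneg _ _ (inv_pos.2 hp).le (inv_pos.2 hc.symm.pos).le,
      hc.inv_add_inv_eq_one, ENNReal.rpow_one]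
  simp only [Pi.mul_apply, e1] at hH
  have e2 : ∀ y, (ENNReal.ofReal (wt A (x - y)) ^ p⁻¹ * ‖g y‖ₑ) ^ p = ENNReal.ofReal (wt A (x - y)) * ‖g y‖ₑ ^ p := by
    intro y
    rw [ENNReal.mul_rpow_of_nonneg _ _ hp.le, ← ENNReal.rpow_mul, inv_mul_cancel₀ hp.ne', ENNReal.rpow_one]
  have e3 : ∀ y, (ENNReal.ofReal (wt A (x - y)) ^ r⁻¹) ^ r = ENNReal.ofReal (wt A (x - y)) := by
    intro y
    rw [← ENNReal.rpow_mul, inv_mul_cancel₀ hc.symm.pos.ne', ENNReal.rpow_one]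
  simp only [e2, e3, hW] at hH
  calc TT A g x ^ p ≤ _ := ENNReal.rpow_le_rpow hH hp.le
    _ = _ := by
      rw [ENNReal.mul_rpow_of_nonneg _ _ hp.le, ← ENNReal.rpow_mul, ← ENNReal.rpow_mul, one_div,
        inv_mul_cancel₀ hp.ne', ENNReal.rpow_one, mul_comm]
      congr 2
      have : r = p / (p - 1) := rfl
      rw [this]
      have : p - 1 ≠ 0 := by linarith
      field_simp

lemma TT_inf {A : ℝ} (hA : (n : ℝ) < A) :
    ∃ C : ℝ≥0∞, C ≠ ∞ ∧ ∀ g : Rn n → E, ∀ x, TT A g x ≤ C * eLpNorm g ∞ volume := by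
  have hW : ∀ x : Rn n, ∫⁻ y, ENNReal.ofReal (wt A (x - y)) = ∫⁻ y : Rn n, ENNReal.ofReal (wt A y) := fun x =>
    lintegral_sub_left_eq_self (fun y => ENNReal.ofReal (wt A y)) x
  refine ⟨∫⁻ y : Rn n, ENNReal.ofReal (wt A y), (wt_integrable hA).lintegral_lt_top.ne, fun g x => ?_⟩
  have hwm : Measurable fun y : Rn n => ENNReal.ofReal (wt A (x - y)) :=
    ((wt_cont A).comp (by fun_prop : Continuous fun y : Rn n => x - y)).measurable.ennreal_ofReal
  rw [← hW x, ← lintegral_mul_const _ hwm]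
  refine lintegral_mono_ae ?_
  filter_upwards [enorm_ae_le_eLpNormEssSup g volume] with y hy
  rw [eLpNorm_exponent_top]
  gcongr


lemma PP_fin {P : ℝ} (hP : 0 < P) (Θ : Sch n) :
    ∃ A B : ℝ, 0 ≤ A ∧ (n : ℝ) < B ∧ ∃ C : ℝ≥0∞, C ≠ ∞ ∧ ∀ g : Rn n → E, PolyG g →
      (∀ x, g x = cv (Bs E) Θ g x) → ∀ x, TT A g x ^ P ≤ C * II B P g x := by
  rcases le_total P 1 with h | h
  · obtain ⟨C, hC, hb⟩ := PP_small (E := E) (A := (n + 1) / P) (by positivity) hP h Θ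
    refine ⟨(n + 1) / P, n + 1, by positivity, by linarith, C, hC, fun g hg hr x => ?_⟩
    have := hb g hg hr x
    rwa [div_mul_cancel₀ _ hP.ne'] at this
  · obtain ⟨C, hC, hb⟩ := PP_big (n := n) (E := E) (A := n + 1) (by linarith) h
    exact ⟨n + 1, n + 1, by positivity, by linarith, C, hC, fun g hg _ x => hb g hg.1 x⟩

/-- `ℓ_p` norm over the lattice -/
def bp (p : ℝ≥0∞) (t : (Fin n → ℤ) → ℝ≥0∞) : ℝ≥0∞ :=
  if p = ∞ then ⨆ m, t m else (∑' m, t m ^ p.toReal) ^ (1 / p.toReal)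

lemma PP_all {p : ℝ≥0∞} (hp : 0 < p) (Θ : Sch n) :
    ∃ A : ℝ, 0 ≤ A ∧ ∃ C : ℝ≥0∞, C ≠ ∞ ∧ ∀ g : Rn n → E, PolyG g →
      (∀ x, g x = cv (Bs E) Θ g x) → (∀ x, TT A g x ≤ C * eLpNorm g p volume) ∧
        bp p (fun m => TT A g (zpt m)) ≤ C * eLpNorm g p volume := by
  by_cases hpt : p = ∞
  · subst hpt
    obtain ⟨C, hC, hb⟩ := TT_inf (n := n) (E := E) (A := n + 1) (by linarith)
    refine ⟨n + 1, by positivity, C, hC, fun g _ _ => ⟨hb g, ?_⟩⟩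
    unfold bp
    rw [if_pos rfl]
    exact iSup_le fun m => hb g _
  have hP : 0 < p.toReal := ENNReal.toReal_pos hp.ne' hpt
  set P := p.toReal with hPdef
  have hPi : 0 ≤ 1 / P := by positivity
  obtain ⟨A, B, hA, hB, C, hC, hb⟩ := PP_fin (n := n) (E := E) hP Θ
  obtain ⟨D, hD, hl⟩ := lattice_sum (n := n) hB
  refine ⟨A, hA, C ^ (1 / P) + (C * D) ^ (1 / P), ?_, fun g hg hr => ?_⟩
  · exact ENNReal.add_ne_top.2 ⟨ENNReal.rpow_ne_top_of_nonneg hPi hC,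
      ENNReal.rpow_ne_top_of_nonneg hPi (ENNReal.mul_ne_top hC hD)⟩
  have he : eLpNorm g p volume = (∫⁻ x, ‖g x‖ₑ ^ P) ^ (1 / P) :=
    eLpNorm_eq_lintegral_rpow_enorm_toReal hp.ne' hpt
  have hB0 : 0 ≤ B := (Nat.cast_nonneg n).trans hB.le
  have hgm : Measurable fun y : Rn n => ‖g y‖ₑ ^ P := hg.1.enorm.measurable.pow_const _
  constructor
  · intro x
    refine le_trans ?_ (mul_le_mul_left le_self_add _)
    rw [he, ← ENNReal.mul_rpow_of_nonneg _ _ hPi, one_div, ENNReal.le_rpow_inv_iff hP]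
    refine (hb g hg hr x).trans ?_
    gcongr
    unfold II
    refine lintegral_mono fun y => ?_
    refine mul_le_of_le_one_left zero_le ?_
    rw [← ENNReal.ofReal_one]
    exact ENNReal.ofReal_le_ofReal (wt_le_one hB0 _)
  · refine le_trans ?_ (mul_le_mul_left le_add_self _)
    unfold bp
    rw [if_neg hpt, he, ← ENNReal.mul_rpow_of_nonneg _ _ hPi]
    refine ENNReal.rpow_le_rpow ?_ hPi
    calc _ ≤ ∑' m : Fin n → ℤ, C * II B P g (zpt m) := ENNReal.tsum_le_tsum fun m => hb g hg hr _
      _ = C * ∑' m : Fin n → ℤ, II B P g (zpt m) := ENNReal.tsum_mul_left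
      _ = C * ∫⁻ y, ∑' m : Fin n → ℤ, ENNReal.ofReal (wt B (zpt m - y)) * ‖g y‖ₑ ^ P := by
          rw [lintegral_tsum]
          · rfl
          · intro m
            refine AEMeasurable.mul ?_ hgm.aemeasurable
            exact (((wt_cont B).comp (by fun_prop : Continuous fun y : Rn n => zpt m - y)).measurable.ennreal_ofReal).aemeasurable
      _ ≤ C * ∫⁻ y, D * ‖g y‖ₑ ^ P := by
          gcongr with y
          rw [ENNReal.tsum_mul_right]
          gcongr
          have := hl 1 one_pos le_rfl y
          simp only [one_pow, ENNReal.ofReal_one, one_mul, one_smul] at this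
          refine le_trans (le_of_eq ?_) this
          exact tsum_congr fun m => by rw [wt_sub_comm]
      _ = _ := by rw [lintegral_const_mul _ hgm, mul_assoc]


lemma invF_shift (ψ : Sch n) (z ξ : Rn n) : invFourierS (shiftReflect ψ z) ξ =
    Complex.exp (((2 * π * inner ℝ z ξ : ℝ) : ℂ) * Complex.I) * fourierS ψ ξ := by
  rw [invFourierS_apply, fourierS_apply, ← integral_const_mul,
    ← integral_sub_left_eq_self (fun v => Complex.exp (((2 * π * inner ℝ z ξ : ℝ) : ℂ) * Complex.I) *
      Complex.exp (((-2 * π * inner ℝ v ξ : ℝ) : ℂ) * Complex.I) • ψ v) volume z]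
  refine integral_congr_ae (Eventually.of_forall fun v => ?_)
  simp only [shiftReflect_apply, smul_eq_mul]
  rw [← mul_assoc, ← Complex.exp_add]
  congr 2
  rw [inner_sub_left]
  push_cast; ring

lemma shift_repr (χ θ : Sch n) (h : ∀ ξ, χ ξ * θ ξ = χ ξ) (z : Rn n) :
    fourierS (smulLeftCLM ℂ χ (invFourierS (shiftReflect (invFourierS θ) z))) =
      shiftReflect (invFourierS χ) z := by
  have e : smulLeftCLM ℂ χ (invFourierS (shiftReflect (invFourierS θ) z)) =
      invFourierS (shiftReflect (invFourierS χ) z) := by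
    ext ξ
    rw [smulLeftCLM_apply_apply χ.hasTemperateGrowth, invF_shift, invF_shift]
    have h1 : fourierS (invFourierS θ) = θ := (FourierTransform.fourierCLE ℂ (Sch n)).apply_symm_apply θ
    have h2 : fourierS (invFourierS χ) = χ := (FourierTransform.fourierCLE ℂ (Sch n)).apply_symm_apply χ
    rw [h1, h2, smul_eq_mul, mul_left_comm, h ξ]
  rw [e]
  exact (FourierTransform.fourierCLE ℂ (Sch n)).apply_symm_apply _

lemma exists_theta (n : ℕ) : ∃ θ : Sch n, ∀ ξ, ‖ξ‖ ≤ 2 → θ ξ = 1 := by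
  let b : ContDiffBump (0 : Rn n) := ⟨2, 3, by norm_num, by norm_num⟩
  have hc : HasCompactSupport (fun x : Rn n => ((b x : ℝ) : ℂ)) :=
    HasCompactSupport.comp_left (g := fun r : ℝ => (r : ℂ)) b.hasCompactSupport Complex.ofReal_zero
  have hs : ContDiff ℝ ((⊤ : ℕ∞) : WithTop ℕ∞) (fun x : Rn n => ((b x : ℝ) : ℂ)) :=
    Complex.ofRealCLM.contDiff.comp b.contDiff
  refine ⟨hc.toSchwartzMap hs, fun ξ hξ => ?_⟩
  change ((b ξ : ℝ) : ℂ) = 1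
  rw [b.one_of_mem_closedBall (by simpa using hξ)]; simp

/-- a fixed cut-off -/
def theta (n : ℕ) : Sch n := (exists_theta n).choose

lemma theta_one (ξ : Rn n) (h : ‖ξ‖ ≤ 2) : theta n ξ = 1 := (exists_theta n).choose_spec ξ h

/-- rescaled dyadic pieces -/
def gj (φ : ℕ → Sch n) (f : TDist n E) (j : ℕ) (x : Rn n) : E := mOp (φ j) f (((2 : ℝ) ^ j)⁻¹ • x)

lemma mOp_poly (χ : Sch n) (f : TDist n E) : PolyG (mOp χ f) := by
  obtain ⟨N, hN, h⟩ := td_growth f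
  obtain ⟨C, hC, hb⟩ := h (invFourierS χ)
  have hc := td_cont f (invFourierS χ)
  refine ⟨hc.const_smul _, N, (2 * π) ^ (-(n : ℝ) / 2) * C, hN, by positivity, fun y => ?_⟩
  unfold mOp tdConv
  rw [norm_smul, Real.norm_of_nonneg (by positivity), mul_assoc]
  gcongr
  exact hb y

lemma gj_poly (φ : ℕ → Sch n) (f : TDist n E) (j : ℕ) : PolyG (gj φ f j) := by
  obtain ⟨hc, N, C, hN, hC, hb⟩ := mOp_poly (φ j) f
  refine ⟨hc.comp (by fun_prop), N, C, hN, hC, fun y => (hb _).trans ?_⟩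
  have : ‖((2 : ℝ) ^ j)⁻¹ • y‖ ≤ ‖y‖ := by
    rw [norm_smul, norm_inv, norm_pow, Real.norm_ofNat]
    exact mul_le_of_le_one_left (norm_nonneg _) (inv_le_one_of_one_le₀ (one_le_pow₀ (by norm_num)))
  gcongr

lemma gj_rep [CompleteSpace E] {φ : ℕ → Sch n} (hφ : SmoothResolution n φ) (f : TDist n E) (j : ℕ) (x : Rn n) :
    gj φ f j x = cv (Bs E) (invFourierS (theta n)) (gj φ f j) x := by
  set t : ℝ := (2 : ℝ) ^ j with ht
  have ht0 : 0 < t := by positivity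
  set θ' : Sch n := dilate (theta n) t⁻¹ with hθ'
  have h1 : ∀ ξ, φ j ξ * θ' ξ = φ j ξ := by
    intro ξ
    by_cases h0 : φ j ξ = 0
    · rw [h0, zero_mul]
    have hξ : ‖ξ‖ ≤ t * 2 := by
      rcases Nat.eq_zero_or_pos j with rfl | hj
      · have := hφ.supp0 h0
        rw [ht]; simpa using this
      · have := (hφ.suppj j hj h0).2
        rwa [Real.rpow_add (by norm_num), Real.rpow_natCast, Real.rpow_one] at this
    rw [hθ', dilate_apply _ (inv_ne_zero ht0.ne'), theta_one, mul_one]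
    rw [norm_smul, norm_inv, Real.norm_of_nonneg ht0.le, inv_mul_le_iff₀ ht0]
    exact hξ
  have hT : ∀ y, invFourierS θ' y = (t : ℂ) ^ n * invFourierS (theta n) (t • y) := by
    intro y
    rw [invFourier_dilate θ' ht0]
    congr 2
    congr 1
    ext ξ
    rw [dilate_apply _ ht0.ne', hθ', dilate_apply _ (inv_ne_zero ht0.ne'), smul_smul, inv_mul_cancel₀ ht0.ne',
      one_smul]
  set z := t⁻¹ • x with hz
  have h2 := td_ex f (φ j) (shiftReflect (invFourierS θ') z)
  rw [shift_repr _ _ h1] at h2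
  have h3 : mOp (φ j) f z = ∫ y, invFourierS θ' (z - y) • mOp (φ j) f y := by
    unfold mOp tdConv
    rw [← h2, ← integral_smul]
    refine integral_congr_ae (Eventually.of_forall fun y => ?_)
    simp only [shiftReflect_apply]
    rw [smul_comm]
  unfold cv
  change mOp (φ j) f z = ∫ y, invFourierS (theta n) (x - y) • mOp (φ j) f (t⁻¹ • y)
  rw [h3]
  have h4 := Measure.integral_comp_smul (volume : Measure (Rn n))
    (fun y => invFourierS (theta n) (x - y) • mOp (φ j) f (t⁻¹ • y)) t
  rw [finrank_euclideanSpace, Fintype.card_fin, abs_of_pos (by positivity)] at h4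
  have h5 : ∫ y, invFourierS (theta n) (x - y) • mOp (φ j) f (t⁻¹ • y) =
      (t ^ n) • ∫ y, invFourierS (theta n) (x - t • y) • mOp (φ j) f (t⁻¹ • t • y) := by
    rw [h4, smul_smul, mul_inv_cancel₀ (by positivity), one_smul]
  rw [h5, ← integral_smul]
  refine integral_congr_ae (Eventually.of_forall fun y => ?_)
  simp only
  rw [hT, smul_sub, hz, smul_smul, smul_smul, mul_inv_cancel₀ ht0.ne', inv_mul_cancel₀ ht0.ne', one_smul,
    one_smul, mul_smul, ← Complex.ofReal_pow, Complex.coe_smul]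


lemma part_one {d : ℝ} (hd : 1 < d) : ∃ h : ℝ → ℝ, ContDiff ℝ ((⊤ : ℕ∞) : WithTop ℕ∞) h ∧ (∀ t, 0 ≤ h t) ∧
    (∀ t, h t ≠ 0 → |t| ≤ d / 2) ∧
    ∀ t, ∃ S : Finset ℤ, (∀ k ∉ S, h (t - k) = 0) ∧ ∑ k ∈ S, h (t - k) = 1 := by
  set ε := (d - 1) / 2 with hε
  have hε0 : 0 < ε := by rw [hε]; linarith
  set σ : ℝ → ℝ := fun t => Real.smoothTransition ((t + ε) / (2 * ε)) with hσ
  have σ0 : ∀ t, t ≤ -ε → σ t = 0 := fun t ht =>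
    Real.smoothTransition.zero_of_nonpos (div_nonpos_of_nonpos_of_nonneg (by linarith) (by linarith))
  have σ1 : ∀ t, ε ≤ t → σ t = 1 := fun t ht =>
    Real.smoothTransition.one_of_one_le (by rw [le_div_iff₀ (by linarith)]; linarith)
  have σm : Monotone σ := fun a b hab => Real.smoothTransition.monotone (by gcongr)
  have σc : ContDiff ℝ ((⊤ : ℕ∞) : WithTop ℕ∞) σ :=
    Real.smoothTransition.contDiff.comp ((contDiff_id.add contDiff_const).div_const _)
  have hsupp : ∀ t, σ (t + 1 / 2) - σ (t - 1 / 2) ≠ 0 → |t| ≤ d / 2 := by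
    intro t ht
    by_contra hlt
    push Not at hlt
    apply ht
    rcases lt_abs.1 hlt with h | h
    · rw [σ1 _ (by rw [hε]; linarith), σ1 _ (by rw [hε]; linarith), sub_self]
    · rw [σ0 _ (by rw [hε]; linarith), σ0 _ (by rw [hε]; linarith), sub_self]
  refine ⟨fun t => σ (t + 1 / 2) - σ (t - 1 / 2), ?_, fun t => ?_, hsupp, fun t => ?_⟩
  · exact (σc.comp (contDiff_id.add contDiff_const)).sub (σc.comp (contDiff_id.sub contDiff_const))
  · exact sub_nonneg.2 (σm (by linarith))
  obtain ⟨M, hM⟩ := exists_nat_gt (|t| + d + 1)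
  have ht := abs_le.1 (le_refl |t|)
  have hinj : Function.Injective fun k : ℕ => (k : ℤ) - M := fun a b hab => by simpa using hab
  refine ⟨(Finset.range (2 * M)).image fun k : ℕ => (k : ℤ) - M, fun k hk => ?_, ?_⟩
  · by_contra hne
    have h1 := abs_le.1 (hsupp _ hne)
    apply hk
    have ha : (-(M : ℝ)) < k := by linarith
    have hb : (k : ℝ) < M := by linarith
    have ha' : -(M : ℤ) < k := by exact_mod_cast ha
    have hb' : k < (M : ℤ) := by exact_mod_cast hb
    refine Finset.mem_image.2 ⟨(k + M).toNat, Finset.mem_range.2 (by omega), by omega⟩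
  · rw [Finset.sum_image (fun a _ b _ hab => hinj hab)]
    have := Finset.sum_range_sub' (fun k : ℕ => σ (t - ((k : ℤ) - M : ℤ) + 1 / 2)) (2 * M)
    have e : ∀ k : ℕ, σ (t - ((k : ℤ) - M : ℤ) - 1 / 2) = σ (t - (((k + 1 : ℕ) : ℤ) - M : ℤ) + 1 / 2) := by
      intro k; congr 1; push_cast; ring
    simp only [e]
    rw [this, σ1 _ (by push_cast; rw [hε]; linarith), σ0 _ (by push_cast; rw [hε]; linarith), sub_zero]

lemma exists_eta (n : ℕ) {d : ℝ} (hd : 1 < d) : ∃ (η : Sch n) (r : Rn n → ℝ), (∀ x, 0 ≤ r x) ∧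
    (∀ x, η x = (r x : ℂ)) ∧ (∀ x, η x ≠ 0 → ∀ i, |x i| ≤ d / 2) ∧
    ∀ x, HasSum (fun m : Fin n → ℤ => r (x - zpt m)) 1 := by
  obtain ⟨h, hc, h0, hs, hsum⟩ := part_one hd
  set r : Rn n → ℝ := fun x => ∏ i, h (x i) with hr
  have hrc : ContDiff ℝ ((⊤ : ℕ∞) : WithTop ℕ∞) r := by
    refine contDiff_prod fun i _ => hc.comp ?_
    exact (EuclideanSpace.proj i : Rn n →L[ℝ] ℝ).contDiff
  have hrs : ∀ x, r x ≠ 0 → ∀ i, |x i| ≤ d / 2 := fun x hx i =>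
    hs _ (Finset.prod_ne_zero_iff.1 hx i (Finset.mem_univ i))
  have hcs : HasCompactSupport (fun x => (r x : ℂ)) := by
    refine HasCompactSupport.of_support_subset_isCompact (isCompact_closedBall (0 : Rn n) (n * (d / 2))) ?_
    intro x hx
    have hx' : r x ≠ 0 := by simpa using hx
    rw [mem_closedBall_zero_iff]
    exact norm_le_of_coord (hrs x hx')
  have hcd : ContDiff ℝ ((⊤ : ℕ∞) : WithTop ℕ∞) (fun x => (r x : ℂ)) := Complex.ofRealCLM.contDiff.comp hrc
  refine ⟨hcs.toSchwartzMap hcd, r, fun x => Finset.prod_nonneg fun i _ => h0 _, fun x => rfl, ?_, ?_⟩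
  · intro x hx
    refine hrs x fun h => hx ?_
    change (r x : ℂ) = 0
    rw [h]; simp
  · intro x
    choose S hS hS1 using fun i => hsum (x i)
    have := hasSum_sum_of_ne_finset_zero (L := .unconditional _) (f := fun m : Fin n → ℤ => r (x - zpt m))
      (s := Fintype.piFinset S) (fun m hm => by
        rw [Fintype.mem_piFinset] at hm
        push Not at hm
        obtain ⟨i, hi⟩ := hm
        refine Finset.prod_eq_zero (Finset.mem_univ i) ?_
        exact hS i _ hi)
    convert this using 1
    have e := Finset.prod_univ_sum S (fun i k => h (x i - (k : ℝ)))
    simp only [hS1, Finset.prod_const_one] at e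
    rw [e]
    rfl


lemma atom_bd [CompleteSpace E] {A : ℝ} (hA : 0 ≤ A) (K : ℕ) (η Θ : Sch n) :
    ∃ C : ℝ≥0∞, C ≠ ∞ ∧ ∀ g : Rn n → E, PolyG g → (∀ x, g x = cv (Bs E) Θ g x) →
      ContDiff ℝ K g ∧ (∀ x z : Rn n, ‖g x‖ₑ ≤ C * ENNReal.ofReal ((1 + ‖z - x‖) ^ A) * TT A g z) ∧
      ∀ z : Rn n, ∀ l ≤ K, ∀ x,
      ‖iteratedFDeriv ℝ l (fun y => η (y - z) • g y) x‖ₑ ≤ C * TT A g z := by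
  choose Cg hCg hg' using fun l => cv_iter (n := n) (E := E) A l (Bs E) Θ
  choose D hD hη using fun l => (SBdd.const η).decay_l l A
  refine ⟨Cg 0 + ∑ l ∈ Finset.range (K + 1), ∑ i ∈ Finset.range (l + 1),
    (l.choose i : ℝ≥0∞) * ENNReal.ofReal (D i) * Cg (l - i), ?_, fun g hg hr => ?_⟩
  · refine ENNReal.add_ne_top.2 ⟨hCg 0, ?_⟩
    refine ENNReal.sum_ne_top.2 fun l _ => ENNReal.sum_ne_top.2 fun i _ => ?_
    exact ENNReal.mul_ne_top (ENNReal.mul_ne_top (ENNReal.natCast_ne_top _) ENNReal.ofReal_ne_top) (hCg _)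
  have hr' : cv (Bs E) Θ g = g := (funext hr).symm
  have hcd : ∀ l : ℕ, ContDiff ℝ l g := fun l => by have := (hg' l g hg).1; rwa [hr'] at this
  have hbd : ∀ l x, ‖iteratedFDeriv ℝ l g x‖ₑ ≤ Cg l * TT A g x := fun l x => by
    have := (hg' l g hg).2 x; rwa [hr'] at this
  refine ⟨hcd K, fun x z => ?_, fun z l hl x => ?_⟩
  · have := hbd 0 x
    rw [← ofReal_norm, norm_iteratedFDeriv_zero, ofReal_norm] at this
    refine this.trans ?_
    rw [mul_assoc]
    exact mul_le_mul' le_self_add (TT_shift hA g z x)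
  have hηc : ContDiff ℝ l (fun y => η (y - z)) := (η.smooth l).comp (contDiff_id.sub contDiff_const)
  have h1 := norm_iteratedFDeriv_smul_le (𝕜 := ℝ) (N := l) hηc (hcd l) x (n := l) le_rfl
  rw [← ofReal_norm]
  refine (ENNReal.ofReal_le_ofReal h1).trans ?_
  rw [ENNReal.ofReal_sum_of_nonneg fun i _ => by positivity]
  refine le_trans ?_ (mul_le_mul_left (le_add_self) _)
  have h2 : ∑ i ∈ Finset.range (l + 1), (l.choose i : ℝ≥0∞) * ENNReal.ofReal (D i) * Cg (l - i) ≤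
      ∑ l ∈ Finset.range (K + 1), ∑ i ∈ Finset.range (l + 1),
        (l.choose i : ℝ≥0∞) * ENNReal.ofReal (D i) * Cg (l - i) :=
    Finset.single_le_sum (f := fun l => ∑ i ∈ Finset.range (l + 1),
        (l.choose i : ℝ≥0∞) * ENNReal.ofReal (D i) * Cg (l - i)) (fun _ _ => zero_le)
        (Finset.mem_range.2 (by omega))
  refine le_trans ?_ (mul_le_mul_left h2 _)
  rw [Finset.sum_mul]
  refine Finset.sum_le_sum fun i _ => ?_
  rw [ENNReal.ofReal_mul (by positivity), ENNReal.ofReal_mul (by positivity), ENNReal.ofReal_natCast, ofReal_norm,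
    ofReal_norm]
  have h3 : ‖iteratedFDeriv ℝ i (fun y => η (y - z)) x‖ₑ ≤ ENNReal.ofReal (D i) * ENNReal.ofReal (wt A (x - z)) := by
    rw [iteratedFDeriv_comp_sub, ← ofReal_norm, ← ENNReal.ofReal_mul (hD i).le]
    exact ENNReal.ofReal_le_ofReal (hη i () _)
  have h4 : ENNReal.ofReal (wt A (x - z)) * ENNReal.ofReal ((1 + ‖z - x‖) ^ A) = 1 := by
    rw [← ENNReal.ofReal_mul (wt_pos _ _).le, wt_sub_comm, wt_mul_pow, ENNReal.ofReal_one]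
  calc _ ≤ (l.choose i : ℝ≥0∞) * (ENNReal.ofReal (D i) * ENNReal.ofReal (wt A (x - z))) *
        (Cg (l - i) * (ENNReal.ofReal ((1 + ‖z - x‖) ^ A) * TT A g z)) := by
        refine mul_le_mul' (mul_le_mul' le_rfl h3) ((hbd (l - i) x).trans ?_)
        gcongr
        exact TT_shift hA g z x
    _ = (l.choose i : ℝ≥0∞) * ENNReal.ofReal (D i) * Cg (l - i) * TT A g z *
        (ENNReal.ofReal (wt A (x - z)) * ENNReal.ofReal ((1 + ‖z - x‖) ^ A)) := by ring
    _ = _ := by rw [h4, mul_one]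


lemma atom_ok {K j : ℕ} {d C₀ τ ρ : ℝ} (hC₀ : 0 < C₀) (hτ : 0 ≤ τ) {η : Sch n}
    (hη : ∀ x, η x ≠ 0 → ∀ i, |x i| ≤ d / 2) {g : Rn n → E} (hg : ContDiff ℝ K g) (m : Fin n → ℤ)
    (hb : ∀ l ≤ K, ∀ x, ‖iteratedFDeriv ℝ l (fun y => η (y - zpt m) • g y) x‖ ≤ C₀ * τ)
    (a : Rn n → E)
    (ha : a = fun x => ((2 : ℝ) ^ (-(j : ℝ) * ρ) * (C₀ * τ)⁻¹) •
      (η ((2 : ℝ) ^ j • x - zpt m) • g ((2 : ℝ) ^ j • x))) :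
    ContDiff ℝ K a ∧ Function.support a ⊆ dQ d j m ∧
    (∀ α : Fin n → ℕ, mdeg α ≤ K → ∀ x, ‖mderiv α a x‖ ≤ 2 ^ (-(j : ℝ) * ρ + (mdeg α : ℝ) * (j : ℝ))) ∧
    ∀ x, ((2 : ℝ) ^ ((j : ℝ) * ρ) * (C₀ * τ)) • a x = η ((2 : ℝ) ^ j • x - zpt m) • g ((2 : ℝ) ^ j • x) := by
  set B : Rn n → E := fun y => η (y - zpt m) • g y with hB
  have hBc : ContDiff ℝ K B := ((η.smooth K).comp (contDiff_id.sub contDiff_const)).smul hg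
  have hBc2 : ContDiff ℝ K (fun x => B ((2 : ℝ) ^ j • x)) := hBc.comp (contDiff_const_smul _)
  set κ : ℝ := (2 : ℝ) ^ (-(j : ℝ) * ρ) * (C₀ * τ)⁻¹ with hκ
  have haB : a = fun x => κ • B ((2 : ℝ) ^ j • x) := ha
  have hac : ContDiff ℝ K a := by rw [haB]; exact hBc2.const_smul κ
  have hκ0 : 0 ≤ κ := by positivity
  have hj0 : (0 : ℝ) < 2 ^ j := by positivity
  refine ⟨hac, ?_, fun α hα x => ?_, fun x => ?_⟩
  · intro x hx i
    have h1 : η ((2 : ℝ) ^ j • x - zpt m) ≠ 0 := fun h0 => hx (by rw [ha]; simp [h0])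
    have h2 := hη _ h1 i
    have e : ((2 : ℝ) ^ j • x - zpt m) i = 2 ^ j * x i - m i := by simp [zpt]
    rw [e] at h2
    rw [two_rpow_neg]
    have e2 : x i - ((2 : ℝ) ^ j)⁻¹ * m i = ((2 : ℝ) ^ j)⁻¹ * (2 ^ j * x i - m i) := by field_simp
    rw [e2, abs_mul, abs_of_pos (inv_pos.2 hj0)]
    calc _ ≤ ((2 : ℝ) ^ j)⁻¹ * (d / 2) := by gcongr
      _ = _ := by ring
  · have hl : ((mdeg α : ℕ) : WithTop ℕ∞) ≤ K := by exact_mod_cast hα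
    refine (norm_mderiv_le α a (hac.of_le hl) x).trans ?_
    rw [haB, iteratedFDeriv_const_smul_apply' ((hBc2.of_le hl).contDiffAt),
      iteratedFDeriv_comp_const_smul _ (hBc.of_le hl), norm_smul, norm_smul, norm_pow, norm_pow, Real.norm_ofNat,
      Real.norm_of_nonneg hκ0]
    have h1 := hb (mdeg α) hα ((2 : ℝ) ^ j • x)
    have h2 : (C₀ * τ)⁻¹ * ‖iteratedFDeriv ℝ (mdeg α) B ((2 : ℝ) ^ j • x)‖ ≤ 1 := by
      rw [inv_mul_eq_div]
      exact div_le_one_of_le₀ h1 (by positivity)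
    rw [hκ, Real.rpow_add (by norm_num)]
    have e : (2 : ℝ) ^ ((mdeg α : ℝ) * (j : ℝ)) = (2 ^ j) ^ mdeg α := by
      rw [mul_comm, Real.rpow_mul (by norm_num), Real.rpow_natCast, Real.rpow_natCast]
    rw [e]
    calc _ = (2 : ℝ) ^ (-(j : ℝ) * ρ) * (2 ^ j) ^ mdeg α *
          ((C₀ * τ)⁻¹ * ‖iteratedFDeriv ℝ (mdeg α) B ((2 : ℝ) ^ j • x)‖) := by ring
      _ ≤ _ := mul_le_of_le_one_right (by positivity) h2
  · rw [haB]
    change _ • κ • B _ = B _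
    rw [smul_smul]
    by_cases h0 : τ = 0
    · have : B ((2 : ℝ) ^ j • x) = 0 := by
        have := hb 0 (Nat.zero_le _) ((2 : ℝ) ^ j • x)
        rw [norm_iteratedFDeriv_zero, h0, mul_zero] at this
        exact norm_le_zero_iff.1 this
      rw [this, smul_zero]
    · have : (2 : ℝ) ^ ((j : ℝ) * ρ) * (C₀ * τ) * κ = 1 := by
        have h3 : (2 : ℝ) ^ ((j : ℝ) * ρ) * 2 ^ (-(j : ℝ) * ρ) = 1 := by
          rw [← Real.rpow_add (by norm_num)]; simp
        have h4 : (C₀ * τ) * (C₀ * τ)⁻¹ = 1 := mul_inv_cancel₀ (mul_ne_zero hC₀.ne' h0)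
        rw [hκ]
        calc _ = ((2 : ℝ) ^ ((j : ℝ) * ρ) * 2 ^ (-(j : ℝ) * ρ)) * ((C₀ * τ) * (C₀ * τ)⁻¹) := by ring
          _ = 1 := by rw [h3, h4, mul_one]
      rw [this, one_smul]


lemma gj_eLp (φ : ℕ → Sch n) (f : TDist n E) (j : ℕ) (p : ℝ≥0∞) :
    eLpNorm (gj φ f j) p volume = e2 (j * (n / p.toReal)) * eLpNorm (mOp (φ j) f) p volume := by
  have hr : ((2 : ℝ) ^ j)⁻¹ ≠ 0 := by positivity
  have hm : Measurable (fun x : Rn n => ((2 : ℝ) ^ j)⁻¹ • x) := measurable_const_smul _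
  have hc : AEStronglyMeasurable (mOp (φ j) f) (Measure.map (fun x : Rn n => ((2 : ℝ) ^ j)⁻¹ • x) volume) :=
    (mOp_poly (φ j) f).1.aestronglyMeasurable
  have h1 : eLpNorm (gj φ f j) p volume =
      eLpNorm (mOp (φ j) f) p (Measure.map (fun x : Rn n => ((2 : ℝ) ^ j)⁻¹ • x) volume) := by
    rw [eLpNorm_map_measure hc hm.aemeasurable]; rfl
  have h2 : Measure.map (fun x : Rn n => ((2 : ℝ) ^ j)⁻¹ • x) volume = e2 (j * n) • (volume : Measure (Rn n)) := by
    rw [Measure.map_addHaar_smul _ hr, finrank_euclideanSpace, Fintype.card_fin, ← e2_ofReal]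
    congr 2
    rw [inv_pow, inv_inv, abs_of_pos (by positivity), ← pow_mul]
    rw [← Nat.cast_mul, Real.rpow_natCast]
  have h3 : e2 ((j : ℝ) * n) ≠ 0 := by
    rw [← e2_ofReal]; simp; positivity
  rw [h1, h2, eLpNorm_smul_measure_of_ne_zero h3, smul_eq_mul, e2_rpow]
  congr 2
  rw [one_div, ENNReal.toReal_inv]; ring

lemma bp_mul_le {p : ℝ≥0∞} (hp : 0 < p) (D : ℝ≥0∞) (t u : (Fin n → ℤ) → ℝ≥0∞) (h : ∀ m, u m ≤ D * t m) :
    bp p u ≤ D * bp p t := by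
  unfold bp
  by_cases hpt : p = ∞
  · simp only [hpt, if_true]
    exact iSup_le fun m => (h m).trans (mul_le_mul' le_rfl (le_iSup t m))
  · simp only [hpt, if_false]
    have hP : 0 < p.toReal := ENNReal.toReal_pos hp.ne' hpt
    calc _ ≤ (D ^ p.toReal * ∑' m, t m ^ p.toReal) ^ (1 / p.toReal) := by
          refine ENNReal.rpow_le_rpow ?_ (by positivity)
          rw [← ENNReal.tsum_mul_left]
          refine ENNReal.tsum_le_tsum fun m => ?_
          rw [← ENNReal.mul_rpow_of_nonneg _ _ hP.le]
          exact ENNReal.rpow_le_rpow (h m) hP.le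
      _ = _ := by
          rw [ENNReal.mul_rpow_of_nonneg _ _ (by positivity), one_div, rpow_inv_cancel _ hP]

lemma lqSum_mul_le {q : ℝ≥0∞} (hq : 0 < q) (D : ℝ≥0∞) (t u : ℕ → ℝ≥0∞) (h : ∀ m, u m ≤ D * t m) :
    lqSum q u ≤ D * lqSum q t := by
  unfold lqSum
  by_cases hpt : q = ∞
  · simp only [hpt, if_true]
    exact iSup_le fun m => (h m).trans (mul_le_mul' le_rfl (le_iSup t m))
  · simp only [hpt, if_false]
    have hP : 0 < q.toReal := ENNReal.toReal_pos hq.ne' hpt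
    calc _ ≤ (D ^ q.toReal * ∑' m, t m ^ q.toReal) ^ (1 / q.toReal) := by
          refine ENNReal.rpow_le_rpow ?_ (by positivity)
          rw [← ENNReal.tsum_mul_left]
          refine ENNReal.tsum_le_tsum fun m => ?_
          rw [← ENNReal.mul_rpow_of_nonneg _ _ hP.le]
          exact ENNReal.rpow_le_rpow (h m) hP.le
      _ = _ := by
          rw [ENNReal.mul_rpow_of_nonneg _ _ (by positivity), one_div, rpow_inv_cancel _ hP]

lemma le_lqSum {q : ℝ≥0∞} (hq : 0 < q) (t : ℕ → ℝ≥0∞) (j : ℕ) : t j ≤ lqSum q t := by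
  unfold lqSum
  by_cases hpt : q = ∞
  · simp only [hpt, if_true]; exact le_iSup t j
  · simp only [hpt, if_false]
    have hP : 0 < q.toReal := ENNReal.toReal_pos hq.ne' hpt
    rw [one_div]
    calc t j = (t j ^ q.toReal) ^ q.toReal⁻¹ := (rpow_inv_cancel _ hP).symm
      _ ≤ _ := ENNReal.rpow_le_rpow (ENNReal.le_tsum (f := fun j => t j ^ q.toReal) j) (by positivity)

lemma e2_mul_neg (x : ℝ) : e2 (-x) * e2 x = 1 := by rw [← e2_add, neg_add_cancel, e2_zero]

lemma mOp_eLp_le {s : ℝ} {p q : ℝ≥0∞} (hq : 0 < q) (φ : ℕ → Sch n) (f : TDist n E) (j : ℕ) :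
    eLpNorm (mOp (φ j) f) p volume ≤ e2 (-(j * s)) * besovNorm s p q φ f := by
  calc _ = e2 (-(j * s)) * (e2 (j * s) * eLpNorm (mOp (φ j) f) p volume) := by
        rw [← mul_assoc, e2_mul_neg, one_mul]
    _ ≤ _ := mul_le_mul' le_rfl (le_lqSum hq (fun j : ℕ => (2 : ℝ≥0∞) ^ ((j : ℝ) * s) *
        eLpNorm (mOp (φ j) f) p volume) j)

/-- coefficients of the atomic decomposition -/
def lamC (A C₀ s : ℝ) (p : ℝ≥0∞) (φ : ℕ → Sch n) (f : TDist n E) (j : ℕ) (m : Fin n → ℤ) : ℂ :=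
  (((2 * π) ^ ((n : ℝ) / 2) * ((2 : ℝ) ^ ((j : ℝ) * (s - n / p.toReal)) *
    (C₀ * (TT A (gj φ f j) (zpt m)).toReal)) : ℝ) : ℂ)

/-- atoms of the atomic decomposition -/
def atC (A C₀ s : ℝ) (p : ℝ≥0∞) (η : Sch n) (φ : ℕ → Sch n) (f : TDist n E) (j : ℕ) (m : Fin n → ℤ) :
    Rn n → E :=
  fun x => ((2 : ℝ) ^ (-(j : ℝ) * (s - n / p.toReal)) * (C₀ * (TT A (gj φ f j) (zpt m)).toReal)⁻¹) •
      (η ((2 : ℝ) ^ j • x - zpt m) • gj φ f j ((2 : ℝ) ^ j • x))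

lemma lamC_bNorm {A C₀ s : ℝ} (hC₀ : 0 ≤ C₀) {p q : ℝ≥0∞} (hp : 0 < p) (hq : 0 < q) {C : ℝ≥0∞} (φ : ℕ → Sch n)
    (f : TDist n E)
    (h : ∀ j, bp p (fun m => TT A (gj φ f j) (zpt m)) ≤ C * eLpNorm (gj φ f j) p volume) :
    bNorm p q (lamC A C₀ s p φ f) ≤
      ENNReal.ofReal ((2 * π) ^ ((n : ℝ) / 2)) * ENNReal.ofReal C₀ * C * besovNorm s p q φ f := by
  unfold bNorm besovNorm
  refine lqSum_mul_le hq _ _ _ fun j => ?_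
  change bp p (fun m => ‖lamC A C₀ s p φ f j m‖ₑ) ≤ _
  refine (bp_mul_le hp (ENNReal.ofReal ((2 * π) ^ ((n : ℝ) / 2)) * ENNReal.ofReal C₀ *
    e2 (j * (s - n / p.toReal))) (fun m => TT A (gj φ f j) (zpt m)) _ fun m => ?_).trans ?_
  · rw [← ofReal_norm, lamC, Complex.norm_real, Real.norm_of_nonneg (by positivity),
      ENNReal.ofReal_mul (by positivity), ENNReal.ofReal_mul (by positivity), ENNReal.ofReal_mul hC₀, e2_ofReal]
    calc _ = ENNReal.ofReal ((2 * π) ^ ((n : ℝ) / 2)) * ENNReal.ofReal C₀ * e2 (j * (s - n / p.toReal)) *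
          ENNReal.ofReal (TT A (gj φ f j) (zpt m)).toReal := by ring
      _ ≤ _ := mul_le_mul' le_rfl ENNReal.ofReal_toReal_le
  · refine (mul_le_mul' le_rfl (h j)).trans ?_
    rw [gj_eLp]
    have e : e2 (j * s) = e2 (j * (s - n / p.toReal)) * e2 (j * (n / p.toReal)) := by
      rw [← e2_add]; congr 1; ring
    change _ ≤ _ * (e2 (j * s) * _)
    rw [e]
    exact le_of_eq (by ring)


lemma mOp_sum_big {s : ℝ} {p q : ℝ≥0∞} (hp : 1 ≤ p) (hq : 0 < q) (φ : ℕ → Sch n) (f : TDist n E) (ψ : Sch n) (j : ℕ) :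
    ∫⁻ x, ‖ψ x‖ₑ * ‖mOp (φ j) f x‖ₑ ≤
      (eLpNorm ψ p.conjExponent volume * besovNorm s p q φ f) * e2 (-(j * s)) := by
  have : p.HolderConjugate p.conjExponent := ENNReal.HolderConjugate.conjExponent hp
  have : p.conjExponent.HolderTriple p 1 := this.symm
  have h := eLpNorm_smul_le_mul_eLpNorm (p := p.conjExponent) (q := p) (r := 1) (μ := (volume : Measure (Rn n)))
    (mOp_poly (φ j) f).1.aestronglyMeasurable (φ := ψ) ψ.continuous.aestronglyMeasurable
  rw [eLpNorm_one_eq_lintegral_enorm] at h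
  simp only [Pi.smul_apply', enorm_smul] at h
  refine h.trans ?_
  refine (mul_le_mul' le_rfl (mOp_eLp_le (s := s) hq φ f j)).trans (le_of_eq (by ring))

lemma mOp_sum_small {s : ℝ} {p q : ℝ≥0∞} (hp0 : 0 < p) (hp : p < 1) (hq : 0 < q) (φ : ℕ → Sch n) (f : TDist n E)
    {D : ℝ≥0∞} (hD : ∀ j x, ‖gj φ f j x‖ₑ ≤ D * eLpNorm (gj φ f j) p volume)
    (ψ : Sch n) (j : ℕ) :
    ∫⁻ x, ‖ψ x‖ₑ * ‖mOp (φ j) f x‖ₑ ≤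
      ((⨆ x, ‖ψ x‖ₑ) * (D ^ (1 - p.toReal) * besovNorm s p q φ f)) * e2 (-(j * (s - n * (1 / p.toReal - 1)))) := by
  have hpt : p ≠ ∞ := (hp.trans ENNReal.one_lt_top).ne
  have hP : 0 < p.toReal := ENNReal.toReal_pos hp0.ne' hpt
  have hP1 : p.toReal < 1 := by
    have := (ENNReal.toReal_lt_toReal hpt ENNReal.one_ne_top).2 hp
    simpa using this
  set P := p.toReal with hPd
  set N := eLpNorm (mOp (φ j) f) p volume with hN
  have hsup : ∀ x, ‖mOp (φ j) f x‖ₑ ≤ D * (e2 (j * (n / P)) * N) := by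
    intro x
    have h1 := hD j ((2 : ℝ) ^ j • x)
    rw [gj_eLp] at h1
    have e : gj φ f j ((2 : ℝ) ^ j • x) = mOp (φ j) f x := by
      unfold gj; rw [smul_smul, inv_mul_cancel₀ (by positivity), one_smul]
    rwa [e] at h1
  have hNP : ∫⁻ x, ‖mOp (φ j) f x‖ₑ ^ P = N ^ P := by
    rw [hN, eLpNorm_eq_lintegral_rpow_enorm_toReal hp0.ne' hpt, one_div, rpow_inv_cancel' _ hP]
  have h2 : ∫⁻ x, ‖mOp (φ j) f x‖ₑ ≤ (D * (e2 (j * (n / P)) * N)) ^ (1 - P) * N ^ P := by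
    rw [← hNP, ← lintegral_const_mul]
    · refine lintegral_mono fun x => ?_
      calc ‖mOp (φ j) f x‖ₑ = ‖mOp (φ j) f x‖ₑ ^ (1 - P) * ‖mOp (φ j) f x‖ₑ ^ P := by
            rw [← ENNReal.rpow_add_of_nonneg _ _ (by linarith) hP.le]; simp
        _ ≤ _ := mul_le_mul' (ENNReal.rpow_le_rpow (hsup x) (by linarith)) le_rfl
    · exact (mOp_poly (φ j) f).1.enorm.measurable.pow_const _
  have h3 : (D * (e2 (j * (n / P)) * N)) ^ (1 - P) * N ^ P = D ^ (1 - P) * e2 (j * (n * (1 / P - 1))) * N := by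
    rw [ENNReal.mul_rpow_of_nonneg _ _ (by linarith), ENNReal.mul_rpow_of_nonneg _ _ (by linarith), e2_rpow]
    have e : N = N ^ (1 - P) * N ^ P := by
      rw [← ENNReal.rpow_add_of_nonneg _ _ (by linarith) hP.le]; simp
    conv_rhs => rw [e]
    have e2' : (j : ℝ) * (n / P) * (1 - P) = j * (n * (1 / P - 1)) := by field_simp
    rw [e2']; ring
  calc _ ≤ ∫⁻ x, (⨆ x, ‖ψ x‖ₑ) * ‖mOp (φ j) f x‖ₑ :=
        lintegral_mono fun x => mul_le_mul' (le_iSup (fun x => ‖ψ x‖ₑ) x) le_rfl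
    _ = (⨆ x, ‖ψ x‖ₑ) * ∫⁻ x, ‖mOp (φ j) f x‖ₑ :=
        lintegral_const_mul _ (mOp_poly (φ j) f).1.enorm.measurable
    _ ≤ (⨆ x, ‖ψ x‖ₑ) * (D ^ (1 - P) * e2 (j * (n * (1 / P - 1))) * (e2 (-(j * s)) * besovNorm s p q φ f)) := by
        rw [h3] at h2
        exact mul_le_mul' le_rfl (h2.trans (mul_le_mul' le_rfl (mOp_eLp_le hq φ f j)))
    _ = _ := by
        have : e2 (-(j * (s - n * (1 / P - 1)))) = e2 (j * (n * (1 / P - 1))) * e2 (-(j * s)) := by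
          rw [← e2_add]; congr 1; ring
        rw [this]; ring

lemma geo_nat {δ : ℝ} (hδ : 0 < δ) {C : ℝ≥0∞} (hC : C ≠ ∞) : ∑' j : ℕ, C * e2 (-(j * δ)) ≠ ∞ := by
  rw [ENNReal.tsum_mul_left]
  refine ENNReal.mul_ne_top hC (ne_top_of_le_ne_top (geo_ne_top hδ) (le_trans (le_of_eq ?_) (geo_right δ 0)))
  refine tsum_congr fun j => ?_
  congr 2
  rw [Nat.cast_zero, sub_zero, Nat.abs_cast, mul_comm]

lemma mOp_sum {s : ℝ} {p q : ℝ≥0∞} (hp0 : 0 < p) (hq : 0 < q) (hs : sigmaP n p < s) (φ : ℕ → Sch n) (f : TDist n E)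
    {D : ℝ≥0∞} (hDt : D ≠ ∞) (hD : ∀ j x, ‖gj φ f j x‖ₑ ≤ D * eLpNorm (gj φ f j) p volume)
    (hf : besovNorm s p q φ f ≠ ∞) (ψ : Sch n) :
    ∑' j, ∫⁻ x, ‖ψ x‖ₑ * ‖mOp (φ j) f x‖ₑ ≠ ∞ := by
  rcases le_or_gt 1 p with h | h
  · have h1 : eLpNorm ψ p.conjExponent (volume : Measure (Rn n)) ≠ ∞ := (ψ.memLp p.conjExponent volume).eLpNorm_ne_top
    have h2 := mOp_sum_big (s := s) h hq φ f ψ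
    have hs0 : 0 < s := lt_of_le_of_lt (le_max_right _ _) hs
    have h3 := geo_nat hs0 (ENNReal.mul_ne_top h1 hf)
    exact ne_top_of_le_ne_top h3 (ENNReal.tsum_le_tsum h2)
  · have hP1 : p.toReal ≤ 1 := ENNReal.toReal_le_of_le_ofReal zero_le_one (by simpa using h.le)
    have h0 : (⨆ x, ‖ψ x‖ₑ) ≠ ∞ := by
      obtain ⟨C, hC⟩ := ψ.decay 0 0
      refine ne_top_of_le_ne_top (ENNReal.ofReal_ne_top (r := C)) (iSup_le fun x => ?_)
      rw [← ofReal_norm]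
      exact ENNReal.ofReal_le_ofReal (by simpa using hC.2 x)
    have h1 : D ^ (1 - p.toReal) ≠ ∞ := ENNReal.rpow_ne_top_of_nonneg (by linarith) hDt
    have h2 := mOp_sum_small (s := s) hp0 h hq φ f hD ψ
    have hs0 : 0 < s - n * (1 / p.toReal - 1) := sub_pos.2 (lt_of_le_of_lt (le_max_left _ _) hs)
    have h3 := geo_nat hs0 (ENNReal.mul_ne_top h0 (ENNReal.mul_ne_top h1 hf))
    exact ne_top_of_le_ne_top h3 (ENNReal.tsum_le_tsum h2)


lemma rep_key (φ : ℕ → Sch n) (ψ : Sch n) (f : TDist n E) (j : ℕ) (x : Rn n) :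
    ((2 * π) ^ ((n : ℝ) / 2) : ℝ) • (ψ x • mOp (φ j) f x) =
      ψ x • f.toFun (shiftReflect (invFourierS (φ j)) x) := by
  have e : mOp (φ j) f x = ((2 * π) ^ (-(n : ℝ) / 2) : ℝ) • f.toFun (shiftReflect (invFourierS (φ j)) x) := rfl
  have e2 : ((2 * π) ^ ((n : ℝ) / 2) : ℝ) * ((2 * π) ^ (-(n : ℝ) / 2) : ℝ) = 1 := by
    rw [← Real.rpow_add (by positivity), neg_div, add_neg_cancel, Real.rpow_zero]
  rw [e, smul_comm (ψ x), smul_smul, e2, one_smul]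

lemma represents [CompleteSpace E] {φ : ℕ → Sch n} (hφ : SmoothResolution n φ) (f : TDist n E) {η : Sch n}
    {r : Rn n → ℝ} (hr0 : ∀ x, 0 ≤ r x) (hηr : ∀ x, η x = (r x : ℂ))
    (hsum : ∀ x, HasSum (fun m : Fin n → ℤ => r (x - zpt m)) 1)
    (lam : ℕ → (Fin n → ℤ) → ℂ) (a : ℕ → (Fin n → ℤ) → Rn n → E)
    (hla : ∀ j m x, lam j m • a j m x =
      ((2 * π) ^ ((n : ℝ) / 2) : ℝ) • (η ((2 : ℝ) ^ j • x - zpt m) • mOp (φ j) f x))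
    (hfin : ∀ ψ : Sch n, ∑' j, ∫⁻ x, ‖ψ x‖ₑ * ‖mOp (φ j) f x‖ₑ ≠ ∞) :
    RepresentsAtomic f lam a := by
  intro ψ
  set c : ℝ := (2 * π) ^ ((n : ℝ) / 2) with hc
  have hc0 : 0 < c := by positivity
  set G : ℕ × (Fin n → ℤ) → Rn n → E := fun z x =>
    r ((2 : ℝ) ^ z.1 • x - zpt z.2) • (c • (ψ x • mOp (φ z.1) f x)) with hG
  have hrη : ∀ x, r x = (η x).re := fun x => by rw [hηr]; simp
  have hrc : Continuous r := by
    have : r = fun x => (η x).re := funext hrη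
    rw [this]; exact Complex.continuous_re.comp η.continuous
  have hmc : ∀ j, Continuous (mOp (φ j) f) := fun j => (mOp_poly (φ j) f).1
  have hGc : ∀ z, Continuous (G z) := fun z => by
    have h1 := hmc z.1
    have h2 := ψ.continuous
    have h3 : Continuous fun x : Rn n => r ((2 : ℝ) ^ z.1 • x - zpt z.2) := hrc.comp (by fun_prop)
    exact h3.smul ((h2.smul h1).const_smul c)
  have hterm : ∀ z : ℕ × (Fin n → ℤ), lam z.1 z.2 • ∫ x : Rn n, ψ x • a z.1 z.2 x = ∫ x, G z x := by
    intro z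
    rw [← integral_smul]
    refine integral_congr_ae (Eventually.of_forall fun x => ?_)
    simp only [hG]
    rw [smul_comm (lam z.1 z.2), hla, hηr, Complex.coe_smul]
    rw [smul_comm (ψ x) c, smul_comm (ψ x) (r _), smul_comm c (r _)]
  have hGn : ∀ z x, ‖G z x‖ₑ = ENNReal.ofReal c * (‖ψ x‖ₑ * ‖mOp (φ z.1) f x‖ₑ) *
      ENNReal.ofReal (r ((2 : ℝ) ^ z.1 • x - zpt z.2)) := by
    intro z x
    simp only [hG, enorm_smul]
    rw [Real.enorm_of_nonneg (hr0 _), Real.enorm_of_nonneg hc0.le]; ring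
  have hrs : ∀ x : Rn n, ∑' m : Fin n → ℤ, ENNReal.ofReal (r (x - zpt m)) = 1 := by
    intro x
    rw [← ENNReal.ofReal_tsum_of_nonneg (fun m => hr0 _) (hsum x).summable, (hsum x).tsum_eq, ENNReal.ofReal_one]
  have hj : ∀ j, ∑' m, ∫⁻ x, ‖G (j, m) x‖ₑ = ENNReal.ofReal c * ∫⁻ x, ‖ψ x‖ₑ * ‖mOp (φ j) f x‖ₑ := by
    intro j
    rw [← lintegral_tsum fun m => (hGc (j, m)).enorm.measurable.aemeasurable, ← lintegral_const_mul]
    · refine lintegral_congr fun x => ?_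
      simp only [hGn]
      rw [ENNReal.tsum_mul_left, hrs, mul_one]
    · exact (ψ.continuous.enorm.measurable).mul (hmc j).enorm.measurable
  have htot : ∑' z, ∫⁻ x, ‖G z x‖ₑ ≠ ∞ := by
    rw [ENNReal.tsum_prod (f := fun j m => ∫⁻ x, ‖G (j, m) x‖ₑ)]
    simp only [hj]
    rw [ENNReal.tsum_mul_left]
    exact ENNReal.mul_ne_top ENNReal.ofReal_ne_top (hfin ψ)
  have hGi : ∀ z, Integrable (G z) := fun z =>
    ⟨(hGc z).aestronglyMeasurable, lt_top_iff_ne_top.2 (ENNReal.ne_top_of_tsum_ne_top htot z)⟩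
  have hnorm : Summable fun z => ∫ x, ‖G z x‖ := by
    have h1 : ∀ z, ∫ x, ‖G z x‖ = (∫⁻ x, ‖G z x‖ₑ).toReal := fun z =>
      integral_norm_eq_lintegral_enorm (hGc z).aestronglyMeasurable
    simp only [h1]
    exact ENNReal.summable_toReal htot
  have hS := hasSum_integral_of_summable_integral_norm hGi hnorm
  have hfib : ∀ j, HasSum (fun m => ∫ x, G (j, m) x)
      (f.toFun (fourierS (smulLeftCLM ℂ (φ j) (invFourierS ψ)))) := by
    intro j
    have h1 := hasSum_integral_of_summable_integral_norm (F := fun m => G (j, m)) (fun m => hGi (j, m))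
      (hnorm.comp_injective (Prod.mk_right_injective j))
    have h2 : ∫ x, ∑' m, G (j, m) x = f.toFun (fourierS (smulLeftCLM ℂ (φ j) (invFourierS ψ))) := by
      rw [← td_ex]
      refine integral_congr_ae (Eventually.of_forall fun x => ?_)
      have h3 := (hsum ((2 : ℝ) ^ j • x)).smul_const (c • (ψ x • mOp (φ j) f x))
      have h4 : ∑' m, G (j, m) x = c • (ψ x • mOp (φ j) f x) := by
        rw [← one_smul ℝ (c • (ψ x • mOp (φ j) f x))]; exact h3.tsum_eq
      simp only [h4]
      exact rep_key φ ψ f j x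
    rwa [h2] at h1
  have h5 := hS.prod_fiberwise hfib
  have h6 := h5.unique (td_res hφ f ψ)
  rw [h6] at hS
  simpa only [hterm] using hS

lemma dir2 [CompleteSpace E] {φ : ℕ → Sch n} (hφ : SmoothResolution n φ) {p q : ℝ≥0∞} (hp : 0 < p)
    (hq : 0 < q) {s : ℝ} (hs : sigmaP n p < s) (K : ℕ) {d : ℝ} (hd : 1 < d) :
    ∃ C : ℝ≥0∞, C ≠ ∞ ∧ ∀ f : TDist n E, besovNorm s p q φ f ≠ ∞ →
      ∃ (lam : ℕ → (Fin n → ℤ) → ℂ) (a : ℕ → (Fin n → ℤ) → Rn n → E),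
        (∀ m, Is1Atom K d m (a 0 m)) ∧
        (∀ ν m, 0 < ν → IsSPAtom s p K (-1) d ν m (a ν m)) ∧
        bNorm p q lam ≤ C * besovNorm s p q φ f ∧ RepresentsAtomic f lam a := by
  obtain ⟨η, r, hr0, hηr, hη, hsum⟩ := exists_eta n hd
  obtain ⟨A, hA, C1, hC1, h1⟩ := PP_all (E := E) hp (invFourierS (theta n))
  obtain ⟨C2, hC2, h2⟩ := atom_bd (E := E) hA K η (invFourierS (theta n))
  set C₀ : ℝ := C2.toReal + 1 with hC₀d
  have hC₀ : 0 < C₀ := by positivity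
  have hC2' : C2 ≤ ENNReal.ofReal C₀ := by
    rw [hC₀d]
    calc C2 = ENNReal.ofReal C2.toReal := (ENNReal.ofReal_toReal hC2).symm
      _ ≤ _ := ENNReal.ofReal_le_ofReal (by linarith)
  refine ⟨ENNReal.ofReal ((2 * π) ^ ((n : ℝ) / 2)) * ENNReal.ofReal C₀ * C1,
    ENNReal.mul_ne_top (ENNReal.mul_ne_top ENNReal.ofReal_ne_top ENNReal.ofReal_ne_top) hC1, fun f hf => ?_⟩
  have P1 := fun j => h1 (gj φ f j) (gj_poly φ f j) (gj_rep hφ f j)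
  have P2 := fun j => h2 (gj φ f j) (gj_poly φ f j) (gj_rep hφ f j)
  have hfinj : ∀ j, eLpNorm (gj φ f j) p volume ≠ ∞ := fun j => by
    rw [gj_eLp]
    exact ENNReal.mul_ne_top (e2_ne_top _) (ne_top_of_le_ne_top (ENNReal.mul_ne_top (e2_ne_top _) hf)
      (mOp_eLp_le (s := s) hq φ f j))
  have hTT : ∀ j z, TT A (gj φ f j) z ≠ ∞ := fun j z =>
    ne_top_of_le_ne_top (ENNReal.mul_ne_top hC1 (hfinj j)) ((P1 j).1 z)
  have hat := fun j m => atom_ok (d := d) (K := K) (j := j) (ρ := s - n / p.toReal) (E := E) hC₀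
    (ENNReal.toReal_nonneg (a := TT A (gj φ f j) (zpt m))) hη (P2 j).1 m (by
      intro l hl x
      have := (P2 j).2.2 (zpt m) l hl x
      rw [← ENNReal.ofReal_le_ofReal_iff (by positivity), ofReal_norm, ENNReal.ofReal_mul hC₀.le,
        ENNReal.ofReal_toReal (hTT j _)]
      exact this.trans (mul_le_mul' hC2' le_rfl)) (atC A C₀ s p η φ f j m) rfl
  refine ⟨lamC A C₀ s p φ f, atC A C₀ s p η φ f, fun m => ?_, fun j m hj => ?_,
    lamC_bNorm hC₀.le hp hq φ f fun j => (P1 j).2, ?_⟩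
  · obtain ⟨b1, b2, b3, -⟩ := hat 0 m
    refine ⟨b1, b2, fun α hα x => ?_⟩
    simpa using b3 α hα x
  · obtain ⟨b1, b2, b3, -⟩ := hat j m
    refine ⟨b1, b2, b3, fun β hβ => ?_⟩
    exfalso; omega
  · refine represents hφ f hr0 hηr hsum _ _ (fun j m x => ?_)
      (mOp_sum hp hq hs φ f (D := C2 * C1) (ENNReal.mul_ne_top hC2 hC1) (fun j x => ?_) hf)
    · have h := (hat j m).2.2.2 x
      rw [lamC, Complex.coe_smul, mul_smul, h]
      congr 2
      unfold gj; rw [smul_smul, inv_mul_cancel₀ (by positivity), one_smul]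
    · have h := (P2 j).2.1 x x
      rw [sub_self, norm_zero, add_zero, Real.one_rpow, ENNReal.ofReal_one, mul_one] at h
      rw [mul_assoc]
      exact h.trans (mul_le_mul' le_rfl ((P1 j).1 x))


/-- atomic characterization of `B^s_{p,q}(E)` without moment
conditions, for `n/(n+1) < p ≤ ∞` and `s > σ_p`. -/
theorem statement15 (n : ℕ) (E : Type*) [NormedAddCommGroup E] [NormedSpace ℂ E]
    [CompleteSpace E] (p q : ℝ≥0∞) (hp : ENNReal.ofReal ((n : ℝ) / ((n : ℝ) + 1)) < p)
    (hq : 0 < q) (s : ℝ) (hs : sigmaP n p < s)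
    (d : ℝ) (hd : 1 < d) (K : ℕ) (hK : 1 + ⌊s⌋ ≤ (K : ℤ))
    (φ : ℕ → Sch n) (hφ : SmoothResolution n φ) :
    (∀ f : TDist n E, besovNorm s p q φ f < ∞ ↔
      ∃ (lam : ℕ → (Fin n → ℤ) → ℂ) (a : ℕ → (Fin n → ℤ) → Rn n → E),
        (∀ m, Is1Atom K d m (a 0 m)) ∧
        (∀ ν m, 0 < ν → IsSPAtom s p K (-1) d ν m (a ν m)) ∧
        bNorm p q lam < ∞ ∧ RepresentsAtomic f lam a) ∧
    ∃ c₁ > (0 : ℝ), ∃ c₂ > (0 : ℝ), ∀ f : TDist n E, besovNorm s p q φ f < ∞ →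
      ENNReal.ofReal c₁ * besovNorm s p q φ f ≤ sInf (atomRepSetB s p q K d f) ∧
      sInf (atomRepSetB s p q K d f) ≤ ENNReal.ofReal c₂ * besovNorm s p q φ f := by
  have hp0 : 0 < p := lt_of_le_of_lt bot_le hp
  have hsK : s < K := by
    have h1 := Int.lt_floor_add_one s
    have h2 : ((1 + ⌊s⌋ : ℤ) : ℝ) ≤ ((K : ℤ) : ℝ) := Int.cast_le.2 hK
    push_cast at h2
    linarith
  obtain ⟨C1, hC1, h1⟩ := dir1 (E := E) hφ hp0 hq hs hsK (by linarith : (0 : ℝ) ≤ d)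
  obtain ⟨C2, hC2, h2⟩ := dir2 (E := E) hφ hp0 hq hs K hd
  refine ⟨fun f => ⟨fun hf => ?_, ?_⟩, (C1.toReal + 1)⁻¹, by positivity, C2.toReal + 1, by positivity,
    fun f hf => ⟨?_, ?_⟩⟩
  · obtain ⟨lam, a, ha0, ha, hb, hr⟩ := h2 f hf.ne
    exact ⟨lam, a, ha0, ha, lt_of_le_of_lt hb (ENNReal.mul_lt_top hC2.lt_top hf), hr⟩
  · rintro ⟨lam, a, ha0, ha, hb, hr⟩
    exact lt_of_le_of_lt (h1 f lam a ha0 ha hr) (ENNReal.mul_lt_top hC1.lt_top hb)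
  · refine le_sInf ?_
    rintro _ ⟨lam, a, ha0, ha, hb, hr, rfl⟩
    have hC1' : C1 ≤ ENNReal.ofReal (C1.toReal + 1) := by
      calc C1 = ENNReal.ofReal C1.toReal := (ENNReal.ofReal_toReal hC1).symm
        _ ≤ _ := ENNReal.ofReal_le_ofReal (by linarith)
    calc _ ≤ ENNReal.ofReal (C1.toReal + 1)⁻¹ * (ENNReal.ofReal (C1.toReal + 1) * bNorm p q lam) :=
          mul_le_mul' le_rfl ((h1 f lam a ha0 ha hr).trans (mul_le_mul' hC1' le_rfl))
      _ = bNorm p q lam := by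
          rw [← mul_assoc, ← ENNReal.ofReal_mul (by positivity), inv_mul_cancel₀ (by positivity),
            ENNReal.ofReal_one, one_mul]
  · obtain ⟨lam, a, ha0, ha, hb, hr⟩ := h2 f hf.ne
    have hC2' : C2 ≤ ENNReal.ofReal (C2.toReal + 1) := by
      calc C2 = ENNReal.ofReal C2.toReal := (ENNReal.ofReal_toReal hC2).symm
        _ ≤ _ := ENNReal.ofReal_le_ofReal (by linarith)
    have hmem : bNorm p q lam ∈ atomRepSetB s p q K d f :=
      ⟨lam, a, ha0, ha, lt_of_le_of_lt hb (ENNReal.mul_lt_top hC2.lt_top hf), hr, rfl⟩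
    exact (sInf_le hmem).trans (hb.trans (mul_le_mul' hC2' le_rfl))

end
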